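/- The edge-inducibility constant λ_{5,2} equals 280/729. Moreover, the problem of maximising λ_{5,2} is perfectly stable with respect to the family of all blowups of 3K_3, i.e., the family of graphs that are vertex-disjoint unions of three complete multipartite graphs each having at most three (possibly empty) parts. -/

import Mathlib

open Finset
open scoped Classical

/-- Number of edges of `G` inside the vertex subset `S`. -/
noncomputable def edgeCount {n : ℕ} (G : SimpleGraph (Fin n)) (S : Finset (Fin n)) : ℕ :=
  (Finset.univ.filter (fun p : Fin n × Fin n =>
    p.1 ∈ S ∧ p.2 ∈ S ∧ p.1 < p.2 ∧ G.Adj p.1 p.2)).card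

/-- `Λ_{κ,ℓ}(G)`: number of `κ`-subsets of vertices inducing exactly `ℓ` edges. -/
noncomputable def numKL (κ ℓ : ℕ) {n : ℕ} (G : SimpleGraph (Fin n)) : ℕ :=
  ((Finset.powersetCard κ Finset.univ).filter (fun S => edgeCount G S = ℓ)).card

/-- `λ_{κ,ℓ}(G) = Λ_{κ,ℓ}(G) / C(n,κ)`. -/
noncomputable def lamKL (κ ℓ : ℕ) {n : ℕ} (G : SimpleGraph (Fin n)) : ℝ :=
  (numKL κ ℓ G : ℝ) / (n.choose κ : ℝ)

/-- `λ_{κ,ℓ}(n)`: the maximum of `λ_{κ,ℓ}(G)` over all graphs on `n` vertices. -/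
noncomputable def lamKLmax (κ ℓ n : ℕ) : ℝ :=
  ⨆ G : SimpleGraph (Fin n), lamKL κ ℓ G

/-- Edit distance between two graphs on `Fin n`: the minimum over bijections of the number
of vertex pairs whose adjacency must be changed in `G` to obtain a graph isomorphic to `H`. -/
noncomputable def editDist {n : ℕ} (G H : SimpleGraph (Fin n)) : ℕ :=
  ⨅ σ : Equiv.Perm (Fin n),
    (Finset.univ.filter (fun p : Fin n × Fin n =>
      p.1 < p.2 ∧ ¬ (G.Adj p.1 p.2 ↔ H.Adj (σ p.1) (σ p.2)))).card

/-- Edit distance of `G` to the family of `n`-vertex graphs satisfying `P`. -/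
noncomputable def distToFam {n : ℕ} (G : SimpleGraph (Fin n))
    (P : SimpleGraph (Fin n) → Prop) : ℕ :=
  ⨅ H : {H : SimpleGraph (Fin n) // P H}, editDist G H.1

/-- A blowup of `3K₃`: a vertex-disjoint union of three complete multipartite graphs,
each with at most three (possibly empty) parts. -/
def isBlowup3K3 {n : ℕ} (G : SimpleGraph (Fin n)) : Prop :=
  ∃ c : Fin n → Fin 3 × Fin 3, ∀ u v,
    G.Adj u v ↔ ((c u).1 = (c v).1 ∧ (c u).2 ≠ (c v).2)


namespace EI

/-! ### Certificate data -/

structure Cert where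
  rows3 : ℕ → List (ℤ × ℕ)
  rows1 : List (ℤ × ℕ)
  mu : ℕ → ℤ
  cE : ℕ
  cX : ℤ
  cXX : ℤ
  cB : ℤ
  xd : ℤ
  xt : ℤ
  bound : ℕ

def offs : ℕ := 2 ^ 46

def tblF (r : ℕ) : ℕ := (788488389451756882872296372059041224014786235918276924475525112545269582358598444294407912131245831504356576386886994903608665097402960594843049318809856 >>> (8 * r)) % 256
def tblH (r : ℕ) : ℕ := (1314285581162890263754267649822294460344755639732205258033335264615485176387701395954056293209372008948180486998083426567407127847386598757269803590811904 >>> (8 * r)) % 256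
def tblB (r : ℕ) : ℕ := (69474476853286183311360746443175102763421913986890669452321942233296236288391 >>> (4 * r)) % 16
def tblBad (r : ℕ) : ℕ := (10837449231934480384 >>> r) % 2

def wv (row i : ℕ) : ℤ := Int.subNatNat ((row >>> (24 * i)) % 16777216) 8388608

def sos (L : List (ℤ × ℕ)) (i j : ℕ) : ℤ :=
  L.foldr (fun p acc => p.1 * (wv p.2 i * wv p.2 j) + acc) 0

def tcx (a b c : ℕ) : ℕ := a + 2 * b + 4 * c

def e3 (C : Cert) (t r r' : ℕ) : ℤ := sos (C.rows3 (tblB t)) (tblF r) (tblF r')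

def dvec (t : ℕ) : ℤ := Int.subNatNat (9 * (t % 2) + 9 * (t / 2 % 2)) 4
def tvec (t : ℕ) : ℤ := if t % 8 = 7 then 79 else -2

def e1 (C : Cert) (t t' : ℕ) : ℤ :=
  C.xd * (dvec t * dvec t') + (C.xt * (tvec t * tvec t') + sos C.rows1 (tblH t) (tblH t'))

def inA (d e : ℕ) : Bool := d % 2 == 1 || e % 2 == 1

def colA (p q : Bool) (l : ℕ) : ℤ :=
  match p with
  | false => 0
  | true => match q with
    | true => if l / 8 = 1 then 0 else if l % 2 = 1 then -2 else 1
    | false => if l / 8 = 1 then (if l % 2 = 1 then 4 else -2) else 0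

def eA (C : Cert) (t : ℕ) (p q : Bool) (l : ℕ) : ℤ := C.mu t * colA p q l

def crossE (a : ℕ) : Bool := a == 1

def eX (C : Cert) (a f : ℕ) : ℤ :=
  match crossE a with
  | false => 0
  | true => match crossE f with
    | true => C.cX - C.cXX
    | false => C.cX

def eB (C : Cert) (t r : ℕ) : ℤ := if tblBad (t % 8 + 8 * (r % 8)) = 1 then C.cB else 0

def off (x : ℤ) : ℕ := (x + (offs : ℤ)).toNat

def fN (C : Cert) (a b c d e f g h k l : ℕ) : ℕ :=
  off (e3 C (tcx a b c) (tcx d e f) (tcx g h k)) +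
  (off (e1 C (tcx a b c) (tcx d g l)) +
  (off (eA C (tcx a b c) (inA d e) (inA g h) l) +
  (off (eX C a f) + off (eB C (tcx a b c) (tcx d e f)))))

def sy1 (F : ℕ → ℕ → ℕ → ℕ → ℕ → ℕ → ℕ → ℕ → ℕ → ℕ → ℕ) (a b c d e f g h k l : ℕ) : ℕ :=
  F a b c d e f g h k l + F a c b e d f h g k l
def sy2 (F : ℕ → ℕ → ℕ → ℕ → ℕ → ℕ → ℕ → ℕ → ℕ → ℕ → ℕ) (a b c d e f g h k l : ℕ) : ℕ :=
  sy1 F a b c d e f g h k l + (sy1 F b a c d f e g k h l + sy1 F c b a f e d k h g l)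
def sy3 (F : ℕ → ℕ → ℕ → ℕ → ℕ → ℕ → ℕ → ℕ → ℕ → ℕ → ℕ) (a b c d e f g h k l : ℕ) : ℕ :=
  sy2 F a b c d e f g h k l + (sy2 F a d e b c f g h l k +
    (sy2 F d b f a e c g l k h + sy2 F e f c d a b l h k g))
def sy4 (F : ℕ → ℕ → ℕ → ℕ → ℕ → ℕ → ℕ → ℕ → ℕ → ℕ → ℕ) (a b c d e f g h k l : ℕ) : ℕ :=
  sy3 F a b c d e f g h k l + (sy3 F a b c g h k d e f l + (sy3 F a g h d e l b c k f +
    (sy3 F g b k d l f a h c e + sy3 F h k c l e f g a b d)))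

def e2N (a b c d e f g h k l : ℕ) : ℕ :=
  if a % 2 + b % 2 + c % 2 + d % 2 + e % 2 + f % 2 + g % 2 + h % 2 + k % 2 + l % 2 = 2 then 1 else 0

def okN (C : Cert) (a b c d e f g h k l : ℕ) : Bool :=
  Nat.ble (120 * (C.cE * e2N a b c d e f g h k l) + sy4 (fN C) a b c d e f g h k l)
    (C.bound + 600 * offs)

def rows3_1 (b : ℕ) : List (ℤ × ℕ) :=
  if b = 0 then []
  else if b = 1 then [(1, 20139040336427554036067569706304509828352555521486689392045827058091180558953564698227296188350411217225472360129403)]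
  else if b = 2 then [(1, 19701004272468599575115054978131859811770904876206436552217234686443281077226713343218561264338497982588466734563328), (1, 19661898701837155924372091158970072026525182523673032167511031140856356354368835939200684506508144712263392169039558), (1, 19701004272468602510470230306264592190285805441271685746611138048191288398984539696942625623273215308252789109424128), (1, 20209630494037643724990291514752352059230288974455103678256742281245884156657012117574206362075153854409201946686945)]
  else if b = 3 then [(1, 125760671409802731496303470095949524425239801504437217218644150990861254050649833145338943770750693078197777285729449508495551340829223136174720615934230037475281353710601986), (1, 124392359274410915582208421247675848810964669708914535810775791083815061236120015593131010095194719030964619731444843525571012735216194524968791640837704583916114943584258579), (1, 123665222865365258822689923833142937526524224043721413188263334209977566840917336054926473417762197374467285013091216721605503670100964103081439478346289391257697481580871681)]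
  else if b = 4 then [(1, 127008540683101948641872857996719092520047489412016342242856491223435216160933153230745479308841163048357035097700368535493701506100136230670253335861690335196314812033031707), (1, 123665532207583904026822187057463137756381769906788988630803497628986121234630537492797911441602205025417527360201671310639523359813874122860477154468660569164920132026236906), (1, 123409079923259876806269385072222321531921825722426879667385286546053435345715092867446113330577091067405781965520375034719278736720817387760539381841427225172555179742983531)]
  else if b = 5 then [(1, 126082504642786710594202681489595502775998626153956212240587951826555407441239331007824223377880050581047913759396923457552952921515158236663600310626143939125311871473335498), (1, 123865139652862358643458291575057636924204639004321164088361376573225725814113813278856272971764623569948315735463649579448627853973826126854323105230562584401817548588291991)]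
  else if b = 6 then [(1, 124549597981371478071634539611591144495354771821412091031766089636871620270500198607095411754463421827820487327919010441175635923324813842007947303359438491703320843399471340), (1, 123511109580323595112005949795911806503083502357686452147902670050096572330183450947974086430497265911999525128072709286331965159746470629570609303835986780770461800713917588), (1, 122776307320475492231272636095207887636030946896987480033689619077556080358258484991718520159438912375795275914823900656700678195919390460579801118705402515744601081028514318), (1, 123703080689658191683200337043530243563859602879210925048226210891237505139445775142398297917907512818459027744719188559080385228550721010684762822486242804049550420782066299)]
  else if b = 7 then [(1, 782917706133464160929391526779261999571810040946180498261100596612668443986168208603698602920497144741148767201857820364966861723536198660718939130164085025797863325284223079961789245914434080540159488970139747898124406004863950888), (1, 776259184824009435601118835043811673679421336255828297249945482199920816093433573909135445272913500616203636197150358569537256867442685018745026277529061176080335908484735798450336005533976282781491836901497470018109762520980914176), (1, 764186770163317650717633808673110091472552443037453004215330692319521039618360418240302799259218949205287210473239469340718700806555976688030703951420572881426698781024770081656356884928194468829566800971384880694969202546128715776), (1, 776984677344119601314027691080487037017000548658156404649039714049504545999555790532857829096097296621037497242116405851174442789187502752245874534533928725751503892383180934348574523453169518801695557155846849744997318374033719296),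 (1, 773199532044711661401010440963867074195196021698952913288022071500359415545112872232393010670070294027935204592142899932106462328583911681051026323444820332007449098704054687130918701345272494491081185751817355638981893223757120985), (1, 774692713451067891678189790744305114801281640237725254971992879026764217494279003393515128189744274354713107071256912814171506207321837301416255755207108507236563589493935519099147899276789364085943953949034910502828068456403828736), (1, 765527450890971002207641054464614511719142373192908944934238368886909350363383497279903695700041773266421395564858999699407054327240089253577383027286647545573067628267614447716520645307965319497021697983301722924528737556327563265), (1, 775433104390321141248409514040671472638540914371561019535818349585718365698140357324905460881708745702956088909439225055763907866731434977604526085453106257993698816813445505802574737480384712921605589611931117743060548930871754752), (1, 778216718589118227036359364767601321224778407741982493628294269053525354549055510728328089140285493489753077696153055168048770167628095781097852320642550565580149603677952169339400750105025833587184440424216661632837116845801603072)]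
  else if b = 8 then [(1, 757201501487913062440586316218346215554150647408262211875277184757690607621449572254598702014411342223467252748756750442058979272075777961557159299723894937059403052700855151588313587874294520680357065603629235860958691930285551954), (1, 771891704069171770618574848626276104429589876159463140048400358887560472713379250541243682861748061563230156371501150668846027250251670189078597395769298365398996851681083571874120749724761261877802726963029852533697177076222656524), (1, 770282756234561063219739722663167458449540526846417224422240005493195415618049238954024920529026527607489429640542975127207193006040545355310789567961061108543235447430929179347492383382690486748817043778331030230789408528399335361), (1, 774755361479815413963574463678892191648714327633104800007488431592435238452180877851044673300624131904393544635663883383720319043480134814854425395752816331824279396527402460980893146898415702597984734513636490448997262226110817713), (1, 781145986625547734170611404997702437579166956849070239063124409176886297180678379526941180842780623883838457125072489104202746159755610581855054329301224530354789191105603804897833468832988555421397937829973749624159469379734497403), (1, 775309937602302321020217599865676448368383087136207224998296479520478846318999685507086800739705461235989636581478712208857664918546026543463245022401628574826726377956654174413504558810884124516805707949851665923937695302084985340)]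
  else []
def rows1_1 : List (ℤ × ℕ) := [(1, 34886689082522184320343474995185095879909997668441794289557466483107135855094519844824771005443523373132275036630980637059162673229546219216721455612579077916553788158380836307297026179638), (1, 34941130693744786790671480671536427265145957347336488452007328169991502384230602810736967594573984900201547761512991382560354907695709241148203176171843677009704811752753355071368567238890), (1, 34853123620568889655751740915774403668711023600191837668214565495158132430573414587828449415650666695331183371666868138419042247962326632997130408339671034049773354624575122792877039573052), (1, 34884087341621379567486577967558896018961681139595370507707616095360070486857766001594065016241546935217055624174413482615643578934784703145939547005502186079719539505219284728953981358979), (1, 34752373383635067305755118825927621488875342282981178869279580289372223392065304360924719168452803453971771839629854389035288960450069017525257529522634710127976072157083854432903154899482), (1, 34834226739956279470066700548267829089981916251233467807275695078799963142052191925001328284518915407901833375713370022631794631931472502758077373585556288664885367045873763032786433739428)]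
def mu_1 (t : ℕ) : ℤ := if t = 1 then 41825506647 else if t = 3 then 2302031952 else if t = 5 then 2302031952 else if t = 7 then 8606340494 else if t = 9 then 27483465315 else if t = 15 then 8222167464 else if t = 17 then 20800292344 else if t = 21 then 1799011084 else if t = 23 then 6865727440 else if t = 33 then 20800292344 else if t = 35 then 1799011084 else if t = 39 then 6865727440 else if t = 57 then 26407852093 else 0
def rows3_2 (b : ℕ) : List (ℤ × ℕ) :=
  if b = 0 then [(2, 20401097820505006659469120962569260766222512004990955013507891268340997262229229100177034210785118903843253202608081)]
  else if b = 1 then [(2, 20078706207369279970650629473748661060915623333206037931199266309064491122498657909830726270251707765080483681642904), (2, 19182267608184006298481311479261887812959758937066018423984576921576188350297713554167614408658142971235078422705731), (2, 19701004368386503755973417866608015843202205112446782483096857367237112352956134311411458755124521453837521411637248)]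
  else if b = 2 then [(2, 19701027757895273263995721132115214483090798353858100494625329297478195624063228883837339775277348547594739376979966), (2, 19700999575383294226245783797476354903609247733827028468862464358724074017970083166039781834280574483840577826717696), (2, 19042733597222396589268430755992224961623397426190802834982284386107906041140001284599464225278103329437230362057126), (104409496, 19701004272468461001037112788358720037668074962838023389109429559886451954863677607589333787219208867946265132924928), (159915577, 19701001923926018211250271011641283088473583114922857083633136018191411671973462729972839083579296788020891576434688)]
  else if b = 3 then [(2, 115718968753206999714525212338326145983932452542260877942655272679744612712340653035326052572687720651640810724062419854494134141280727314331976072971734841936665276868751831), (2, 122951133325249983027914419924525462973597149606686656476997520039704683587887115610870399857736281566831408937047161765443149834977321055875789657159460133544225605727098643), (120701336, 123665208107573067356900649588933939804766964988944806765098165581224471613642553393075041079377018043981970377379207305201813105498430521179192410681214176141257737626451968), (151453022, 123665208107573067356900649588933939804766964988944806765019361568831682655217995312874753851796501340285792430071744890555545766365873216030767862565545486365670242833661952), (122211964, 123665208107573067356900649592055688355082957220326403994773125868383886318670687423633767197587150564990339657495674805154303298024529656255779442478423507253570602996334592), (147314284, 1236652081075730673569006495920556883550829572203264039948125278745802807978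82966463733910811392230304260805104163597990151607473072971523709500878067644013472599374848589825)]
  else if b = 4 then [(2, 129253738686633308940007568992706182936568485682178900929442401753663131357839102239675270306012917294922552878867438070227973784522352818735286533248230517434784136075677931), (2, 124128535598626165974178482022101090617335731439149147405823617041631833010178286076505559943466492431575113219928094265457905344904389857097963776764569567527139198174713735), (2, 124346378839822237434192693655563313637158206076739541665767107762975130879945112424270386141324942313712621635362317295296955626864552713909223846717926191268833623596329328), (100110045, 123665208107573067356900649592055688355082957220326403994773125868383886318670687423633767197587150566757186722274052857635865412086684336293840131687626363019732340254441472), (175665657, 123665208107573067356900649592055688355082957220326403994812527874580280797882966463733910811362587529416052263447474317851776226622853598673798835567886579582018260075282432), (99015913, 123665208107573067356900649592055688355082957220326403994773125868383886318670687423633767197616793339835092603524102700214792015754202936540760219206108546404151900149645312), (145568364, 123665208107573067356900649588933939804766964988944806765019361568831682655217995312874753851766858568974733613600079377559916663441273131611331671922682261102856884231077888), (169407972, 123665208107573067356900649592055688355082957220326403994812527874580280797882966463733910811392230302493958144697524160430702830290372198920718923086368762966437819970486272)]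
  else if b = 5 then [(2, 123665208110066788655761509498027188810206493952621438251615115954250192396341009628747270867302481925736700026652614564098940238787194750540458910123400446969262184783462166), (2, 123665208102350106534460116594272381202461900388051495884770410506589724026632687740593827958679981027043723767947363800351982310188506247753784580157516219746384562630873127), (2, 123665208107816462391875480975287829949769874314371186457062175856716383029445784119626915547410266663910924863930952849071811181647065298044441745532154765346770183453233404)]
  else if b = 6 then [(2, 123665208245144079337365172304167896247233576239623200135849467288279886510827866056351887647310200994885427079586145308833355088388084570826495326888009799787333142519345738), (2, 123665208105617982392484930439835835508303520322080329995440859277922630468034610211966711577730847400431143705717798910181325621042652298111743488999470009666508974979024761)]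
  else if b = 7 then [(2, 775987217263378421726700588674187385002821328261880159777262617120095043620302621198783245900150172950311926204896069187857185677207128345593928938958958205139542157262135918011518005055036382410322602855801814785597286110541643776), (2, 775760409041460394503641736090250118735640422824954464762351107448440345318814654607305766846758453870240147372700250002949211034782924472688803781933571115018484704225650153714367515836991895812148047120864949816317743843772465152), (148518909, 776259092419001924876221144495821066550578036835866866209307773863545566926760774412625017155462883315864635091641579387892982775281010697110148490740444686483093394849781708504315487219000074642000354656887023390890623179566350336), (153698482, 776259092419001924876221144495821066550577967218547871730257944823313262215653355589218659376520093059655146325490037528666468291022710627298392856099118681910129748389071202853985324953183232053162490245365617495471068846317633536), (126499467, 776259092419001924876221144495821066550577967218547871730257944823313262215653355589215537627969777067423764728260244362360719692880045656147533699139493310171309982768950909305125303755384932793619930037803001724502669489080369152), (147178501, 776259092419001924876221144495821066550577967218547871730752605626259471283774360631254832008040039765626188408088370474546514143093109390488166501261979400150505325620983175429624563050636907541976175932673955855624994105308741632)]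
  else if b = 8 then [(2, 776259092419001924876224953651979914672947389251626832019199235101797093491169642740864150489819282872309405854092237418102079716194136081325701620859876176128528084678877712005113159392068718852513114403366183701852093332904721934), (2, 776259092419001924876221707651658353773384125438949988456157223950872226818016820192256156346919167154917862686450872021348073398978112391385796793838229723487204664945021451023806770321728621789480028274479137801643839265573968618), (2, 776259092419001924876220794774344967592071516584732361856572042699176225566470478121153167386263160094066213106210422133523406099316343274522356093819796440493333552145908496073514777134961152049178267176427661487975985591430941206), (2, 776259092419001924876221303689641257250217807526647945902318401235275920791866216885057734442124507914991111723198737505229138924117904773060945591388636135047055231144338582980352408024402257830391942994411422495636065950736842755)]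
  else []
def rows1_2 : List (ℤ × ℕ) := [(2, 35029241534496724390379060130015181749299286274897716664673957476135603591403291260605746265428075334028493798132298592893440291763058378985400700114414119075761091206751025453436223071583), (2, 34795710934246659241041675488209511007016311626901206756411936658106821039926158447698695379040484602797583909929335250506006403003822546470575027112364012196433527858744786862969276333032), (2, 35361928972243699738612431641983191962617791219797086703330722342187164560145256067290079346685286893841013331198384606396110836400839266073079847131524879647433832547955232289543252068053), (2, 34903004975021110591826689966757124737518633355277318588948928058668357918194294992396962558373993130916398165700924180981440482645716445165563387049892674003793351516531327144956958601666), (2, 34921553336836918455040968420559108208752318218388950990579650705924357670214500667198544536479922074657947457324597511904171277700253005816967807896990765328008329528461582891519467053767), (2, 34759830069805107776176251222964774391538789290858666572329266666851602038903428440127345126741356054394260182260577244566834987231080833822688637525057707758116209562202719569856392334301), (129749261, 34808657422481987804432481022364703116237949156341686382819959701487465384660624546382969754342755253430145320013699279701129178928747668607797312476792343874473879935207442855738252197888), (145257116, 34808657422481987804432481021486009015741237356321103712522004132871437252574892951176763761509307444269164596085489285227703236503859867733630082301902972223755940423149325811046137462784), (164900492, 34808661571997556685425439533893872706902382125270235322974441364673251388104844267936709523241283633230634950575617037712603383012399024925151747010471551615381693276506831259323196243968),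 (144859204, 34808661571996814694221020220291691199339323183700129928927137730475621136517062774165220543705314763684260587369210683267622925143192553302671496106474871325723815756467232840691960774656), (149936792, 34808661571997556685425439531257790405412227994717185416127186369902844201640063589681290846993192203397499549667370882750636232019100198183065670367470957124531405423437648615526342066176)]
def mu_2 (t : ℕ) : ℤ := if t = 9 then 85423690688 else if t = 17 then 201384649746 else if t = 33 then 201384649746 else if t = 57 then 685169582582 else if t = 59 then 193012052418 else if t = 61 then 193012052418 else 0

def cert1 : Cert where
  rows3 := rows3_1
  rows1 := rows1_1
  mu := mu_1
  cE := 14580000000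
  cX := 729000000
  cXX := 0
  cB := 0
  xd := 0
  xt := 0
  bound := 672368108544

def cert2 : Cert where
  rows3 := rows3_2
  rows1 := rows1_2
  mu := mu_2
  cE := 145800000000
  cX := 7823385882
  cXX := 1738530196000
  cB := 72900000
  xd := 7288562
  xt := 145800
  bound := 6720000000000
def stabT (b1 b2 b3 c1 c2 c3 : ℕ) : Bool := b1 == c1 && (b2 == c2 && b3 == c3)
def loop2 (s : ℕ) (f : ℕ → Bool) : Bool := if s = 0 then f 0 && f 1 else f 8 && f 9
def low01 (b1 b2 b3 c1 c2 c3 : ℕ) : Bool := Nat.blt (2*c1+4*b1+8*c2+16*b2+64*c3+128*b3) (2*b1+4*c1+8*b2+16*c2+64*b3+128*c3)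
def low02 (b1 b2 b3 c1 c2 c3 : ℕ) : Bool := Nat.blt (1*c1+4*b1+8*c2+32*b2+64*c3+256*b3) (1*b1+4*c1+8*b2+32*c2+64*b3+256*c3)
def low12 (b1 b2 b3 c1 c2 c3 : ℕ) : Bool := Nat.blt (1*c1+2*b1+16*c2+32*b2+128*c3+256*b3) (1*b1+2*c1+16*b2+32*c2+128*b3+256*c3)
def low03 (b1 b2 b3 c1 c2 c3 : ℕ) : Bool := Nat.blt (1*c1+16*b1+2*c2+32*b2+64*c3+512*b3) (1*b1+16*c1+2*b2+32*c2+64*b3+512*c3)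
def low13 (b1 b2 b3 c1 c2 c3 : ℕ) : Bool := Nat.blt (1*c1+8*b1+4*c2+32*b2+128*c3+512*b3) (1*b1+8*c1+4*b2+32*c2+128*b3+512*c3)
def low23 (b1 b2 b3 c1 c2 c3 : ℕ) : Bool := Nat.blt (2*c1+8*b1+4*c2+16*b2+256*c3+512*b3) (2*b1+8*c1+4*b2+16*c2+256*b3+512*c3)
def low04 (b1 b2 b3 c1 c2 c3 : ℕ) : Bool := Nat.blt (1*c1+128*b1+2*c2+256*b2+8*c3+512*b3) (1*b1+128*c1+2*b2+256*c2+8*b3+512*c3)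
def low14 (b1 b2 b3 c1 c2 c3 : ℕ) : Bool := Nat.blt (1*c1+64*b1+4*c2+256*b2+16*c3+512*b3) (1*b1+64*c1+4*b2+256*c2+16*b3+512*c3)
def low24 (b1 b2 b3 c1 c2 c3 : ℕ) : Bool := Nat.blt (2*c1+64*b1+4*c2+128*b2+32*c3+512*b3) (2*b1+64*c1+4*b2+128*c2+32*b3+512*c3)
def low34 (b1 b2 b3 c1 c2 c3 : ℕ) : Bool := Nat.blt (8*c1+64*b1+16*c2+128*b2+32*c3+256*b3) (8*b1+64*c1+16*b2+128*c2+32*b3+256*c3)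
def lowS (a b c d e f g h k l : ℕ) : Bool :=
  low01 b d g c e h || (low02 a d g c f k || (low12 a e h b f k || (low03 a b g e f l || (low13 a c h d f l || (low23 b c k d e l || (low04 a b d h k l || (low14 a c e g k l || (low24 b c f g h l || (low34 d e f g h k)))))))))
def lowA (sa sb sc sd se sf sg sh sk sl a b c d e f g h k l : ℕ) : Bool :=
  (stabT sb sd sg sc se sh && low01 b d g c e h) || ((stabT sa sd sg sc sf sk && low02 a d g c f k) || ((stabT sa se sh sb sf sk && low12 a e h b f k) || ((stabT sa sb sg se sf sl && low03 a b g e f l) || ((stabT sa sc sh sd sf sl && low13 a c h d f l) || ((stabT sb sc sk sd se sl && low23 b c k d e l) || ((stabT sa sb sd sh sk sl && low04 a b d h k l) || ((stabT sa sc se sg sk sl && low14 a c e g k l) || ((stabT sb sc sf sg sh sl && low24 b c f g h l) || ((stabT sd se sf sg sh sk && low34 d e f g h k))))))))))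
def chkA (C : Cert) (sa sb sc sd se sf sg sh sk sl : ℕ) : Bool :=
  loop2 sa fun a => loop2 sb fun b => loop2 sc fun c => loop2 sd fun d => loop2 se fun e => loop2 sf fun f => loop2 sg fun g => loop2 sh fun h => loop2 sk fun k => loop2 sl fun l =>
    lowA sa sb sc sd se sf sg sh sk sl a b c d e f g h k l || okN C a b c d e f g h k l
theorem chk1_0 : chkA cert1 0 0 0 0 0 0 0 0 0 0 = true := by decide +kernel
theorem chk1_1 : chkA cert1 8 0 0 0 0 0 0 0 0 0 = true := by decide +kernel
theorem chk1_7 : chkA cert1 8 8 8 0 0 0 0 0 0 0 = true := by decide +kernel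
theorem chk1_12 : chkA cert1 0 0 8 8 0 0 0 0 0 0 = true := by decide +kernel
theorem chk1_63 : chkA cert1 8 8 8 8 8 8 0 0 0 0 = true := by decide +kernel
theorem chk1_116 : chkA cert1 0 0 8 0 8 8 8 0 0 0 = true := by decide +kernel
theorem chk1_225 : chkA cert1 8 0 0 0 0 8 8 8 0 0 = true := by decide +kernel
theorem chk1_1023 : chkA cert1 8 8 8 8 8 8 8 8 8 8 = true := by decide +kernel
theorem chk2_0 : chkA cert2 0 0 0 0 0 0 0 0 0 0 = true := by decide +kernel
theorem chk2_1 : chkA cert2 8 0 0 0 0 0 0 0 0 0 = true := by decide +kernel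
theorem chk2_7 : chkA cert2 8 8 8 0 0 0 0 0 0 0 = true := by decide +kernel
theorem chk2_12 : chkA cert2 0 0 8 8 0 0 0 0 0 0 = true := by decide +kernel
theorem chk2_63 : chkA cert2 8 8 8 8 8 8 0 0 0 0 = true := by decide +kernel
theorem chk2_116 : chkA cert2 0 0 8 0 8 8 8 0 0 0 = true := by decide +kernel
theorem chk2_225 : chkA cert2 8 0 0 0 0 8 8 8 0 0 = true := by decide +kernel
theorem chk2_1023 : chkA cert2 8 8 8 8 8 8 8 8 8 8 = true := by decide +kernel
end EI

namespace EI
theorem sy4_01 (F : ℕ → ℕ → ℕ → ℕ → ℕ → ℕ → ℕ → ℕ → ℕ → ℕ → ℕ) (a b c d e f g h k l : ℕ) :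
    sy4 F a c b e d f h g k l = sy4 F a b c d e f g h k l := by
  simp only [sy4, sy3, sy2, sy1]; ring

theorem sy4_02 (F : ℕ → ℕ → ℕ → ℕ → ℕ → ℕ → ℕ → ℕ → ℕ → ℕ → ℕ) (a b c d e f g h k l : ℕ) :
    sy4 F c b a f e d k h g l = sy4 F a b c d e f g h k l := by
  simp only [sy4, sy3, sy2, sy1]; ring

theorem sy4_12 (F : ℕ → ℕ → ℕ → ℕ → ℕ → ℕ → ℕ → ℕ → ℕ → ℕ → ℕ) (a b c d e f g h k l : ℕ) :
    sy4 F b a c d f e g k h l = sy4 F a b c d e f g h k l := by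
  simp only [sy4, sy3, sy2, sy1]; ring

theorem sy4_03 (F : ℕ → ℕ → ℕ → ℕ → ℕ → ℕ → ℕ → ℕ → ℕ → ℕ → ℕ) (a b c d e f g h k l : ℕ) :
    sy4 F e f c d a b l h k g = sy4 F a b c d e f g h k l := by
  simp only [sy4, sy3, sy2, sy1]; ring

theorem sy4_13 (F : ℕ → ℕ → ℕ → ℕ → ℕ → ℕ → ℕ → ℕ → ℕ → ℕ → ℕ) (a b c d e f g h k l : ℕ) :
    sy4 F d b f a e c g l k h = sy4 F a b c d e f g h k l := by
  simp only [sy4, sy3, sy2, sy1]; ring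

theorem sy4_23 (F : ℕ → ℕ → ℕ → ℕ → ℕ → ℕ → ℕ → ℕ → ℕ → ℕ → ℕ) (a b c d e f g h k l : ℕ) :
    sy4 F a d e b c f g h l k = sy4 F a b c d e f g h k l := by
  simp only [sy4, sy3, sy2, sy1]; ring

theorem sy4_04 (F : ℕ → ℕ → ℕ → ℕ → ℕ → ℕ → ℕ → ℕ → ℕ → ℕ → ℕ) (a b c d e f g h k l : ℕ) :
    sy4 F h k c l e f g a b d = sy4 F a b c d e f g h k l := by
  simp only [sy4, sy3, sy2, sy1]; ring

theorem sy4_14 (F : ℕ → ℕ → ℕ → ℕ → ℕ → ℕ → ℕ → ℕ → ℕ → ℕ → ℕ) (a b c d e f g h k l : ℕ) :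
    sy4 F g b k d l f a h c e = sy4 F a b c d e f g h k l := by
  simp only [sy4, sy3, sy2, sy1]; ring

theorem sy4_24 (F : ℕ → ℕ → ℕ → ℕ → ℕ → ℕ → ℕ → ℕ → ℕ → ℕ → ℕ) (a b c d e f g h k l : ℕ) :
    sy4 F a g h d e l b c k f = sy4 F a b c d e f g h k l := by
  simp only [sy4, sy3, sy2, sy1]; ring

theorem sy4_34 (F : ℕ → ℕ → ℕ → ℕ → ℕ → ℕ → ℕ → ℕ → ℕ → ℕ → ℕ) (a b c d e f g h k l : ℕ) :
    sy4 F a b c g h k d e f l = sy4 F a b c d e f g h k l := by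
  simp only [sy4, sy3, sy2, sy1]; ring

theorem okN_01 (C : Cert) (a b c d e f g h k l : ℕ) :
    okN C a c b e d f h g k l = okN C a b c d e f g h k l := by
  unfold okN; rw [sy4_01]
  congr 4; unfold e2N; congr 2; ring

theorem okN_02 (C : Cert) (a b c d e f g h k l : ℕ) :
    okN C c b a f e d k h g l = okN C a b c d e f g h k l := by
  unfold okN; rw [sy4_02]
  congr 4; unfold e2N; congr 2; ring

theorem okN_12 (C : Cert) (a b c d e f g h k l : ℕ) :
    okN C b a c d f e g k h l = okN C a b c d e f g h k l := by
  unfold okN; rw [sy4_12]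
  congr 4; unfold e2N; congr 2; ring

theorem okN_03 (C : Cert) (a b c d e f g h k l : ℕ) :
    okN C e f c d a b l h k g = okN C a b c d e f g h k l := by
  unfold okN; rw [sy4_03]
  congr 4; unfold e2N; congr 2; ring

theorem okN_13 (C : Cert) (a b c d e f g h k l : ℕ) :
    okN C d b f a e c g l k h = okN C a b c d e f g h k l := by
  unfold okN; rw [sy4_13]
  congr 4; unfold e2N; congr 2; ring

theorem okN_23 (C : Cert) (a b c d e f g h k l : ℕ) :
    okN C a d e b c f g h l k = okN C a b c d e f g h k l := by
  unfold okN; rw [sy4_23]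
  congr 4; unfold e2N; congr 2; ring

theorem okN_04 (C : Cert) (a b c d e f g h k l : ℕ) :
    okN C h k c l e f g a b d = okN C a b c d e f g h k l := by
  unfold okN; rw [sy4_04]
  congr 4; unfold e2N; congr 2; ring

theorem okN_14 (C : Cert) (a b c d e f g h k l : ℕ) :
    okN C g b k d l f a h c e = okN C a b c d e f g h k l := by
  unfold okN; rw [sy4_14]
  congr 4; unfold e2N; congr 2; ring

theorem okN_24 (C : Cert) (a b c d e f g h k l : ℕ) :
    okN C a g h d e l b c k f = okN C a b c d e f g h k l := by
  unfold okN; rw [sy4_24]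
  congr 4; unfold e2N; congr 2; ring

theorem okN_34 (C : Cert) (a b c d e f g h k l : ℕ) :
    okN C a b c g h k d e f l = okN C a b c d e f g h k l := by
  unfold okN; rw [sy4_34]
  congr 4; unfold e2N; congr 2; ring

def vld (j : ℕ) : Prop := j = 0 ∨ j = 1 ∨ j = 8 ∨ j = 9
def st (j : ℕ) : ℕ := 8 * (j / 8)

theorem loop2_spec {j : ℕ} (hj : vld j) {f : ℕ → Bool} (h : loop2 (st j) f = true) : f j = true := by
  rcases hj with rfl | rfl | rfl | rfl <;> simp [loop2, st] at h <;> tauto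

theorem chkA_spec (C : Cert) (a b c d e f g h k l : ℕ) (ha : vld a) (hb : vld b) (hc : vld c) (hd : vld d) (he : vld e) (hf : vld f) (hg : vld g) (hh : vld h) (hk : vld k) (hl : vld l)
    (H : chkA C (st a) (st b) (st c) (st d) (st e) (st f) (st g) (st h) (st k) (st l) = true) :
    lowA (st a) (st b) (st c) (st d) (st e) (st f) (st g) (st h) (st k) (st l) a b c d e f g h k l = true ∨ okN C a b c d e f g h k l = true := by
  unfold chkA at H
  have H := loop2_spec ha H
  have H := loop2_spec hb H
  have H := loop2_spec hc H
  have H := loop2_spec hd H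
  have H := loop2_spec he H
  have H := loop2_spec hf H
  have H := loop2_spec hg H
  have H := loop2_spec hh H
  have H := loop2_spec hk H
  have H := loop2_spec hl H
  simpa using H

theorem stage1 (C : Cert) (N : ℕ) : ∀ (a b c d e f g h k l : ℕ), vld a → vld b → vld c → vld d → vld e → vld f → vld g → vld h → vld k → vld l →
    1 * a + 2 * b + 4 * c + 8 * d + 16 * e + 32 * f + 64 * g + 128 * h + 256 * k + 512 * l ≤ N → chkA C (st a) (st b) (st c) (st d) (st e) (st f) (st g) (st h) (st k) (st l) = true → okN C a b c d e f g h k l = true := by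
  induction N using Nat.strong_induction_on with
  | _ N ih =>
    intro a b c d e f g h k l ha hb hc hd he hf hg hh hk hl hN H
    rcases chkA_spec C a b c d e f g h k l ha hb hc hd he hf hg hh hk hl H with h1 | h1
    swap
    · exact h1
    simp only [lowA, stabT, low01, low02, low12, low03, low13, low23, low04, low14, low24, low34, Nat.blt, Bool.or_eq_true, Bool.and_eq_true, beq_iff_eq, Nat.ble_eq] at h1
    rcases h1 with ⟨⟨e1, e2, e3⟩, h1⟩ | ⟨⟨e1, e2, e3⟩, h1⟩ | ⟨⟨e1, e2, e3⟩, h1⟩ | ⟨⟨e1, e2, e3⟩, h1⟩ | ⟨⟨e1, e2, e3⟩, h1⟩ | ⟨⟨e1, e2, e3⟩, h1⟩ | ⟨⟨e1, e2, e3⟩, h1⟩ | ⟨⟨e1, e2, e3⟩, h1⟩ | ⟨⟨e1, e2, e3⟩, h1⟩ | ⟨⟨e1, e2, e3⟩, h1⟩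
    · rw [← okN_01]
      refine ih (1 * a + 2 * c + 4 * b + 8 * e + 16 * d + 32 * f + 64 * h + 128 * g + 256 * k + 512 * l) (by omega) a c b e d f h g k l ha hc hb he hd hf hh hg hk hl le_rfl ?_
      rw [e1, e2, e3] at H
      rw [e1, e2, e3]; exact H
    · rw [← okN_02]
      refine ih (1 * c + 2 * b + 4 * a + 8 * f + 16 * e + 32 * d + 64 * k + 128 * h + 256 * g + 512 * l) (by omega) c b a f e d k h g l hc hb ha hf he hd hk hh hg hl le_rfl ?_
      rw [e1, e2, e3] at H
      rw [e1, e2, e3]; exact H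
    · rw [← okN_12]
      refine ih (1 * b + 2 * a + 4 * c + 8 * d + 16 * f + 32 * e + 64 * g + 128 * k + 256 * h + 512 * l) (by omega) b a c d f e g k h l hb ha hc hd hf he hg hk hh hl le_rfl ?_
      rw [e1, e2, e3] at H
      rw [e1, e2, e3]; exact H
    · rw [← okN_03]
      refine ih (1 * e + 2 * f + 4 * c + 8 * d + 16 * a + 32 * b + 64 * l + 128 * h + 256 * k + 512 * g) (by omega) e f c d a b l h k g he hf hc hd ha hb hl hh hk hg le_rfl ?_
      rw [e1, e2, e3] at H
      rw [e1, e2, e3]; exact H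
    · rw [← okN_13]
      refine ih (1 * d + 2 * b + 4 * f + 8 * a + 16 * e + 32 * c + 64 * g + 128 * l + 256 * k + 512 * h) (by omega) d b f a e c g l k h hd hb hf ha he hc hg hl hk hh le_rfl ?_
      rw [e1, e2, e3] at H
      rw [e1, e2, e3]; exact H
    · rw [← okN_23]
      refine ih (1 * a + 2 * d + 4 * e + 8 * b + 16 * c + 32 * f + 64 * g + 128 * h + 256 * l + 512 * k) (by omega) a d e b c f g h l k ha hd he hb hc hf hg hh hl hk le_rfl ?_
      rw [e1, e2, e3] at H
      rw [e1, e2, e3]; exact H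
    · rw [← okN_04]
      refine ih (1 * h + 2 * k + 4 * c + 8 * l + 16 * e + 32 * f + 64 * g + 128 * a + 256 * b + 512 * d) (by omega) h k c l e f g a b d hh hk hc hl he hf hg ha hb hd le_rfl ?_
      rw [e1, e2, e3] at H
      rw [e1, e2, e3]; exact H
    · rw [← okN_14]
      refine ih (1 * g + 2 * b + 4 * k + 8 * d + 16 * l + 32 * f + 64 * a + 128 * h + 256 * c + 512 * e) (by omega) g b k d l f a h c e hg hb hk hd hl hf ha hh hc he le_rfl ?_
      rw [e1, e2, e3] at H
      rw [e1, e2, e3]; exact H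
    · rw [← okN_24]
      refine ih (1 * a + 2 * g + 4 * h + 8 * d + 16 * e + 32 * l + 64 * b + 128 * c + 256 * k + 512 * f) (by omega) a g h d e l b c k f ha hg hh hd he hl hb hc hk hf le_rfl ?_
      rw [e1, e2, e3] at H
      rw [e1, e2, e3]; exact H
    · rw [← okN_34]
      refine ih (1 * a + 2 * b + 4 * c + 8 * g + 16 * h + 32 * k + 64 * d + 128 * e + 256 * f + 512 * l) (by omega) a b c g h k d e f l ha hb hc hg hh hk hd he hf hl le_rfl ?_
      rw [e1, e2, e3] at H
      rw [e1, e2, e3]; exact H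

def eqvS (a b c d e f g h k l : ℕ) : Bool :=
  !(a + b + c == 16) && (!(a + d + e == 16) && (!(b + d + f == 16) && (!(c + e + f == 16) && (!(a + g + h == 16) && (!(b + g + k == 16) && (!(c + h + k == 16) && (!(d + g + l == 16) && (!(e + h + l == 16) && (!(f + k + l == 16))))))))))
def loop8 (f : ℕ → Bool) : Bool := f 0 && f 8
theorem loop8_spec {f : ℕ → Bool} (h : loop8 f = true) (j : ℕ) : f (st j) = true ∨ 16 ≤ j := by
  by_cases hj : 16 ≤ j
  · exact Or.inr hj
  · left
    have : st j = 0 ∨ st j = 8 := by unfold st; omega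
    simp [loop8] at h
    rcases this with e | e <;> rw [e] <;> tauto

def isRep (a b c d e f g h k l : ℕ) : Bool :=
  (a == 0 && (b == 0 && (c == 0 && (d == 0 && (e == 0 && (f == 0 && (g == 0 && (h == 0 && (k == 0 && (l == 0)))))))))) || ((a == 8 && (b == 0 && (c == 0 && (d == 0 && (e == 0 && (f == 0 && (g == 0 && (h == 0 && (k == 0 && (l == 0)))))))))) || ((a == 8 && (b == 8 && (c == 8 && (d == 0 && (e == 0 && (f == 0 && (g == 0 && (h == 0 && (k == 0 && (l == 0)))))))))) || ((a == 0 && (b == 0 && (c == 8 && (d == 8 && (e == 0 && (f == 0 && (g == 0 && (h == 0 && (k == 0 && (l == 0)))))))))) || ((a == 8 && (b == 8 && (c == 8 && (d == 8 && (e == 8 && (f == 8 && (g == 0 && (h == 0 && (k == 0 && (l == 0)))))))))) || ((a == 0 && (b == 0 && (c == 8 && (d == 0 && (e == 8 && (f == 8 && (g == 8 && (h == 0 && (k == 0 && (l == 0)))))))))) || ((a == 8 && (b == 0 && (c == 0 && (d == 0 && (e == 0 && (f == 8 && (g == 8 && (h == 8 && (k == 0 && (l == 0)))))))))) || ((a ==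 8 && (b == 8 && (c == 8 && (d == 8 && (e == 8 && (f == 8 && (g == 8 && (h == 8 && (k == 8 && (l == 8)))))))))))))))))
theorem reps_all : (loop8 fun a => loop8 fun b => loop8 fun c => loop8 fun d => loop8 fun e => loop8 fun f => loop8 fun g => loop8 fun h => loop8 fun k => loop8 fun l =>
    !eqvS a b c d e f g h k l || (lowS a b c d e f g h k l || isRep a b c d e f g h k l)) = true := by decide +kernel

theorem reps_spec (a b c d e f g h k l : ℕ) (ha : vld a) (hb : vld b) (hc : vld c) (hd : vld d) (he : vld e) (hf : vld f) (hg : vld g) (hh : vld h) (hk : vld k) (hl : vld l) (hE : eqvS (st a) (st b) (st c) (st d) (st e) (st f) (st g) (st h) (st k) (st l) = true) :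
    lowS (st a) (st b) (st c) (st d) (st e) (st f) (st g) (st h) (st k) (st l) = true ∨ isRep (st a) (st b) (st c) (st d) (st e) (st f) (st g) (st h) (st k) (st l) = true := by
  have H := reps_all
  have H := (loop8_spec H a).resolve_right (by unfold vld at ha; omega)
  have H := (loop8_spec H b).resolve_right (by unfold vld at hb; omega)
  have H := (loop8_spec H c).resolve_right (by unfold vld at hc; omega)
  have H := (loop8_spec H d).resolve_right (by unfold vld at hd; omega)
  have H := (loop8_spec H e).resolve_right (by unfold vld at he; omega)
  have H := (loop8_spec H f).resolve_right (by unfold vld at hf; omega)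
  have H := (loop8_spec H g).resolve_right (by unfold vld at hg; omega)
  have H := (loop8_spec H h).resolve_right (by unfold vld at hh; omega)
  have H := (loop8_spec H k).resolve_right (by unfold vld at hk; omega)
  have H := (loop8_spec H l).resolve_right (by unfold vld at hl; omega)
  simp only [hE] at H
  simpa using H

theorem isRep_chk (C : Cert)
    (k0 : chkA C 0 0 0 0 0 0 0 0 0 0 = true)
    (k1 : chkA C 8 0 0 0 0 0 0 0 0 0 = true)
    (k7 : chkA C 8 8 8 0 0 0 0 0 0 0 = true)
    (k12 : chkA C 0 0 8 8 0 0 0 0 0 0 = true)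
    (k63 : chkA C 8 8 8 8 8 8 0 0 0 0 = true)
    (k116 : chkA C 0 0 8 0 8 8 8 0 0 0 = true)
    (k225 : chkA C 8 0 0 0 0 8 8 8 0 0 = true)
    (k1023 : chkA C 8 8 8 8 8 8 8 8 8 8 = true)
    (a b c d e f g h k l : ℕ) (hR : isRep a b c d e f g h k l = true) : chkA C a b c d e f g h k l = true := by
  simp only [isRep, Bool.or_eq_true, Bool.and_eq_true, beq_iff_eq] at hR
  rcases hR with ⟨rfl, rfl, rfl, rfl, rfl, rfl, rfl, rfl, rfl, rfl⟩ | ⟨rfl, rfl, rfl, rfl, rfl, rfl, rfl, rfl, rfl, rfl⟩ | ⟨rfl, rfl, rfl, rfl, rfl, rfl, rfl, rfl, rfl, rfl⟩ | ⟨rfl, rfl, rfl, rfl, rfl, rfl, rfl, rfl, rfl, rfl⟩ | ⟨rfl, rfl, rfl, rfl, rfl, rfl, rfl, rfl, rfl, rfl⟩ | ⟨rfl, rfl, rfl, rfl, rfl, rfl, rfl, rfl, rfl, rfl⟩ | ⟨rfl, rfl, rfl, rfl, rfl, rfl, rfl, rfl, rfl, rfl⟩ | ⟨rfl, rfl, rfl,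 rfl, rfl, rfl, rfl, rfl, rfl, rfl⟩
  · exact k0
  · exact k1
  · exact k7
  · exact k12
  · exact k63
  · exact k116
  · exact k225
  · exact k1023

theorem stage2 (C : Cert) (hC : ∀ a b c d e f g h k l : ℕ, isRep a b c d e f g h k l = true → chkA C a b c d e f g h k l = true) (N : ℕ) :
    ∀ (a b c d e f g h k l : ℕ), vld a → vld b → vld c → vld d → vld e → vld f → vld g → vld h → vld k → vld l →
    1 * st a + 2 * st b + 4 * st c + 8 * st d + 16 * st e + 32 * st f + 64 * st g + 128 * st h + 256 * st k + 512 * st l ≤ N → eqvS (st a) (st b) (st c) (st d) (st e) (st f) (st g) (st h) (st k) (st l) = true → okN C a b c d e f g h k l = true := by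
  induction N using Nat.strong_induction_on with
  | _ N ih =>
    intro a b c d e f g h k l ha hb hc hd he hf hg hh hk hl hN hE
    rcases reps_spec a b c d e f g h k l ha hb hc hd he hf hg hh hk hl hE with h1 | h1
    swap
    · exact stage1 C _ a b c d e f g h k l ha hb hc hd he hf hg hh hk hl le_rfl (hC _ _ _ _ _ _ _ _ _ _ h1)
    simp only [eqvS, Bool.and_eq_true, Bool.not_eq_true', beq_eq_false_iff_ne, ne_eq] at hE ih
    simp only [lowS, low01, low02, low12, low03, low13, low23, low04, low14, low24, low34, Nat.blt, Bool.or_eq_true, Nat.ble_eq] at h1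
    obtain ⟨q0, q1, q2, q3, q4, q5, q6, q7, q8, q9⟩ := hE
    rcases h1 with h1 | h1 | h1 | h1 | h1 | h1 | h1 | h1 | h1 | h1
    · rw [← okN_01]
      exact ih (1 * st a + 2 * st c + 4 * st b + 8 * st e + 16 * st d + 32 * st f + 64 * st h + 128 * st g + 256 * st k + 512 * st l) (by clear q0 q1 q2 q3 q4 q5 q6 q7 q8 q9; omega) a c b e d f h g k l ha hc hb he hd hf hh hg hk hl le_rfl
        ⟨fun w => q0 (Eq.trans (by ac_rfl) w), fun w => q1 (Eq.trans (by ac_rfl) w), fun w => q3 (Eq.trans (by ac_rfl) w), fun w => q2 (Eq.trans (by ac_rfl) w), fun w => q4 (Eq.trans (by ac_rfl) w), fun w => q6 (Eq.trans (by ac_rfl) w), fun w => q5 (Eq.trans (by ac_rfl) w), fun w => q8 (Eq.trans (by ac_rfl) w), fun w => q7 (Eq.trans (by ac_rfl) w), fun w => q9 (Eq.trans (by ac_rfl) w)⟩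
    · rw [← okN_02]
      exact ih (1 * st c + 2 * st b + 4 * st a + 8 * st f + 16 * st e + 32 * st d + 64 * st k + 128 * st h + 256 * st g + 512 * st l) (by clear q0 q1 q2 q3 q4 q5 q6 q7 q8 q9; omega) c b a f e d k h g l hc hb ha hf he hd hk hh hg hl le_rfl
        ⟨fun w => q0 (Eq.trans (by ac_rfl) w), fun w => q3 (Eq.trans (by ac_rfl) w), fun w => q2 (Eq.trans (by ac_rfl) w), fun w => q1 (Eq.trans (by ac_rfl) w), fun w => q6 (Eq.trans (by ac_rfl) w), fun w => q5 (Eq.trans (by ac_rfl) w), fun w => q4 (Eq.trans (by ac_rfl) w), fun w => q9 (Eq.trans (by ac_rfl) w), fun w => q8 (Eq.trans (by ac_rfl) w), fun w => q7 (Eq.trans (by ac_rfl) w)⟩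
    · rw [← okN_12]
      exact ih (1 * st b + 2 * st a + 4 * st c + 8 * st d + 16 * st f + 32 * st e + 64 * st g + 128 * st k + 256 * st h + 512 * st l) (by clear q0 q1 q2 q3 q4 q5 q6 q7 q8 q9; omega) b a c d f e g k h l hb ha hc hd hf he hg hk hh hl le_rfl
        ⟨fun w => q0 (Eq.trans (by ac_rfl) w), fun w => q2 (Eq.trans (by ac_rfl) w), fun w => q1 (Eq.trans (by ac_rfl) w), fun w => q3 (Eq.trans (by ac_rfl) w), fun w => q5 (Eq.trans (by ac_rfl) w), fun w => q4 (Eq.trans (by ac_rfl) w), fun w => q6 (Eq.trans (by ac_rfl) w), fun w => q7 (Eq.trans (by ac_rfl) w), fun w => q9 (Eq.trans (by ac_rfl) w), fun w => q8 (Eq.trans (by ac_rfl) w)⟩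
    · rw [← okN_03]
      exact ih (1 * st e + 2 * st f + 4 * st c + 8 * st d + 16 * st a + 32 * st b + 64 * st l + 128 * st h + 256 * st k + 512 * st g) (by clear q0 q1 q2 q3 q4 q5 q6 q7 q8 q9; omega) e f c d a b l h k g he hf hc hd ha hb hl hh hk hg le_rfl
        ⟨fun w => q3 (Eq.trans (by ac_rfl) w), fun w => q1 (Eq.trans (by ac_rfl) w), fun w => q2 (Eq.trans (by ac_rfl) w), fun w => q0 (Eq.trans (by ac_rfl) w), fun w => q8 (Eq.trans (by ac_rfl) w), fun w => q9 (Eq.trans (by ac_rfl) w), fun w => q6 (Eq.trans (by ac_rfl) w), fun w => q7 (Eq.trans (by ac_rfl) w), fun w => q4 (Eq.trans (by ac_rfl) w), fun w => q5 (Eq.trans (by ac_rfl) w)⟩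
    · rw [← okN_13]
      exact ih (1 * st d + 2 * st b + 4 * st f + 8 * st a + 16 * st e + 32 * st c + 64 * st g + 128 * st l + 256 * st k + 512 * st h) (by clear q0 q1 q2 q3 q4 q5 q6 q7 q8 q9; omega) d b f a e c g l k h hd hb hf ha he hc hg hl hk hh le_rfl
        ⟨fun w => q2 (Eq.trans (by ac_rfl) w), fun w => q1 (Eq.trans (by ac_rfl) w), fun w => q0 (Eq.trans (by ac_rfl) w), fun w => q3 (Eq.trans (by ac_rfl) w), fun w => q7 (Eq.trans (by ac_rfl) w), fun w => q5 (Eq.trans (by ac_rfl) w), fun w => q9 (Eq.trans (by ac_rfl) w), fun w => q4 (Eq.trans (by ac_rfl) w), fun w => q8 (Eq.trans (by ac_rfl) w), fun w => q6 (Eq.trans (by ac_rfl) w)⟩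
    · rw [← okN_23]
      exact ih (1 * st a + 2 * st d + 4 * st e + 8 * st b + 16 * st c + 32 * st f + 64 * st g + 128 * st h + 256 * st l + 512 * st k) (by clear q0 q1 q2 q3 q4 q5 q6 q7 q8 q9; omega) a d e b c f g h l k ha hd he hb hc hf hg hh hl hk le_rfl
        ⟨fun w => q1 (Eq.trans (by ac_rfl) w), fun w => q0 (Eq.trans (by ac_rfl) w), fun w => q2 (Eq.trans (by ac_rfl) w), fun w => q3 (Eq.trans (by ac_rfl) w), fun w => q4 (Eq.trans (by ac_rfl) w), fun w => q7 (Eq.trans (by ac_rfl) w), fun w => q8 (Eq.trans (by ac_rfl) w), fun w => q5 (Eq.trans (by ac_rfl) w), fun w => q6 (Eq.trans (by ac_rfl) w), fun w => q9 (Eq.trans (by ac_rfl) w)⟩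
    · rw [← okN_04]
      exact ih (1 * st h + 2 * st k + 4 * st c + 8 * st l + 16 * st e + 32 * st f + 64 * st g + 128 * st a + 256 * st b + 512 * st d) (by clear q0 q1 q2 q3 q4 q5 q6 q7 q8 q9; omega) h k c l e f g a b d hh hk hc hl he hf hg ha hb hd le_rfl
        ⟨fun w => q6 (Eq.trans (by ac_rfl) w), fun w => q8 (Eq.trans (by ac_rfl) w), fun w => q9 (Eq.trans (by ac_rfl) w), fun w => q3 (Eq.trans (by ac_rfl) w), fun w => q4 (Eq.trans (by ac_rfl) w), fun w => q5 (Eq.trans (by ac_rfl) w), fun w => q0 (Eq.trans (by ac_rfl) w), fun w => q7 (Eq.trans (by ac_rfl) w), fun w => q1 (Eq.trans (by ac_rfl) w), fun w => q2 (Eq.trans (by ac_rfl) w)⟩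
    · rw [← okN_14]
      exact ih (1 * st g + 2 * st b + 4 * st k + 8 * st d + 16 * st l + 32 * st f + 64 * st a + 128 * st h + 256 * st c + 512 * st e) (by clear q0 q1 q2 q3 q4 q5 q6 q7 q8 q9; omega) g b k d l f a h c e hg hb hk hd hl hf ha hh hc he le_rfl
        ⟨fun w => q5 (Eq.trans (by ac_rfl) w), fun w => q7 (Eq.trans (by ac_rfl) w), fun w => q2 (Eq.trans (by ac_rfl) w), fun w => q9 (Eq.trans (by ac_rfl) w), fun w => q4 (Eq.trans (by ac_rfl) w), fun w => q0 (Eq.trans (by ac_rfl) w), fun w => q6 (Eq.trans (by ac_rfl) w), fun w => q1 (Eq.trans (by ac_rfl) w), fun w => q8 (Eq.trans (by ac_rfl) w), fun w => q3 (Eq.trans (by ac_rfl) w)⟩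
    · rw [← okN_24]
      exact ih (1 * st a + 2 * st g + 4 * st h + 8 * st d + 16 * st e + 32 * st l + 64 * st b + 128 * st c + 256 * st k + 512 * st f) (by clear q0 q1 q2 q3 q4 q5 q6 q7 q8 q9; omega) a g h d e l b c k f ha hg hh hd he hl hb hc hk hf le_rfl
        ⟨fun w => q4 (Eq.trans (by ac_rfl) w), fun w => q1 (Eq.trans (by ac_rfl) w), fun w => q7 (Eq.trans (by ac_rfl) w), fun w => q8 (Eq.trans (by ac_rfl) w), fun w => q0 (Eq.trans (by ac_rfl) w), fun w => q5 (Eq.trans (by ac_rfl) w), fun w => q6 (Eq.trans (by ac_rfl) w), fun w => q2 (Eq.trans (by ac_rfl) w), fun w => q3 (Eq.trans (by ac_rfl) w), fun w => q9 (Eq.trans (by ac_rfl) w)⟩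
    · rw [← okN_34]
      exact ih (1 * st a + 2 * st b + 4 * st c + 8 * st g + 16 * st h + 32 * st k + 64 * st d + 128 * st e + 256 * st f + 512 * st l) (by clear q0 q1 q2 q3 q4 q5 q6 q7 q8 q9; omega) a b c g h k d e f l ha hb hc hg hh hk hd he hf hl le_rfl
        ⟨fun w => q0 (Eq.trans (by ac_rfl) w), fun w => q4 (Eq.trans (by ac_rfl) w), fun w => q5 (Eq.trans (by ac_rfl) w), fun w => q6 (Eq.trans (by ac_rfl) w), fun w => q1 (Eq.trans (by ac_rfl) w), fun w => q2 (Eq.trans (by ac_rfl) w), fun w => q3 (Eq.trans (by ac_rfl) w), fun w => q7 (Eq.trans (by ac_rfl) w), fun w => q8 (Eq.trans (by ac_rfl) w), fun w => q9 (Eq.trans (by ac_rfl) w)⟩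

theorem ok_cert1 (a b c d e f g h k l : ℕ) (ha : vld a) (hb : vld b) (hc : vld c) (hd : vld d) (he : vld e) (hf : vld f) (hg : vld g) (hh : vld h) (hk : vld k) (hl : vld l)
    (hE : eqvS (st a) (st b) (st c) (st d) (st e) (st f) (st g) (st h) (st k) (st l) = true) : okN cert1 a b c d e f g h k l = true :=
  stage2 cert1 (isRep_chk cert1 chk1_0 chk1_1 chk1_7 chk1_12 chk1_63 chk1_116 chk1_225 chk1_1023) _ a b c d e f g h k l ha hb hc hd he hf hg hh hk hl le_rfl hE

theorem ok_cert2 (a b c d e f g h k l : ℕ) (ha : vld a) (hb : vld b) (hc : vld c) (hd : vld d) (he : vld e) (hf : vld f) (hg : vld g) (hh : vld h) (hk : vld k) (hl : vld l)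
    (hE : eqvS (st a) (st b) (st c) (st d) (st e) (st f) (st g) (st h) (st k) (st l) = true) : okN cert2 a b c d e f g h k l = true :=
  stage2 cert2 (isRep_chk cert2 chk2_0 chk2_1 chk2_7 chk2_12 chk2_63 chk2_116 chk2_225 chk2_1023) _ a b c d e f g h k l ha hb hc hd he hf hg hh hk hl le_rfl hE

end EI

namespace EI
set_option linter.unusedSectionVars false

section core
variable {V : Type*} [Fintype V]

/-- weighted sum over 5-tuples -/
noncomputable def S5 (ω : V → ℝ) (f : V → V → V → V → V → ℝ) : ℝ :=
  ∑ x, ∑ y, ∑ z, ∑ u, ∑ w, ω x * ω y * ω z * ω u * ω w * f x y z u w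

theorem S5_01 (ω : V → ℝ) (f : V → V → V → V → V → ℝ) :
    S5 ω (fun x y z u w => f y x z u w) = S5 ω f := by
  unfold S5
  rw [Finset.sum_comm]
  refine sum_congr rfl fun x _ => sum_congr rfl fun y _ => sum_congr rfl fun z _ =>
    sum_congr rfl fun u _ => sum_congr rfl fun w _ => by ring

theorem S5_12 (ω : V → ℝ) (f : V → V → V → V → V → ℝ) :
    S5 ω (fun x y z u w => f x z y u w) = S5 ω f := by
  unfold S5
  refine sum_congr rfl fun x _ => ?_
  rw [Finset.sum_comm]
  refine sum_congr rfl fun y _ => sum_congr rfl fun z _ =>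
    sum_congr rfl fun u _ => sum_congr rfl fun w _ => by ring

theorem S5_23 (ω : V → ℝ) (f : V → V → V → V → V → ℝ) :
    S5 ω (fun x y z u w => f x y u z w) = S5 ω f := by
  unfold S5
  refine sum_congr rfl fun x _ => sum_congr rfl fun y _ => ?_
  rw [Finset.sum_comm]
  refine sum_congr rfl fun z _ =>
    sum_congr rfl fun u _ => sum_congr rfl fun w _ => by ring

theorem S5_34 (ω : V → ℝ) (f : V → V → V → V → V → ℝ) :
    S5 ω (fun x y z u w => f x y z w u) = S5 ω f := by
  unfold S5
  refine sum_congr rfl fun x _ => sum_congr rfl fun y _ => sum_congr rfl fun z _ => ?_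
  rw [Finset.sum_comm]
  refine sum_congr rfl fun u _ => sum_congr rfl fun w _ => by ring

theorem S5_02 (ω : V → ℝ) (f : V → V → V → V → V → ℝ) :
    S5 ω (fun x y z u w => f z y x u w) = S5 ω f := by
  rw [← S5_01 ω f, ← S5_12 ω (fun x y z u w => f y x z u w), ← S5_01]

theorem S5_13 (ω : V → ℝ) (f : V → V → V → V → V → ℝ) :
    S5 ω (fun x y z u w => f x u z y w) = S5 ω f := by
  rw [← S5_12 ω f, ← S5_23 ω (fun x y z u w => f x z y u w), ← S5_12]

theorem S5_24 (ω : V → ℝ) (f : V → V → V → V → V → ℝ) :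
    S5 ω (fun x y z u w => f x y w u z) = S5 ω f := by
  rw [← S5_23 ω f, ← S5_34 ω (fun x y z u w => f x y u z w), ← S5_23]

theorem S5_03 (ω : V → ℝ) (f : V → V → V → V → V → ℝ) :
    S5 ω (fun x y z u w => f u y z x w) = S5 ω f := by
  rw [← S5_01 ω f, ← S5_13 ω (fun x y z u w => f y x z u w), ← S5_01]

theorem S5_14 (ω : V → ℝ) (f : V → V → V → V → V → ℝ) :
    S5 ω (fun x y z u w => f x w z u y) = S5 ω f := by
  rw [← S5_12 ω f, ← S5_24 ω (fun x y z u w => f x z y u w), ← S5_12]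

theorem S5_04 (ω : V → ℝ) (f : V → V → V → V → V → ℝ) :
    S5 ω (fun x y z u w => f w y z u x) = S5 ω f := by
  rw [← S5_01 ω f, ← S5_14 ω (fun x y z u w => f y x z u w), ← S5_01]

theorem S5_add (ω : V → ℝ) (f g : V → V → V → V → V → ℝ) :
    S5 ω (fun x y z u w => f x y z u w + g x y z u w) = S5 ω f + S5 ω g := by
  unfold S5; simp only [mul_add, sum_add_distrib]

theorem S5_mul (ω : V → ℝ) (c : ℝ) (f : V → V → V → V → V → ℝ) :
    S5 ω (fun x y z u w => c * f x y z u w) = c * S5 ω f := by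
  unfold S5; simp only [mul_sum, mul_left_comm c]

theorem S5_mono (ω : V → ℝ) (hω : ∀ x, 0 ≤ ω x) (f g : V → V → V → V → V → ℝ)
    (h : ∀ x y z u w, f x y z u w ≤ g x y z u w) : S5 ω f ≤ S5 ω g := by
  unfold S5
  refine sum_le_sum fun x _ => sum_le_sum fun y _ => sum_le_sum fun z _ =>
    sum_le_sum fun u _ => sum_le_sum fun w _ => mul_le_mul_of_nonneg_left (h x y z u w) ?_
  have := hω x; have := hω y; have := hω z; have := hω u; have := hω w
  positivity

theorem S5_const (ω : V → ℝ) (c : ℝ) :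
    S5 ω (fun _ _ _ _ _ => c) = c * (∑ x, ω x) ^ 5 := by
  unfold S5
  simp only [← mul_sum, ← sum_mul]
  ring

abbrev F10 := ℕ → ℕ → ℕ → ℕ → ℕ → ℕ → ℕ → ℕ → ℕ → ℕ → ℕ

def at5 (j : V → V → ℕ) (F : F10) (x y z u w : V) : ℕ :=
  F (j x y) (j x z) (j y z) (j x u) (j y u) (j z u) (j x w) (j y w) (j z w) (j u w)

theorem at5_sy1 (j : V → V → ℕ) (hj : ∀ x y, j x y = j y x) (F : F10) (x y z u w : V) :
    at5 j (sy1 F) x y z u w = at5 j F x y z u w + at5 j F y x z u w := by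
  simp only [at5, sy1]; rw [hj y x]

theorem at5_sy2 (j : V → V → ℕ) (hj : ∀ x y, j x y = j y x) (F : F10) (x y z u w : V) :
    at5 j (sy2 F) x y z u w = at5 j (sy1 F) x y z u w +
      (at5 j (sy1 F) x z y u w + at5 j (sy1 F) z y x u w) := by
  simp only [at5, sy2]; rw [hj z y, hj z x, hj y x]

theorem at5_sy3 (j : V → V → ℕ) (hj : ∀ x y, j x y = j y x) (F : F10) (x y z u w : V) :
    at5 j (sy3 F) x y z u w = at5 j (sy2 F) x y z u w +
      (at5 j (sy2 F) x y u z w + (at5 j (sy2 F) x u z y w + at5 j (sy2 F) u y z x w)) := by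
  simp only [at5, sy3]; rw [hj u z, hj u y, hj u x, hj z y, hj z x, hj y x]

theorem at5_sy4 (j : V → V → ℕ) (hj : ∀ x y, j x y = j y x) (F : F10) (x y z u w : V) :
    at5 j (sy4 F) x y z u w = at5 j (sy3 F) x y z u w +
      (at5 j (sy3 F) x y z w u + (at5 j (sy3 F) x y w u z +
        (at5 j (sy3 F) x w z u y + at5 j (sy3 F) w y z u x))) := by
  simp only [at5, sy4]
  rw [hj w u, hj w z, hj w y, hj w x, hj u z, hj u y, hj u x, hj z y, hj z x, hj y x]

theorem S5_sy4 (ω : V → ℝ) (j : V → V → ℕ) (hj : ∀ x y, j x y = j y x) (F : F10) :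
    S5 ω (fun x y z u w => (at5 j (sy4 F) x y z u w : ℝ)) =
      120 * S5 ω (fun x y z u w => (at5 j F x y z u w : ℝ)) := by
  have h1 : S5 ω (fun x y z u w => (at5 j (sy1 F) x y z u w : ℝ)) =
      2 * S5 ω (fun x y z u w => (at5 j F x y z u w : ℝ)) := by
    simp only [at5_sy1 j hj, Nat.cast_add, S5_add]
    rw [S5_01 ω (fun x y z u w => (at5 j F x y z u w : ℝ))]; ring
  have h2 : S5 ω (fun x y z u w => (at5 j (sy2 F) x y z u w : ℝ)) =
      3 * S5 ω (fun x y z u w => (at5 j (sy1 F) x y z u w : ℝ)) := by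
    simp only [at5_sy2 j hj, Nat.cast_add, S5_add]
    rw [S5_12 ω (fun x y z u w => (at5 j (sy1 F) x y z u w : ℝ)),
      S5_02 ω (fun x y z u w => (at5 j (sy1 F) x y z u w : ℝ))]; ring
  have h3 : S5 ω (fun x y z u w => (at5 j (sy3 F) x y z u w : ℝ)) =
      4 * S5 ω (fun x y z u w => (at5 j (sy2 F) x y z u w : ℝ)) := by
    simp only [at5_sy3 j hj, Nat.cast_add, S5_add]
    rw [S5_23 ω (fun x y z u w => (at5 j (sy2 F) x y z u w : ℝ)),
      S5_13 ω (fun x y z u w => (at5 j (sy2 F) x y z u w : ℝ)),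
      S5_03 ω (fun x y z u w => (at5 j (sy2 F) x y z u w : ℝ))]; ring
  have h4 : S5 ω (fun x y z u w => (at5 j (sy4 F) x y z u w : ℝ)) =
      5 * S5 ω (fun x y z u w => (at5 j (sy3 F) x y z u w : ℝ)) := by
    simp only [at5_sy4 j hj, Nat.cast_add, S5_add]
    rw [S5_34 ω (fun x y z u w => (at5 j (sy3 F) x y z u w : ℝ)),
      S5_24 ω (fun x y z u w => (at5 j (sy3 F) x y z u w : ℝ)),
      S5_14 ω (fun x y z u w => (at5 j (sy3 F) x y z u w : ℝ)),
      S5_04 ω (fun x y z u w => (at5 j (sy3 F) x y z u w : ℝ))]; ring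
  rw [h4, h3, h2, h1]; ring

end core
end EI

namespace EI
set_option linter.unusedSectionVars false
section core2
variable {V : Type*} [Fintype V]

noncomputable def jn {L : Type*} (G : SimpleGraph V) (c : V → L) (x y : V) : ℕ :=
  (if G.Adj x y then 1 else 0) + (if c x = c y then 8 else 0)

theorem jn_symm {L : Type*} (G : SimpleGraph V) (c : V → L) (x y : V) : jn G c x y = jn G c y x := by
  unfold jn; simp only [G.adj_comm x y, eq_comm (a := c x)]

theorem jn_vld {L : Type*} (G : SimpleGraph V) (c : V → L) (x y : V) : vld (jn G c x y) := by
  unfold jn vld; split_ifs <;> simp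

theorem st_jn {L : Type*} (G : SimpleGraph V) (c : V → L) (x y : V) :
    st (jn G c x y) = if c x = c y then 8 else 0 := by
  unfold jn st; split_ifs <;> simp

theorem tri_jn {L : Type*} (G : SimpleGraph V) (c : V → L) (x y z : V) :
    (!(st (jn G c x y) + st (jn G c x z) + st (jn G c y z) == 16)) = true := by
  simp only [st_jn]
  by_cases h1 : c x = c y <;> by_cases h2 : c x = c z <;> by_cases h3 : c y = c z <;> simp_all

theorem eqv_jn {L : Type*} (G : SimpleGraph V) (c : V → L) (x y z u w : V) :
    eqvS (st (jn G c x y)) (st (jn G c x z)) (st (jn G c y z)) (st (jn G c x u)) (st (jn G c y u))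
      (st (jn G c z u)) (st (jn G c x w)) (st (jn G c y w)) (st (jn G c z w)) (st (jn G c u w)) = true := by
  unfold eqvS
  simp only [tri_jn, Bool.and_self]

def fT (C : Cert) (a b c d e f g h k l : ℕ) : ℤ :=
  e3 C (tcx a b c) (tcx d e f) (tcx g h k) +
  (e1 C (tcx a b c) (tcx d g l) +
  (eA C (tcx a b c) (inA d e) (inA g h) l +
  (eX C a f + eB C (tcx a b c) (tcx d e f))))

theorem off_le (x : ℤ) : (x : ℝ) + (offs : ℝ) ≤ (off x : ℝ) := by
  have := Int.self_le_toNat (x + (offs : ℤ))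
  unfold off
  exact_mod_cast this

theorem fT_le (C : Cert) (a b c d e f g h k l : ℕ) :
    (fT C a b c d e f g h k l : ℝ) + 5 * (offs : ℝ) ≤ (fN C a b c d e f g h k l : ℝ) := by
  unfold fT fN
  push_cast
  linarith [off_le (e3 C (tcx a b c) (tcx d e f) (tcx g h k)), off_le (e1 C (tcx a b c) (tcx d g l)),
    off_le (eA C (tcx a b c) (inA d e) (inA g h) l), off_le (eX C a f),
    off_le (eB C (tcx a b c) (tcx d e f))]

/-- conditions on a certificate that are used on the level of graphs -/
structure Good (C : Cert) : Prop where
  ok : ∀ a b c d e f g h k l : ℕ, vld a → vld b → vld c → vld d → vld e → vld f → vld g → vld h →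
    vld k → vld l → eqvS (st a) (st b) (st c) (st d) (st e) (st f) (st g) (st h) (st k) (st l) = true →
    okN C a b c d e f g h k l = true
  r3 : ∀ b, ∀ p ∈ C.rows3 b, 0 ≤ p.1
  r1 : ∀ p ∈ C.rows1, 0 ≤ p.1
  mu0 : ∀ t, 0 ≤ C.mu t
  mu1 : ∀ t, t % 2 = 0 → C.mu t = 0

theorem mu_1_aux (t : ℕ) : 0 ≤ mu_1 t ∧ (t % 2 = 0 → mu_1 t = 0) := by
  have h1 : ∀ t < 64, 0 ≤ mu_1 t ∧ (t % 2 = 0 → mu_1 t = 0) := by decide +kernel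
  by_cases hb : t < 64
  · exact h1 t hb
  · have : mu_1 t = 0 := by
      unfold mu_1
      repeat rw [if_neg (by omega)]
    simp [this]

theorem good1 : Good cert1 where
  ok := ok_cert1
  r3 := by
    intro b p hp
    have h1 : ∀ b < 9, (rows3_1 b).all (fun p => decide (0 ≤ p.1)) = true := by decide +kernel
    have hp : p ∈ rows3_1 b := hp
    by_cases hb : b < 9
    · exact of_decide_eq_true (List.all_eq_true.1 (h1 b hb) p hp)
    · unfold rows3_1 at hp
      rw [if_neg (by omega), if_neg (by omega), if_neg (by omega), if_neg (by omega),
        if_neg (by omega), if_neg (by omega), if_neg (by omega), if_neg (by omega),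
        if_neg (by omega)] at hp
      exact absurd hp List.not_mem_nil
  r1 := by
    intro p hp
    have h1 : rows1_1.all (fun p => decide (0 ≤ p.1)) = true := by decide +kernel
    exact of_decide_eq_true (List.all_eq_true.1 h1 p hp)
  mu0 := fun t => (mu_1_aux t).1
  mu1 := fun t => (mu_1_aux t).2

theorem mu_2_aux (t : ℕ) : 0 ≤ mu_2 t ∧ (t % 2 = 0 → mu_2 t = 0) := by
  have h1 : ∀ t < 64, 0 ≤ mu_2 t ∧ (t % 2 = 0 → mu_2 t = 0) := by decide +kernel
  by_cases hb : t < 64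
  · exact h1 t hb
  · have : mu_2 t = 0 := by
      unfold mu_2
      repeat rw [if_neg (by omega)]
    simp [this]

theorem good2 : Good cert2 where
  ok := ok_cert2
  r3 := by
    intro b p hp
    have h1 : ∀ b < 9, (rows3_2 b).all (fun p => decide (0 ≤ p.1)) = true := by decide +kernel
    have hp : p ∈ rows3_2 b := hp
    by_cases hb : b < 9
    · exact of_decide_eq_true (List.all_eq_true.1 (h1 b hb) p hp)
    · unfold rows3_2 at hp
      rw [if_neg (by omega), if_neg (by omega), if_neg (by omega), if_neg (by omega),
        if_neg (by omega), if_neg (by omega), if_neg (by omega), if_neg (by omega),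
        if_neg (by omega)] at hp
      exact absurd hp List.not_mem_nil
  r1 := by
    intro p hp
    have h1 : rows1_2.all (fun p => decide (0 ≤ p.1)) = true := by decide +kernel
    exact of_decide_eq_true (List.all_eq_true.1 h1 p hp)
  mu0 := fun t => (mu_2_aux t).1
  mu1 := fun t => (mu_2_aux t).2

theorem cert_sum (C : Cert) (hC : Good C) {L : Type*} (G : SimpleGraph V) (c : V → L) (ω : V → ℝ)
    (hω : ∀ x, 0 ≤ ω x) :
    120 * ((C.cE : ℝ) * S5 ω (fun x y z u w => (at5 (jn G c) e2N x y z u w : ℝ))) +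
    120 * S5 ω (fun x y z u w => (fT C (jn G c x y) (jn G c x z) (jn G c y z) (jn G c x u)
      (jn G c y u) (jn G c z u) (jn G c x w) (jn G c y w) (jn G c z w) (jn G c u w) : ℝ))
      ≤ C.bound * (∑ x, ω x) ^ 5 := by
  have h1 : S5 ω (fun x y z u w => 120 * ((C.cE : ℝ) * (at5 (jn G c) e2N x y z u w : ℝ)) +
      (at5 (jn G c) (sy4 (fN C)) x y z u w : ℝ)) ≤
      S5 ω (fun _ _ _ _ _ => (C.bound : ℝ) + 600 * (offs : ℝ)) := by
    apply S5_mono ω hω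
    intro x y z u w
    have := hC.ok _ _ _ _ _ _ _ _ _ _ (jn_vld G c x y) (jn_vld G c x z) (jn_vld G c y z)
      (jn_vld G c x u) (jn_vld G c y u) (jn_vld G c z u) (jn_vld G c x w) (jn_vld G c y w)
      (jn_vld G c z w) (jn_vld G c u w) (eqv_jn G c x y z u w)
    unfold okN at this
    rw [Nat.ble_eq] at this
    unfold at5
    exact_mod_cast this
  have h2 : S5 ω (fun x y z u w => (fT C (jn G c x y) (jn G c x z) (jn G c y z) (jn G c x u)
      (jn G c y u) (jn G c z u) (jn G c x w) (jn G c y w) (jn G c z w) (jn G c u w) : ℝ) +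
      5 * (offs : ℝ)) ≤
      S5 ω (fun x y z u w => (at5 (jn G c) (fN C) x y z u w : ℝ)) :=
    S5_mono ω hω _ _ fun x y z u w => fT_le C _ _ _ _ _ _ _ _ _ _
  rw [S5_add, S5_const, S5_sy4 ω (jn G c) (jn_symm G c), S5_mul, S5_mul] at h1
  rw [S5_add, S5_const] at h2
  linarith

/-- sums of squares -/
theorem sos_nonneg {ι : Type*} [Fintype ι] (L : List (ℤ × ℕ)) (hL : ∀ p ∈ L, 0 ≤ p.1)
    (θ : ι → ℝ) (p : ι → ℕ) : 0 ≤ ∑ u, ∑ w, θ u * θ w * (sos L (p u) (p w) : ℝ) := by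
  induction L with
  | nil => simp [sos]
  | cons q L ih =>
    have h1 : ∀ i k, sos (q :: L) i k = q.1 * (wv q.2 i * wv q.2 k) + sos L i k := fun i k => rfl
    have h2 : ∑ u, ∑ w, θ u * θ w * (sos (q :: L) (p u) (p w) : ℝ) =
        (q.1 : ℝ) * (∑ u, θ u * (wv q.2 (p u) : ℝ)) ^ 2 +
        ∑ u, ∑ w, θ u * θ w * (sos L (p u) (p w) : ℝ) := by
      rw [sq, sum_mul_sum, mul_sum, ← sum_add_distrib]
      refine sum_congr rfl fun u _ => ?_
      rw [mul_sum, ← sum_add_distrib]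
      refine sum_congr rfl fun w _ => ?_
      rw [h1]; push_cast; ring
    rw [h2]
    have h3 : (0:ℝ) ≤ q.1 := by exact_mod_cast hL q (by simp)
    have := ih (fun p hp => hL p (by simp [hp]))
    positivity

end core2
end EI

namespace EI
set_option linter.unusedSectionVars false
section core3
variable {V : Type*} [Fintype V]

theorem S5_e3 (C : Cert) (hC : Good C) (j : V → V → ℕ) (ω : V → ℝ) (hω : ∀ x, 0 ≤ ω x) :
    0 ≤ S5 ω (fun x y z u w => (e3 C (tcx (j x y) (j x z) (j y z)) (tcx (j x u) (j y u) (j z u))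
      (tcx (j x w) (j y w) (j z w)) : ℝ)) := by
  unfold S5
  refine sum_nonneg fun x _ => sum_nonneg fun y _ => sum_nonneg fun z _ => ?_
  have h := sos_nonneg (C.rows3 (tblB (tcx (j x y) (j x z) (j y z)))) (hC.r3 _) ω
    (fun u => tblF (tcx (j x u) (j y u) (j z u)))
  have h2 := mul_nonneg (mul_nonneg (mul_nonneg (hω x) (hω y)) (hω z)) h
  rw [mul_sum] at h2
  simp only [mul_sum] at h2
  refine h2.trans_eq (sum_congr rfl fun u _ => sum_congr rfl fun w _ => ?_)
  unfold e3; ring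

theorem sum_sq4 (p : V → V → ℝ) :
    (∑ y, ∑ z, p y z) ^ 2 = ∑ y, ∑ z, ∑ u, ∑ w, p y z * p u w := by
  rw [sq, sum_mul]
  refine sum_congr rfl fun y _ => ?_
  rw [sum_mul]
  refine sum_congr rfl fun z _ => ?_
  rw [mul_sum]
  refine sum_congr rfl fun u _ => ?_
  rw [mul_sum]

theorem S5_e1 (C : Cert) (hC : Good C) (j : V → V → ℕ) (ω : V → ℝ) (hω : ∀ x, 0 ≤ ω x) :
    (C.xd : ℝ) * ∑ x, ω x * (∑ y, ∑ z, ω y * ω z * (dvec (tcx (j x y) (j x z) (j y z)) : ℝ)) ^ 2 +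
    (C.xt : ℝ) * ∑ x, ω x * (∑ y, ∑ z, ω y * ω z * (tvec (tcx (j x y) (j x z) (j y z)) : ℝ)) ^ 2 ≤
    S5 ω (fun x y z u w => (e1 C (tcx (j x y) (j x z) (j y z)) (tcx (j x u) (j x w) (j u w)) : ℝ)) := by
  unfold S5
  rw [mul_sum, mul_sum, ← sum_add_distrib]
  refine sum_le_sum fun x _ => ?_
  have h := sos_nonneg (ι := V × V) C.rows1 hC.r1 (fun p => ω p.1 * ω p.2)
    (fun p => tblH (tcx (j x p.1) (j x p.2) (j p.1 p.2)))
  simp only [Fintype.sum_prod_type] at h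
  have key : ∑ y, ∑ z, ∑ u, ∑ w, ω x * ω y * ω z * ω u * ω w *
      (e1 C (tcx (j x y) (j x z) (j y z)) (tcx (j x u) (j x w) (j u w)) : ℝ) =
      (C.xd : ℝ) * (ω x * (∑ y, ∑ z, ω y * ω z * (dvec (tcx (j x y) (j x z) (j y z)) : ℝ)) ^ 2) +
      (C.xt : ℝ) * (ω x * (∑ y, ∑ z, ω y * ω z * (tvec (tcx (j x y) (j x z) (j y z)) : ℝ)) ^ 2) +
      ω x * ∑ y, ∑ z, ∑ u, ∑ w, ω y * ω z * (ω u * ω w) *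
        (sos C.rows1 (tblH (tcx (j x y) (j x z) (j y z))) (tblH (tcx (j x u) (j x w) (j u w))) : ℝ) := by
    rw [sum_sq4, sum_sq4]
    simp only [mul_sum]
    simp only [← sum_add_distrib]
    refine sum_congr rfl fun y _ => sum_congr rfl fun z _ => sum_congr rfl fun u _ =>
      sum_congr rfl fun w _ => ?_
    unfold e1; push_cast; ring
  rw [key]
  have := mul_nonneg (hω x) h
  linarith

theorem S5_eA (C : Cert) (hC : Good C) (j : V → V → ℕ) (ω : V → ℝ) (hω : ∀ x, 0 ≤ ω x)
    (hA : ∀ x y, j x y % 2 = 1 → 0 ≤ ∑ u, ∑ w, ω u * ω w *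
      (colA (inA (j x u) (j y u)) (inA (j x w) (j y w)) (j u w) : ℝ)) :
    0 ≤ S5 ω (fun x y z u w => (eA C (tcx (j x y) (j x z) (j y z)) (inA (j x u) (j y u))
      (inA (j x w) (j y w)) (j u w) : ℝ)) := by
  unfold S5
  refine sum_nonneg fun x _ => sum_nonneg fun y _ => sum_nonneg fun z _ => ?_
  have h2 : 0 ≤ ω x * ω y * ω z * ((C.mu (tcx (j x y) (j x z) (j y z)) : ℝ) *
      ∑ u, ∑ w, ω u * ω w * (colA (inA (j x u) (j y u)) (inA (j x w) (j y w)) (j u w) : ℝ)) := by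
    refine mul_nonneg (mul_nonneg (mul_nonneg (hω x) (hω y)) (hω z)) ?_
    by_cases h : j x y % 2 = 1
    · refine mul_nonneg ?_ (hA x y h)
      exact_mod_cast hC.mu0 _
    · rw [hC.mu1 _ (by unfold tcx; omega)]; simp
  simp only [mul_sum] at h2
  refine h2.trans_eq (sum_congr rfl fun u _ => sum_congr rfl fun w _ => ?_)
  unfold eA; push_cast; ring

theorem S5_eX (C : Cert) (j : V → V → ℕ) (ω : V → ℝ) :
    S5 ω (fun x y z u w => (eX C (j x y) (j z u) : ℝ)) =
     (∑ x, ω x) * ((C.cX : ℝ) * (∑ x, ω x) ^ 2 *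
       (∑ x, ∑ y, ω x * ω y * (if j x y = 1 then 1 else 0)) -
       C.cXX * (∑ x, ∑ y, ω x * ω y * (if j x y = 1 then 1 else 0)) ^ 2) := by
  have h : ∀ a f : ℕ, (eX C a f : ℝ) = C.cX * ((if a = 1 then 1 else 0) * 1) -
      C.cXX * ((if a = 1 then 1 else 0) * (if f = 1 then 1 else 0)) := by
    intro a f
    unfold eX crossE
    rcases eq_or_ne a 1 with h1 | h1 <;> rcases eq_or_ne f 1 with h2 | h2 <;>
      simp [h1, h2, beq_eq_false_iff_ne.2]
  have h3 : ∀ p q : V → V → ℝ, S5 ω (fun x y z u _ => p x y * q z u) =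
      (∑ x, ω x) * ((∑ x, ∑ y, ω x * ω y * p x y) * (∑ x, ∑ y, ω x * ω y * q x y)) := by
    intro p q
    unfold S5
    rw [mul_comm, sum_mul, sum_mul]
    refine sum_congr rfl fun x _ => ?_
    rw [sum_mul, sum_mul]
    refine sum_congr rfl fun y _ => ?_
    rw [mul_assoc, sum_mul, mul_sum]
    refine sum_congr rfl fun z _ => ?_
    rw [sum_mul, mul_sum]
    refine sum_congr rfl fun u _ => ?_
    rw [mul_sum, mul_sum]
    refine sum_congr rfl fun w _ => ?_
    ring
  have h4 : S5 ω (fun x y z u w => (eX C (j x y) (j z u) : ℝ)) =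
      C.cX * S5 ω (fun x y z u w => (if j x y = 1 then (1:ℝ) else 0) * 1) +
      (-C.cXX) * S5 ω (fun x y z u w => (if j x y = 1 then (1:ℝ) else 0) *
        (if j z u = 1 then (1:ℝ) else 0)) := by
    rw [← S5_mul, ← S5_mul, ← S5_add]
    congr; funext x y z u w; rw [h]; ring
  rw [h4, h3 (fun x y => if j x y = 1 then (1:ℝ) else 0) (fun _ _ => 1),
    h3 (fun x y => if j x y = 1 then (1:ℝ) else 0) (fun x y => if j x y = 1 then (1:ℝ) else 0)]
  have h5 : ∑ x, ∑ y, ω x * ω y * 1 = (∑ x, ω x) ^ 2 := by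
    simp only [mul_one, ← mul_sum, ← sum_mul]; ring
  rw [h5]; ring

noncomputable def bad4 (j : V → V → ℕ) (x y z u : V) : ℝ :=
  if tblBad ((tcx (j x y) (j x z) (j y z)) % 8 + 8 * ((tcx (j x u) (j y u) (j z u)) % 8)) = 1 then 1 else 0

theorem S5_eB (C : Cert) (j : V → V → ℕ) (ω : V → ℝ) :
    S5 ω (fun x y z u w => (eB C (tcx (j x y) (j x z) (j y z)) (tcx (j x u) (j y u) (j z u)) : ℝ)) =
     C.cB * ((∑ x, ω x) * ∑ x, ∑ y, ∑ z, ∑ u, ω x * ω y * ω z * ω u * bad4 j x y z u) := by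
  unfold S5
  rw [mul_comm (∑ x, ω x), sum_mul, mul_sum]
  refine sum_congr rfl fun x _ => ?_
  rw [sum_mul, mul_sum]
  refine sum_congr rfl fun y _ => ?_
  rw [sum_mul, mul_sum]
  refine sum_congr rfl fun z _ => ?_
  rw [sum_mul, mul_sum]
  refine sum_congr rfl fun u _ => ?_
  rw [mul_sum, mul_sum]
  refine sum_congr rfl fun w _ => ?_
  unfold eB bad4
  beta_reduce
  by_cases h : tblBad (tcx (j x y) (j x z) (j y z) % 8 + 8 * (tcx (j x u) (j y u) (j z u) % 8)) = 1
  · rw [if_pos h, if_pos h]; ring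
  · rw [if_neg h, if_neg h]; simp
end core3
end EI

namespace EI
set_option linter.unusedSectionVars false
section core4
variable {V : Type*} [Fintype V]

/-- 0/1 adjacency -/
noncomputable def jb (G : SimpleGraph V) (x y : V) : ℕ := if G.Adj x y then 1 else 0

/-- indicator of a 5-tuple spanning exactly two edges -/
noncomputable def E5 (G : SimpleGraph V) (x y z u w : V) : ℝ := (at5 (jb G) e2N x y z u w : ℝ)

/-- indicator of a bad 4-tuple -/
noncomputable def B4 (G : SimpleGraph V) (x y z u : V) : ℝ := bad4 (jb G) x y z u

theorem jn_mod {L : Type*} (G : SimpleGraph V) (c : V → L) (x y : V) :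
    jn G c x y = jb G x y ∨ jn G c x y = jb G x y + 8 := by
  unfold jn jb; split_ifs <;> simp

theorem jb_01 (G : SimpleGraph V) (x y : V) : jb G x y = 0 ∨ jb G x y = 1 := by
  unfold jb; split_ifs <;> simp

theorem jb_symm (G : SimpleGraph V) (x y : V) : jb G x y = jb G y x := by
  unfold jb; simp only [G.adj_comm x y]

theorem e2N_jn {L : Type*} (G : SimpleGraph V) (c : V → L) (x y z u w : V) :
    (at5 (jn G c) e2N x y z u w : ℝ) = E5 G x y z u w := by
  have h : ∀ x y, jn G c x y % 2 = jb G x y % 2 := by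
    intro x y; have := jn_mod G c x y; omega
  unfold E5 at5 e2N
  simp only [h]

theorem tcx8 {L : Type*} (G : SimpleGraph V) (c : V → L) (x y x' y' x'' y'' : V) :
    (tcx (jn G c x y) (jn G c x' y') (jn G c x'' y'')) % 8 =
    (tcx (jb G x y) (jb G x' y') (jb G x'' y'')) % 8 := by
  have h1 := jn_mod G c x y
  have h2 := jn_mod G c x' y'
  have h3 := jn_mod G c x'' y''
  unfold tcx; omega

theorem bad4_jn {L : Type*} (G : SimpleGraph V) (c : V → L) (x y z u : V) :
    bad4 (jn G c) x y z u = B4 G x y z u := by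
  unfold B4 bad4
  simp only [tcx8]

theorem dvec_jn {L : Type*} (G : SimpleGraph V) (c : V → L) (x y z : V) :
    (dvec (tcx (jn G c x y) (jn G c x z) (jn G c y z)) : ℝ) =
      9 * (jb G x y : ℝ) + 9 * (jb G x z : ℝ) - 4 := by
  have h : dvec (tcx (jn G c x y) (jn G c x z) (jn G c y z)) =
      9 * (jb G x y : ℤ) + 9 * (jb G x z : ℤ) - 4 := by
    unfold dvec
    rw [Int.subNatNat_eq_coe]
    have h1 := jn_mod G c x y
    have h2 := jn_mod G c x z
    have h3 := jn_mod G c y z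
    have h4 := jb_01 G x y
    have h5 := jb_01 G x z
    unfold tcx; push_cast; omega
  rw [h]; push_cast; ring

theorem tvec_jn {L : Type*} (G : SimpleGraph V) (c : V → L) (x y z : V) :
    (tvec (tcx (jn G c x y) (jn G c x z) (jn G c y z)) : ℝ) =
      81 * ((jb G x y : ℝ) * (jb G x z : ℝ) * (jb G y z : ℝ)) - 2 := by
  unfold tvec
  rw [tcx8]
  rcases jb_01 G x y with h1 | h1 <;> rcases jb_01 G x z with h2 | h2 <;>
    rcases jb_01 G y z with h3 | h3 <;> simp [h1, h2, h3, tcx] <;> norm_num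

/-- An optimal labelling. -/
theorem exists_label (G : SimpleGraph V) (ω : V → ℝ) :
    ∃ c : V → Option V, ∀ x y, jn G c x y % 2 = 1 → 0 ≤ ∑ u, ∑ w, ω u * ω w *
      (colA (inA (jn G c x u) (jn G c y u)) (inA (jn G c x w) (jn G c y w)) (jn G c u w) : ℝ) := by
  set h : (V → Option V) → V → V → ℝ := fun c u w =>
    ω u * ω w * (if c u = c w then (if G.Adj u w then 2 else -1) else 0) with hh
  obtain ⟨c, hc⟩ := Finite.exists_max (fun c : V → Option V => ∑ u, ∑ w, h c u w)
  refine ⟨c, fun x y _ => ?_⟩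
  obtain ⟨l, hl⟩ : ∃ l, ∀ u, c u ≠ l := by
    by_contra hcon
    push Not at hcon
    have h1 := Fintype.card_le_of_surjective c hcon
    rw [Fintype.card_option] at h1
    omega
  set c' : V → Option V := fun u => if (G.Adj x u ∨ G.Adj y u) then l else c u with hc'
  have key : ∀ u w, ω u * ω w * (colA (inA (jn G c x u) (jn G c y u)) (inA (jn G c x w)
      (jn G c y w)) (jn G c u w) : ℝ) + ω w * ω u * (colA (inA (jn G c x w) (jn G c y w))
      (inA (jn G c x u) (jn G c y u)) (jn G c w u) : ℝ) = 2 * (h c u w - h c' u w) := by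
    intro u w
    have hi : ∀ u, inA (jn G c x u) (jn G c y u) = decide (G.Adj x u ∨ G.Adj y u) := by
      intro u
      unfold inA jn
      by_cases h1 : G.Adj x u <;> by_cases h2 : G.Adj y u <;> by_cases h3 : c x = c u <;>
        by_cases h4 : c y = c u <;> simp [h1, h2, h3, h4]
    rw [hi, hi, jn_symm G c w u]
    simp only [hh, hc']
    have hlu := hl u
    have hlw := hl w
    by_cases hu : (G.Adj x u ∨ G.Adj y u) <;> by_cases hw : (G.Adj x w ∨ G.Adj y w) <;>
      simp only [hu, hw, if_true, if_false, decide_true, decide_false, colA, jn, hlu, hlw.symm] <;>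
      by_cases h1 : c u = c w <;> by_cases h2 : G.Adj u w <;> simp [h1, h2] <;> ring
  have e1 : ∑ u, ∑ w, (ω u * ω w * (colA (inA (jn G c x u) (jn G c y u)) (inA (jn G c x w)
      (jn G c y w)) (jn G c u w) : ℝ) + ω w * ω u * (colA (inA (jn G c x w) (jn G c y w))
      (inA (jn G c x u) (jn G c y u)) (jn G c w u) : ℝ)) =
      2 * (∑ u, ∑ w, h c u w - ∑ u, ∑ w, h c' u w) := by
    simp only [key, mul_sub, mul_sum, sum_sub_distrib]
  have e2 := sum_comm (s := univ) (t := univ) (f := fun u w : V => ω w * ω u *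
    (colA (inA (jn G c x w) (jn G c y w)) (inA (jn G c x u) (jn G c y u)) (jn G c w u) : ℝ))
  simp only [sum_add_distrib] at e1
  rw [e2] at e1
  have := hc c'
  linarith

theorem fT_split (C : Cert) (j : V → V → ℕ) (ω : V → ℝ) :
    S5 ω (fun x y z u w => (fT C (j x y) (j x z) (j y z) (j x u)
      (j y u) (j z u) (j x w) (j y w) (j z w) (j u w) : ℝ)) =
    S5 ω (fun x y z u w => (e3 C (tcx (j x y) (j x z) (j y z)) (tcx (j x u) (j y u) (j z u))
      (tcx (j x w) (j y w) (j z w)) : ℝ)) +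
    (S5 ω (fun x y z u w => (e1 C (tcx (j x y) (j x z) (j y z)) (tcx (j x u) (j x w) (j u w)) : ℝ)) +
    (S5 ω (fun x y z u w => (eA C (tcx (j x y) (j x z) (j y z)) (inA (j x u) (j y u))
      (inA (j x w) (j y w)) (j u w) : ℝ)) +
    (S5 ω (fun x y z u _ => (eX C (j x y) (j z u) : ℝ)) +
    S5 ω (fun x y z u _ => (eB C (tcx (j x y) (j x z) (j y z)) (tcx (j x u) (j y u) (j z u)) : ℝ))))) := by
  rw [← S5_add, ← S5_add, ← S5_add, ← S5_add]
  congr; funext x y z u w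
  unfold fT; push_cast; ring

theorem core (G : SimpleGraph V) (ω : V → ℝ) (hω : ∀ x, 0 ≤ ω x) :
    S5 ω (E5 G) ≤ (280/729 - 1/100000) * (∑ x, ω x) ^ 5 ∨
    S5 ω (E5 G) + 1/2000 * ((∑ x, ω x) * ∑ x, ∑ y, ∑ z, ∑ u, ω x * ω y * ω z * ω u * B4 G x y z u)
      + 1/10000 * (∑ x, ω x) ^ 2 * ∑ x, ω x * (9 * (∑ y, ω y * jb G x y) - 2 * ∑ x, ω x) ^ 2
      + 1/1000000 * ∑ x, ω x * (81 * (∑ y, ∑ z, ω y * ω z * (jb G x y * jb G x z * jb G y z))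
          - 2 * (∑ x, ω x) ^ 2) ^ 2
      ≤ 280/729 * (∑ x, ω x) ^ 5 := by
  obtain ⟨c, hc⟩ := exists_label G ω
  set Ω := ∑ x, ω x with hΩ
  have hΩ0 : 0 ≤ Ω := sum_nonneg fun x _ => hω x
  set X := ∑ x, ∑ y, ω x * ω y * (if jn G c x y = 1 then (1:ℝ) else 0) with hX
  have hX0 : 0 ≤ X := sum_nonneg fun x _ => sum_nonneg fun y _ =>
    mul_nonneg (mul_nonneg (hω x) (hω y)) (by split_ifs <;> norm_num)
  by_cases hcase : X ≤ 9/2000 * Ω ^ 2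
  · right
    have h := cert_sum cert2 good2 G c ω hω
    rw [fT_split, S5_eX, S5_eB] at h
    have h3 := S5_e3 cert2 good2 (jn G c) ω hω
    have h1 := S5_e1 cert2 good2 (jn G c) ω hω
    have hA := S5_eA cert2 good2 (jn G c) ω hω hc
    rw [← hX, ← hΩ] at h
    simp only [bad4_jn, e2N_jn] at h
    simp only [dvec_jn, tvec_jn] at h1
    have hd : ∀ x, ∑ y, ∑ z, ω y * ω z * (9 * (jb G x y : ℝ) + 9 * (jb G x z : ℝ) - 4) =
        2 * Ω * (9 * (∑ y, ω y * jb G x y) - 2 * Ω) := by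
      intro x
      have : ∀ y z, ω y * ω z * (9 * (jb G x y : ℝ) + 9 * (jb G x z : ℝ) - 4) =
        9 * ((ω y * jb G x y) * ω z) + (9 * (ω y * (ω z * jb G x z)) - 4 * (ω y * ω z)) := by
        intro y z; ring
      simp only [this, sum_add_distrib, sum_sub_distrib, ← mul_sum, ← sum_mul]
      rw [← hΩ]; ring
    have ht : ∀ x, ∑ y, ∑ z, ω y * ω z * (81 * ((jb G x y : ℝ) * (jb G x z : ℝ) * (jb G y z : ℝ)) - 2) =
        81 * (∑ y, ∑ z, ω y * ω z * (jb G x y * jb G x z * jb G y z)) - 2 * Ω ^ 2 := by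
      intro x
      have : ∀ y z, ω y * ω z * (81 * ((jb G x y : ℝ) * (jb G x z : ℝ) * (jb G y z : ℝ)) - 2) =
        81 * (ω y * ω z * (jb G x y * jb G x z * jb G y z)) - 2 * (ω y * ω z) := by
        intro y z; ring
      simp only [this, sum_sub_distrib, ← mul_sum, ← sum_mul]
      rw [← hΩ]; ring
    simp only [hd, ht] at h1
    set D := ∑ x, ω x * (9 * (∑ y, ω y * jb G x y) - 2 * Ω) ^ 2 with hD
    set R := ∑ x, ω x * (81 * (∑ y, ∑ z, ω y * ω z * (jb G x y * jb G x z * jb G y z))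
          - 2 * Ω ^ 2) ^ 2 with hR
    have hD' : ∑ x, ω x * (2 * Ω * (9 * (∑ y, ω y * jb G x y) - 2 * Ω)) ^ 2 = 4 * Ω ^ 2 * D := by
      rw [hD]; refine Eq.trans (sum_congr rfl fun x _ => ?_) (mul_sum _ _ _).symm; ring
    rw [hD'] at h1
    have hD0 : 0 ≤ D := sum_nonneg fun x _ => mul_nonneg (hω x) (sq_nonneg _)
    have hR0 : 0 ≤ R := sum_nonneg fun x _ => mul_nonneg (hω x) (sq_nonneg _)
    have hXX : 0 ≤ Ω * ((cert2.cX : ℝ) * Ω ^ 2 * X - cert2.cXX * X ^ 2) := by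
      have : (cert2.cX : ℝ) * Ω ^ 2 * X - cert2.cXX * X ^ 2 =
        1738530196000 * (X * (9/2000 * Ω^2 - X)) := by simp only [cert2]; push_cast; ring
      rw [this]
      have : 0 ≤ 9/2000 * Ω^2 - X := by linarith
      positivity
    have e : S5 ω (fun x y z u w => E5 G x y z u w) = S5 ω (E5 G) := rfl
    rw [e] at h
    have hp : 0 ≤ Ω ^ 2 * D := by positivity
    set Bd := Ω * ∑ x, ∑ y, ∑ z, ∑ u, ω x * ω y * ω z * ω u * B4 G x y z u with hBd
    have n1 : (cert2.cE : ℝ) = 145800000000 := by simp [cert2]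
    have n2 : (cert2.cB : ℝ) = 72900000 := by simp [cert2]
    have n3 : (cert2.xd : ℝ) = 7288562 := by simp [cert2]
    have n4 : (cert2.xt : ℝ) = 145800 := by simp [cert2]
    have n5 : (cert2.bound : ℝ) = 6720000000000 := by simp [cert2]
    rw [n1, n2, n5] at h
    rw [n3, n4] at h1
    nlinarith
  · left
    push Not at hcase
    have h := cert_sum cert1 good1 G c ω hω
    rw [fT_split, S5_eX, S5_eB] at h
    have h3 := S5_e3 cert1 good1 (jn G c) ω hω
    have h1 := S5_e1 cert1 good1 (jn G c) ω hω
    have hA := S5_eA cert1 good1 (jn G c) ω hω hc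
    rw [← hX, ← hΩ] at h
    simp only [e2N_jn] at h
    have e : S5 ω (fun x y z u w => E5 G x y z u w) = S5 ω (E5 G) := rfl
    rw [e] at h
    have n1 : (cert1.cE : ℝ) = 14580000000 := by simp [cert1]
    have n2 : (cert1.cB : ℝ) = 0 := by simp [cert1]
    have n3 : (cert1.xd : ℝ) = 0 := by simp [cert1]
    have n4 : (cert1.xt : ℝ) = 0 := by simp [cert1]
    have n5 : (cert1.bound : ℝ) = 672368108544 := by simp [cert1]
    have n6 : (cert1.cX : ℝ) = 729000000 := by simp [cert1]
    have n7 : (cert1.cXX : ℝ) = 0 := by simp [cert1]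
    rw [n1, n2, n5, n6, n7] at h
    rw [n3, n4] at h1
    have hp : Ω ^ 3 * (9/2000 * Ω ^ 2) ≤ Ω ^ 3 * X := mul_le_mul_of_nonneg_left hcase.le (by positivity)
    nlinarith [pow_nonneg hΩ0 5]
end core4
end EI

namespace EI
set_option linter.unusedSectionVars false
section rooted
variable {V : Type*} [Fintype V]

theorem E5_nonneg (G : SimpleGraph V) (x y z u w : V) : 0 ≤ E5 G x y z u w := by
  unfold E5; positivity

theorem B4_nonneg (G : SimpleGraph V) (x y z u : V) : 0 ≤ B4 G x y z u := by
  unfold B4 bad4; split_ifs <;> norm_num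

theorem E5_01 (G : SimpleGraph V) (x y z u w : V) : E5 G y x z u w = E5 G x y z u w := by
  unfold E5 at5 e2N; rw [jb_symm G y x]; congr 3; ring
theorem E5_02 (G : SimpleGraph V) (x y z u w : V) : E5 G z y x u w = E5 G x y z u w := by
  unfold E5 at5 e2N; rw [jb_symm G z y, jb_symm G z x, jb_symm G y x]; congr 3; ring
theorem E5_03 (G : SimpleGraph V) (x y z u w : V) : E5 G u y z x w = E5 G x y z u w := by
  unfold E5 at5 e2N; rw [jb_symm G u y, jb_symm G u z, jb_symm G u x, jb_symm G y x, jb_symm G z x]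
  congr 3; ring
theorem E5_04 (G : SimpleGraph V) (x y z u w : V) : E5 G w y z u x = E5 G x y z u w := by
  unfold E5 at5 e2N
  rw [jb_symm G w y, jb_symm G w z, jb_symm G w u, jb_symm G w x, jb_symm G y x, jb_symm G z x,
    jb_symm G u x]
  congr 3; ring

theorem S5_one (f : V → V → V → V → V → ℝ) :
    S5 (fun _ => 1) f = ∑ x, ∑ y, ∑ z, ∑ u, ∑ w, f x y z u w := by
  unfold S5; simp

theorem bern5 (a b c d e : ℝ) (ha : 0 ≤ a) (hb : 0 ≤ b) (hc : 0 ≤ c) (hd : 0 ≤ d) (he : 0 ≤ e) :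
    1 + (a + (b + (c + (d + e)))) ≤ (1 + a) * (1 + b) * (1 + c) * (1 + d) * (1 + e) := by
  have h1 : 1 + (a + b) ≤ (1 + a) * (1 + b) := by nlinarith [mul_nonneg ha hb]
  have step : ∀ p q r : ℝ, 0 ≤ q → 0 ≤ r → 1 + q ≤ p → 1 + (q + r) ≤ p * (1 + r) := by
    intro p q r hq hr h
    nlinarith [mul_nonneg hq hr]
  have h2 := step _ _ c (by positivity) hc h1
  have h3 := step _ _ d (by positivity) hd h2
  have h4 := step _ _ e (by positivity) he h3
  linarith

theorem S5_E_root (G : SimpleGraph V) (x0 : V) (M : ℝ) (hM : 0 ≤ M) :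
    S5 (fun _ => 1) (E5 G) + 5 * M * (∑ y, ∑ z, ∑ u, ∑ w, E5 G x0 y z u w) ≤
    S5 (fun x => 1 + M * (if x = x0 then 1 else 0)) (E5 G) := by
  set b : V → ℝ := fun x => M * (if x = x0 then 1 else 0) with hb
  have hb0 : ∀ x, 0 ≤ b x := fun x => by simp only [hb]; split_ifs <;> simp [hM]
  have hx : S5 (fun _ => 1) (fun x y z u w => b x * E5 G x y z u w) =
      M * (∑ y, ∑ z, ∑ u, ∑ w, E5 G x0 y z u w) := by
    rw [S5_one]
    simp only [← mul_sum]
    rw [Finset.sum_eq_single x0]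
    · simp [hb]
    · intro x _ hx; simp [hb, hx]
    · simp
  have h1 : S5 (fun _ => 1) (fun x y z u w => b y * E5 G x y z u w) =
      S5 (fun _ => 1) (fun x y z u w => b x * E5 G x y z u w) := by
    rw [← S5_01]; simp only [E5_01]
  have h2 : S5 (fun _ => 1) (fun x y z u w => b z * E5 G x y z u w) =
      S5 (fun _ => 1) (fun x y z u w => b x * E5 G x y z u w) := by
    rw [← S5_02]; simp only [E5_02]
  have h3 : S5 (fun _ => 1) (fun x y z u w => b u * E5 G x y z u w) =
      S5 (fun _ => 1) (fun x y z u w => b x * E5 G x y z u w) := by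
    rw [← S5_03]; simp only [E5_03]
  have h4 : S5 (fun _ => 1) (fun x y z u w => b w * E5 G x y z u w) =
      S5 (fun _ => 1) (fun x y z u w => b x * E5 G x y z u w) := by
    rw [← S5_04]; simp only [E5_04]
  have hsum : S5 (fun _ => 1) (E5 G) + 5 * M * (∑ y, ∑ z, ∑ u, ∑ w, E5 G x0 y z u w) =
      S5 (fun _ => 1) (fun x y z u w => E5 G x y z u w + (b x * E5 G x y z u w +
      (b y * E5 G x y z u w + (b z * E5 G x y z u w + (b u * E5 G x y z u w +
        b w * E5 G x y z u w))))) := by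
    rw [S5_add, S5_add, S5_add, S5_add, S5_add, h1, h2, h3, h4, hx]
    have : S5 (fun _ => 1) (fun x y z u w => E5 G x y z u w) = S5 (fun _ => 1) (E5 G) := rfl
    rw [this]; ring
  rw [hsum]
  unfold S5
  refine sum_le_sum fun x _ => sum_le_sum fun y _ => sum_le_sum fun z _ => sum_le_sum fun u _ =>
    sum_le_sum fun w _ => ?_
  have hE := E5_nonneg G x y z u w
  have := mul_le_mul_of_nonneg_right (bern5 _ _ _ _ _ (hb0 x) (hb0 y) (hb0 z) (hb0 u) (hb0 w)) hE
  linarith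

/-- regularity of almost extremal graphs -/
structure Reg (G : SimpleGraph V) : Prop where
  bad : ∀ x, ∑ y, ∑ z, ∑ u, B4 G x y z u ≤ 1/10^36 * (Fintype.card V : ℝ)^3
  deg : ∀ x, |9 * (∑ y, (jb G x y : ℝ)) - 2 * (Fintype.card V : ℝ)| ≤ 1/10^16 * (Fintype.card V : ℝ)
  tri : ∀ x, (Fintype.card V : ℝ)^2 ≤ 81 * ∑ y, ∑ z, (jb G x y * jb G x z * jb G y z : ℝ)

theorem reg_aux (N M b d t Bd D R : ℝ) (hN' : 0 < N) (hM : M = N / 10^40) (hB0 : 0 ≤ b)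
    (hBd1 : M * b ≤ Bd) (hD1 : M * (9 * d - 2 * (N + M)) ^ 2 ≤ D)
    (hR1 : M * (81 * t - 2 * (N + M)^2) ^ 2 ≤ R)
    (hslack : 1/2000 * ((N + M) * Bd) + 1/10000 * (N + M)^2 * D + 1/1000000 * R ≤ 5/10^80 * N^5) :
    b ≤ 1/10^36 * N^3 ∧ |9 * d - 2 * N| ≤ 1/10^16 * N ∧ N^2 ≤ 81 * t := by
  have hM0 : 0 < M := by rw [hM]; positivity
  have hBd0 : 0 ≤ Bd := (mul_nonneg hM0.le hB0).trans hBd1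
  have hD0 : 0 ≤ D := (mul_nonneg hM0.le (sq_nonneg _)).trans hD1
  have hR0 : 0 ≤ R := (mul_nonneg hM0.le (sq_nonneg _)).trans hR1
  have q1 : N * (M * b) ≤ (N + M) * Bd :=
    mul_le_mul (by linarith) hBd1 (by positivity) (by positivity)
  have q2 : N^2 * (M * (9 * d - 2 * (N + M))^2) ≤ (N + M)^2 * D :=
    mul_le_mul (by gcongr; linarith) hD1 (by positivity) (by positivity)
  have p1 : 0 ≤ (N + M) * Bd := by positivity
  have p2 : 0 ≤ (N + M)^2 * D := by positivity
  refine ⟨?_, ?_, ?_⟩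
  · have h1 : N * (M * b) ≤ 1/10^76 * N^5 := by linarith
    have h2 : N * (M * b) = (N^2/10^40) * b := by rw [hM]; ring
    have h3 : 1/10^76 * N^5 = (N^2/10^40) * (1/10^36 * N^3) := by ring
    rw [h2, h3] at h1
    exact le_of_mul_le_mul_left h1 (by positivity)
  · have h1 : N^2 * (M * (9 * d - 2 * (N + M))^2) ≤ 5/10^76 * N^5 := by linarith
    have h2 : N^2 * (M * (9 * d - 2 * (N + M))^2) = (N^3/10^40) * (9 * d - 2 * (N + M))^2 := by
      rw [hM]; ring
    have h3 : 5/10^76 * N^5 = (N^3/10^40) * (5/10^36 * N^2) := by ring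
    rw [h2, h3] at h1
    have h4 : (9 * d - 2 * (N + M))^2 ≤ 5/10^36 * N^2 := le_of_mul_le_mul_left h1 (by positivity)
    have h5 : |9 * d - 2 * (N + M)| ≤ 1/10^17 * N := by
      apply abs_le_of_sq_le_sq _ (by positivity)
      refine h4.trans ?_
      have : (1/10^17 * N)^2 = 1/10^34 * N^2 := by ring
      rw [this]
      have : (0:ℝ) < N^2 := by positivity
      norm_num
      linarith
    rw [abs_le] at h5 ⊢
    rw [hM] at h5
    norm_num at h5 ⊢
    constructor <;> linarith
  · have h1 : M * (81 * t - 2 * (N + M)^2)^2 ≤ 5/10^74 * N^5 := by linarith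
    have h2 : M * (81 * t - 2 * (N + M)^2)^2 = (N/10^40) * (81 * t - 2 * (N + M)^2)^2 := by
      rw [hM]
    have h3 : 5/10^74 * N^5 = (N/10^40) * (5/10^34 * N^4) := by ring
    rw [h2, h3] at h1
    have h4 : (81 * t - 2 * (N + M)^2)^2 ≤ 5/10^34 * N^4 := le_of_mul_le_mul_left h1 (by positivity)
    have h5 : |81 * t - 2 * (N + M)^2| ≤ N^2 := by
      apply abs_le_of_sq_le_sq _ (by positivity)
      refine h4.trans ?_
      have : (N^2)^2 = N^4 := by ring
      rw [this]
      have : (0:ℝ) < N^4 := by positivity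
      norm_num
      linarith
    rw [abs_le] at h5
    nlinarith

theorem reg_of_rooted (G : SimpleGraph V) (hN : 0 < Fintype.card V)
    (hT : (280/729 - 1/10^80) * (Fintype.card V : ℝ)^5 ≤ S5 (fun _ => 1) (E5 G))
    (hTx : ∀ x, (280/729 - 1/10^80) * (Fintype.card V : ℝ)^4 ≤ ∑ y, ∑ z, ∑ u, ∑ w, E5 G x y z u w) :
    Reg G := by
  have hN' : (0:ℝ) < Fintype.card V := by exact_mod_cast hN
  have key : ∀ x0, ∑ y, ∑ z, ∑ u, B4 G x0 y z u ≤ 1/10^36 * (Fintype.card V : ℝ)^3 ∧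
    |9 * (∑ y, (jb G x0 y : ℝ)) - 2 * (Fintype.card V : ℝ)| ≤ 1/10^16 * (Fintype.card V : ℝ) ∧
    (Fintype.card V : ℝ)^2 ≤ 81 * ∑ y, ∑ z, (jb G x0 y * jb G x0 z * jb G y z : ℝ) := by
    intro x0
    set N : ℝ := ((Fintype.card V : ℕ) : ℝ) with hNdef
    set M : ℝ := N / 10^40 with hM
    have hM0 : 0 < M := by positivity
    set ω : V → ℝ := fun x => 1 + M * (if x = x0 then 1 else 0) with hω
    have hω1 : ∀ x, 1 ≤ ω x := fun x => by simp only [hω]; split_ifs <;> simp [hM0.le]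
    have hω0 : ∀ x, 0 ≤ ω x := fun x => zero_le_one.trans (hω1 x)
    have hωx : M ≤ ω x0 := by simp [hω]
    have hΩ : ∑ x, ω x = N + M := by
      simp only [hω, sum_add_distrib, ← mul_sum]
      simp [hNdef]
    have hroot := S5_E_root G x0 M hM0.le
    have hx := hTx x0
    have hjx : jb G x0 x0 = 0 := by simp [jb]
    have hdeg : ∑ y, ω y * jb G x0 y = ∑ y, (jb G x0 y : ℝ) := by
      refine sum_congr rfl fun y _ => ?_
      by_cases h : y = x0
      · subst h; simp [hjx]
      · simp [hω, h]
    have htr : ∑ y, ∑ z, ω y * ω z * (jb G x0 y * jb G x0 z * jb G y z) =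
        ∑ y, ∑ z, (jb G x0 y * jb G x0 z * jb G y z : ℝ) := by
      refine sum_congr rfl fun y _ => sum_congr rfl fun z _ => ?_
      by_cases h : y = x0
      · subst h; simp [hjx]
      · by_cases h' : z = x0
        · subst h'; simp [hjx]
        · simp [hω, h, h']
    set S := S5 ω (E5 G) with hS
    have hSlow : (280/729 - 1/10^80) * (1 + 5/10^40) * N^5 ≤ S := by
      have h5 : 5 * M * ((280/729 - 1/10^80) * N^4) ≤
        5 * M * (∑ y, ∑ z, ∑ u, ∑ w, E5 G x0 y z u w) :=
        mul_le_mul_of_nonneg_left hx (by positivity)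
      have e : (280/729 - 1/10^80) * (1 + 5/10^40) * N^5 = (280/729 - 1/10^80) * N^5 +
        5 * M * ((280/729 - 1/10^80) * N^4) := by rw [hM]; ring
      rw [e]; linarith
    have hc := core G ω hω0
    rw [hΩ] at hc
    have hΩ5 : (N + M)^5 = (1 + 1/10^40)^5 * N^5 := by rw [hM]; ring
    rw [hΩ5] at hc
    have hN5 : 0 < N^5 := by positivity
    rcases hc with hc | hc
    · exfalso
      have : (280/729 - 1/100000) * ((1 + 1/10^40)^5 * N^5) <
          (280/729 - 1/10^80) * (1 + 5/10^40) * N^5 := by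
        rw [← mul_assoc]
        apply mul_lt_mul_of_pos_right _ hN5
        norm_num
      linarith
    · set Bd := ∑ x, ∑ y, ∑ z, ∑ u, ω x * ω y * ω z * ω u * B4 G x y z u with hBd
      set D := ∑ x, ω x * (9 * (∑ y, ω y * jb G x y) - 2 * (N + M)) ^ 2 with hD
      set R := ∑ x, ω x * (81 * (∑ y, ∑ z, ω y * ω z * (jb G x y * jb G x z * jb G y z))
          - 2 * (N + M) ^ 2) ^ 2 with hR
      have hslack : 1/2000 * ((N + M) * Bd) + 1/10000 * (N + M)^2 * D + 1/1000000 * R ≤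
          5/10^80 * N^5 := by
        have : 280/729 * ((1 + 1/10^40)^5 * N^5) ≤ (280/729 - 1/10^80) * (1 + 5/10^40) * N^5
            + 5/10^80 * N^5 := by
          rw [← mul_assoc, ← add_mul]
          apply mul_le_mul_of_nonneg_right _ hN5.le
          norm_num
        linarith
      have hBd1 : M * ∑ y, ∑ z, ∑ u, B4 G x0 y z u ≤ Bd := by
        rw [hBd]
        have hnn : ∀ x ∈ (univ : Finset V), 0 ≤ ∑ y, ∑ z, ∑ u, ω x * ω y * ω z * ω u * B4 G x y z u := by
          intro x _
          refine sum_nonneg fun y _ => sum_nonneg fun z _ => sum_nonneg fun u _ => ?_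
          have := B4_nonneg G x y z u
          have := hω0 x; have := hω0 y; have := hω0 z; have := hω0 u
          positivity
        refine le_trans ?_ (single_le_sum hnn (mem_univ x0))
        simp only [mul_sum]
        refine sum_le_sum fun y _ => sum_le_sum fun z _ => sum_le_sum fun u _ => ?_
        apply mul_le_mul_of_nonneg_right _ (B4_nonneg G x0 y z u)
        have g1 : M * 1 ≤ ω x0 * ω y := mul_le_mul hωx (hω1 y) zero_le_one (hω0 _)
        have g2 : M * 1 * 1 ≤ ω x0 * ω y * ω z :=
          mul_le_mul g1 (hω1 z) zero_le_one (mul_nonneg (hω0 _) (hω0 _))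
        have g3 : M * 1 * 1 * 1 ≤ ω x0 * ω y * ω z * ω u :=
          mul_le_mul g2 (hω1 u) zero_le_one (mul_nonneg (mul_nonneg (hω0 _) (hω0 _)) (hω0 _))
        linarith
      have hB0 : 0 ≤ ∑ y, ∑ z, ∑ u, B4 G x0 y z u :=
        sum_nonneg fun y _ => sum_nonneg fun z _ => sum_nonneg fun u _ => B4_nonneg _ _ _ _ _
      have hD1 : M * (9 * (∑ y, (jb G x0 y : ℝ)) - 2 * (N + M)) ^ 2 ≤ D := by
        have hnn : ∀ x ∈ (univ : Finset V), 0 ≤ ω x * (9 * (∑ y, ω y * jb G x y) - 2 * (N + M)) ^ 2 :=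
          fun x _ => mul_nonneg (hω0 x) (sq_nonneg _)
        refine le_trans ?_ (single_le_sum hnn (mem_univ x0))
        rw [hdeg]
        exact mul_le_mul_of_nonneg_right hωx (sq_nonneg _)
      have hR1 : M * (81 * (∑ y, ∑ z, (jb G x0 y * jb G x0 z * jb G y z : ℝ)) - 2 * (N + M)^2) ^ 2 ≤ R := by
        have hnn : ∀ x ∈ (univ : Finset V), 0 ≤ ω x * (81 * (∑ y, ∑ z, ω y * ω z *
          (jb G x y * jb G x z * jb G y z)) - 2 * (N + M) ^ 2) ^ 2 :=
          fun x _ => mul_nonneg (hω0 x) (sq_nonneg _)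
        refine le_trans ?_ (single_le_sum hnn (mem_univ x0))
        simp only [htr]
        exact mul_le_mul_of_nonneg_right hωx (sq_nonneg _)
      exact reg_aux N M _ _ _ Bd D R hN' hM hB0 hBd1 hD1 hR1 hslack
  exact ⟨fun x => (key x).1, fun x => (key x).2.1, fun x => (key x).2.2⟩
end rooted
end EI

namespace EI
set_option linter.unusedSectionVars false
set_option linter.unusedVariables false
section struct1
variable {V : Type*} [Fintype V] (G : SimpleGraph V)

noncomputable def pT (a : Fin 3 → V) (v : V) : ℝ := B4 G (a 0) (a 1) (a 2) v
noncomputable def qT (a : Fin 3 → V) (w v : V) : ℝ :=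
  B4 G (a 0) (a 1) w v + B4 G (a 0) (a 2) w v + B4 G (a 1) (a 2) w v
def Tri (a : Fin 3 → V) : Prop := ∀ i k, G.Adj (a i) (a k) ↔ i ≠ k
def InS (a : Fin 3 → V) (i : Fin 3) (v : V) : Prop := ∀ k, G.Adj v (a k) ↔ k ≠ i
def Out (a : Fin 3 → V) (v : V) : Prop := ∀ k, ¬ G.Adj v (a k)
noncomputable def sI (a : Fin 3 → V) (i : Fin 3) (v : V) : ℝ := if InS G a i v then 1 else 0

variable {G}

theorem B4_eq {x y z u : V} (a b c d e f : ℕ) (h1 : jb G x y = a) (h2 : jb G x z = b)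
    (h3 : jb G y z = c) (h4 : jb G x u = d) (h5 : jb G y u = e) (h6 : jb G z u = f)
    (h : tblBad ((tcx a b c) % 8 + 8 * ((tcx d e f) % 8)) = 1) : B4 G x y z u = 1 := by
  unfold B4 bad4
  rw [h1, h2, h3, h4, h5, h6, if_pos h]

theorem jb1 {x y : V} (h : G.Adj x y) : jb G x y = 1 := by simp [jb, h]
theorem jb0 {x y : V} (h : ¬ G.Adj x y) : jb G x y = 0 := by simp [jb, h]

theorem pT_nonneg (a : Fin 3 → V) (v : V) : 0 ≤ pT G a v := B4_nonneg _ _ _ _ _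
theorem qT_nonneg (a : Fin 3 → V) (w v : V) : 0 ≤ qT G a w v :=
  add_nonneg (add_nonneg (B4_nonneg _ _ _ _ _) (B4_nonneg _ _ _ _ _)) (B4_nonneg _ _ _ _ _)

theorem sI_nonneg (a : Fin 3 → V) (i : Fin 3) (v : V) : 0 ≤ sI G a i v := by
  unfold sI; split_ifs <;> norm_num
theorem sI_le_one (a : Fin 3 → V) (i : Fin 3) (v : V) : sI G a i v ≤ 1 := by
  unfold sI; split_ifs <;> norm_num

theorem qT_pair (a : Fin 3 → V) (i : Fin 3) : ∃ p q : Fin 3, p ≠ q ∧ p ≠ i ∧ q ≠ i ∧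
    (∀ k, k ≠ i → k = p ∨ k = q) ∧ ∀ w v, B4 G (a p) (a q) w v ≤ qT G a w v := by
  have hn := B4_nonneg G
  fin_cases i
  · refine ⟨1, 2, by decide, by decide, by decide, by decide, fun w v => ?_⟩
    unfold qT; linarith [hn (a 0) (a 1) w v, hn (a 0) (a 2) w v]
  · refine ⟨0, 2, by decide, by decide, by decide, by decide, fun w v => ?_⟩
    unfold qT; linarith [hn (a 0) (a 1) w v, hn (a 1) (a 2) w v]
  · refine ⟨0, 1, by decide, by decide, by decide, by decide, fun w v => ?_⟩
    unfold qT; linarith [hn (a 0) (a 2) w v, hn (a 1) (a 2) w v]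

/-- missing edge inside a component -/
theorem qT_miss {a : Fin 3 → V} (ha : Tri G a) {i k : Fin 3} (hik : k ≠ i) {u w : V}
    (hu : InS G a i u) (hw : InS G a k w) (h : ¬ G.Adj u w) : 1 ≤ qT G a u w := by
  obtain ⟨p, q, hpq, hpi, hqi, hk, hle⟩ := qT_pair (G := G) a i
  refine le_trans (le_of_eq ?_) (hle u w)
  have e1 := jb1 ((ha p q).2 hpq)
  have e2 := jb1 ((hu p).2 hpi).symm
  have e3 := jb1 ((hu q).2 hqi).symm
  have e6 := jb0 h
  rcases hk k hik with rfl | rfl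
  · have e4 : jb G (a k) w = 0 := jb0 fun hh => (hw k).1 hh.symm rfl
    have e5 := jb1 ((hw q).2 hpq.symm).symm
    exact (B4_eq _ _ _ _ _ _ e1 e2 e3 e4 e5 e6 (by decide)).symm
  · have e5 : jb G (a k) w = 0 := jb0 fun hh => (hw k).1 hh.symm rfl
    have e4 := jb1 ((hw p).2 hpq).symm
    exact (B4_eq _ _ _ _ _ _ e1 e2 e3 e4 e5 e6 (by decide)).symm

/-- edge leaving a component -/
theorem qT_out {a : Fin 3 → V} (ha : Tri G a) {i : Fin 3} {w v : V}
    (hw : Out G a w) (hv : InS G a i v) (h : G.Adj w v) : 1 ≤ qT G a w v := by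
  obtain ⟨p, q, hpq, hpi, hqi, hk, hle⟩ := qT_pair (G := G) a i
  refine le_trans (le_of_eq ?_) (hle w v)
  have e1 := jb1 ((ha p q).2 hpq)
  have e2 : jb G (a p) w = 0 := jb0 fun hh => hw p hh.symm
  have e3 : jb G (a q) w = 0 := jb0 fun hh => hw q hh.symm
  have e4 := jb1 ((hv p).2 hpi).symm
  have e5 := jb1 ((hv q).2 hqi).symm
  exact (B4_eq _ _ _ _ _ _ e1 e2 e3 e4 e5 (jb1 h) (by decide)).symm

theorem trich {a : Fin 3 → V} (ha : Tri G a) (v : V) :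
    Out G a v ∨ (∃ k, InS G a k v) ∨ pT G a v = 1 := by
  have e1 := jb1 ((ha 0 1).2 (by decide))
  have e2 := jb1 ((ha 0 2).2 (by decide))
  have e3 := jb1 ((ha 1 2).2 (by decide))
  by_cases h0 : G.Adj v (a 0) <;> by_cases h1 : G.Adj v (a 1) <;> by_cases h2 : G.Adj v (a 2)
  · exact Or.inr (Or.inr (B4_eq _ _ _ _ _ _ e1 e2 e3 (jb1 h0.symm) (jb1 h1.symm) (jb1 h2.symm) (by decide)))
  · refine Or.inr (Or.inl ⟨2, fun k => ?_⟩)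
    fin_cases k <;> simp [h0, h1, h2]
  · refine Or.inr (Or.inl ⟨1, fun k => ?_⟩)
    fin_cases k <;> simp [h0, h1, h2]
  · exact Or.inr (Or.inr (B4_eq _ _ _ _ _ _ e1 e2 e3 (jb1 h0.symm) (jb0 fun h => h1 h.symm)
      (jb0 fun h => h2 h.symm) (by decide)))
  · refine Or.inr (Or.inl ⟨0, fun k => ?_⟩)
    fin_cases k <;> simp [h0, h1, h2]
  · exact Or.inr (Or.inr (B4_eq _ _ _ _ _ _ e1 e2 e3 (jb0 fun h => h0 h.symm) (jb1 h1.symm)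
      (jb0 fun h => h2 h.symm) (by decide)))
  · exact Or.inr (Or.inr (B4_eq _ _ _ _ _ _ e1 e2 e3 (jb0 fun h => h0 h.symm)
      (jb0 fun h => h1 h.symm) (jb1 h2.symm) (by decide)))
  · refine Or.inl fun k => ?_
    fin_cases k <;> simp [h0, h1, h2]

theorem InS_unique {a : Fin 3 → V} {i k : Fin 3} {v : V} (h1 : InS G a i v) (h2 : InS G a k v) :
    i = k := by
  by_contra h
  exact (h1 i).1 ((h2 i).2 h) rfl

theorem sI_of_InS {a : Fin 3 → V} {k : Fin 3} {v : V} (h : InS G a k v) (i : Fin 3) :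
    sI G a i v = if i = k then 1 else 0 := by
  unfold sI
  by_cases hik : i = k
  · subst hik; simp [h]
  · rw [if_neg hik, if_neg fun h' => hik (InS_unique h' h)]

theorem InS_not_out {a : Fin 3 → V} {k : Fin 3} {v : V} (h : InS G a k v) : ¬ Out G a v := by
  intro ho
  have : ∃ m : Fin 3, m ≠ k := by fin_cases k; exacts [⟨1, by decide⟩, ⟨0, by decide⟩, ⟨0, by decide⟩]
  obtain ⟨m, hm⟩ := this
  exact ho m ((h m).2 hm)

theorem sI_of_Out {a : Fin 3 → V} {v : V} (h : Out G a v) (i : Fin 3) : sI G a i v = 0 := by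
  unfold sI
  rw [if_neg fun h' => InS_not_out h' h]

theorem sI_sum_le (a : Fin 3 → V) (v : V) : ∑ k, sI G a k v ≤ 1 := by
  by_cases h : ∃ k, InS G a k v
  · obtain ⟨k, hk⟩ := h
    simp [sI_of_InS hk]
  · push Not at h
    have : ∀ k, sI G a k v = 0 := fun k => by unfold sI; rw [if_neg (h k)]
    simp [this]

theorem deg_pt {a : Fin 3 → V} (ha : Tri G a) (i : Fin 3) (v : V) :
    |(jb G (a i) v : ℝ) - (∑ k, sI G a k v - sI G a i v)| ≤ pT G a v := by
  rcases trich ha v with h | ⟨k, hk⟩ | h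
  · have : jb G (a i) v = 0 := jb0 fun hh => h i hh.symm
    simp [this, sI_of_Out h, pT_nonneg]
  · have : (jb G (a i) v : ℝ) = if i = k then 0 else 1 := by
      by_cases hik : i = k
      · subst hik; rw [jb0 fun hh => (hk i).1 hh.symm rfl]; simp
      · rw [jb1 ((hk i).2 hik).symm]; simp [hik]
    rw [this]
    simp only [sI_of_InS hk]
    have := pT_nonneg (G := G) a v
    by_cases hik : i = k <;> simp [hik, this]
  · rw [h]
    have h1 := sI_sum_le (G := G) a v
    have h2 := sI_nonneg (G := G) a i v
    have h3 : sI G a i v ≤ ∑ k, sI G a k v :=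
      single_le_sum (fun k _ => sI_nonneg a k v) (mem_univ i)
    have h4 : (jb G (a i) v : ℝ) = 0 ∨ (jb G (a i) v : ℝ) = 1 := by
      rcases jb_01 G (a i) v with h | h <;> simp [h]
    rw [abs_le]
    rcases h4 with h4 | h4 <;> rw [h4] <;> constructor <;> linarith

theorem cover_pt {a : Fin 3 → V} (ha : Tri G a) (v : V) :
    1 ≤ (if Out G a v then 1 else 0) + (∑ k, sI G a k v) + pT G a v := by
  have h1 : 0 ≤ ∑ k, sI G a k v := sum_nonneg fun k _ => sI_nonneg a k v
  have h2 := pT_nonneg (G := G) a v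
  rcases trich ha v with h | ⟨k, hk⟩ | h
  · rw [if_pos h]; linarith
  · simp only [sI_of_InS hk]
    rw [Finset.sum_ite_eq' univ k]
    simp only [mem_univ, if_true]
    split_ifs <;> linarith
  · rw [h]; split_ifs <;> linarith

theorem pick (hreg : Reg G) (hN : 0 < Fintype.card V) (X : Finset V)
    (hX : (Fintype.card V : ℝ) / 10 ≤ X.card)
    (f : V → V → V → ℝ) (hf : ∀ x y z, 0 ≤ f x y z) (K : ℝ) (hK0 : 0 < K)
    (hK : ∑ x, ∑ y, ∑ z, f x y z ≤ K * (Fintype.card V : ℝ)^5) :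
    ∃ x ∈ X, ∃ y z, Tri G ![x, y, z] ∧ f x y z ≤ 1000 * K * (Fintype.card V : ℝ)^2 := by
  have hN' : (0:ℝ) < Fintype.card V := by exact_mod_cast hN
  set N : ℝ := ((Fintype.card V : ℕ) : ℝ) with hNdef
  by_contra hcon
  push Not at hcon
  have h1 : ∀ x ∈ X, ∀ y z, 1000 * K * N^2 * (jb G x y * jb G x z * jb G y z : ℝ) ≤ f x y z := by
    intro x hx y z
    by_cases ht : G.Adj x y ∧ G.Adj x z ∧ G.Adj y z
    · obtain ⟨h1, h2, h3⟩ := ht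
      have htri : Tri G ![x, y, z] := by
        intro i k
        fin_cases i <;> fin_cases k <;> simp [h1, h2, h3, h1.symm, h2.symm, h3.symm]
      have := hcon x hx y z htri
      rw [jb1 h1, jb1 h2, jb1 h3]; push_cast; linarith
    · have : (jb G x y * jb G x z * jb G y z : ℝ) = 0 := by
        by_cases h1 : G.Adj x y <;> by_cases h2 : G.Adj x z <;> by_cases h3 : G.Adj y z <;>
          simp_all [jb]
      rw [this, mul_zero]; exact hf x y z
  have h2 : ∑ x ∈ X, ∑ y, ∑ z, 1000 * K * N^2 * (jb G x y * jb G x z * jb G y z : ℝ) ≤ K * N^5 := by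
    refine le_trans ?_ hK
    refine le_trans (sum_le_sum fun x hx => sum_le_sum fun y _ => sum_le_sum fun z _ => h1 x hx y z) ?_
    exact sum_le_univ_sum_of_nonneg fun x => sum_nonneg fun y _ => sum_nonneg fun z _ => hf x y z
  simp only [← mul_sum] at h2
  have h3 : (X.card : ℝ) * (N^2/81) ≤ ∑ x ∈ X, ∑ y, ∑ z, (jb G x y * jb G x z * jb G y z : ℝ) := by
    rw [← nsmul_eq_mul]
    apply card_nsmul_le_sum
    intro x _
    have := hreg.tri x
    linarith
  have h4 : N / 10 * (N^2/81) ≤ X.card * (N^2/81) := mul_le_mul_of_nonneg_right hX (by positivity)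
  have h5 := mul_le_mul_of_nonneg_left (h4.trans h3) (by positivity : 0 ≤ 1000 * K * N^2)
  have h6 : 1000 * K * N^2 * (N / 10 * (N^2/81)) = 1000/810 * (K * N^5) := by ring
  rw [h6] at h5
  have h7 : 0 < K * N^5 := by positivity
  linarith
end struct1
end EI

namespace EI
set_option linter.unusedSectionVars false
set_option linter.unusedVariables false
section struct2
variable {V : Type*} [Fintype V] (G : SimpleGraph V)

structure GoodT (κ : ℝ) (a : Fin 3 → V) : Prop where
  tri : Tri G a
  p : ∑ v, pT G a v ≤ κ * (Fintype.card V : ℝ)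
  q : ∑ w, ∑ v, qT G a w v ≤ κ * (Fintype.card V : ℝ)^2

noncomputable def cost0 (x y z : V) : ℝ :=
  (Fintype.card V : ℝ) * ∑ v, pT G ![x, y, z] v + ∑ w, ∑ v, qT G ![x, y, z] w v

noncomputable def crossC (a : Fin 3 → V) (x y z : V) : ℝ :=
  (Fintype.card V : ℝ) * (∑ v, qT G a x v + ∑ v, qT G a y v + ∑ v, qT G a z v) +
  (Fintype.card V : ℝ)^2 * (qT G a x y + qT G a x z + pT G a y + pT G a z)

variable {G}

theorem cost0_nonneg (x y z : V) : 0 ≤ cost0 G x y z :=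
  add_nonneg (mul_nonneg (Nat.cast_nonneg _) (sum_nonneg fun v _ => pT_nonneg _ v))
    (sum_nonneg fun w _ => sum_nonneg fun v _ => qT_nonneg _ w v)

theorem qs_nonneg (a : Fin 3 → V) (x : V) : 0 ≤ ∑ v, qT G a x v := sum_nonneg fun v _ => qT_nonneg _ x v

theorem crossC_nonneg (a : Fin 3 → V) (x y z : V) : 0 ≤ crossC G a x y z := by
  unfold crossC
  have := qs_nonneg (G := G) a x
  have := qs_nonneg (G := G) a y
  have := qs_nonneg (G := G) a z
  have := qT_nonneg (G := G) a x y
  have := qT_nonneg (G := G) a x z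
  have := pT_nonneg (G := G) a y
  have := pT_nonneg (G := G) a z
  exact add_nonneg (mul_nonneg (Nat.cast_nonneg _) (by linarith))
    (mul_nonneg (pow_nonneg (Nat.cast_nonneg _) _) (by linarith))

theorem cost0_sum (hreg : Reg G) :
    ∑ x, ∑ y, ∑ z, cost0 G x y z ≤ 4/10^36 * (Fintype.card V : ℝ)^5 := by
  set N : ℝ := ((Fintype.card V : ℕ) : ℝ) with hNdef
  have hB : ∑ x, ∑ y, ∑ z, ∑ u, B4 G x y z u ≤ 1/10^36 * N^4 := by
    refine (sum_le_sum fun x _ => hreg.bad x).trans_eq ?_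
    rw [sum_const, card_univ, nsmul_eq_mul]; ring
  have e : ∑ x, ∑ y, ∑ z, cost0 G x y z = 4 * N * ∑ x, ∑ y, ∑ z, ∑ u, B4 G x y z u := by
    unfold cost0 pT qT
    simp only [Matrix.cons_val_zero, Matrix.cons_val_one, Matrix.cons_val]
    simp only [sum_add_distrib]
    have e1 : ∑ x : V, ∑ y : V, ∑ z : V, N * ∑ v, B4 G x y z v = N * ∑ x, ∑ y, ∑ z, ∑ u, B4 G x y z u := by
      simp only [mul_sum]
    have e2 : ∑ x : V, ∑ y : V, ∑ z : V, ∑ w, ∑ v, B4 G x y w v = N * ∑ x, ∑ y, ∑ z, ∑ u, B4 G x y z u := by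
      simp only [sum_const, card_univ, nsmul_eq_mul, mul_sum]; rfl
    have e3 : ∑ x : V, ∑ y : V, ∑ z : V, ∑ w, ∑ v, B4 G x z w v = N * ∑ x, ∑ y, ∑ z, ∑ u, B4 G x y z u := by
      simp only [sum_const, card_univ, nsmul_eq_mul, mul_sum]; rfl
    have e4 : ∑ x : V, ∑ y : V, ∑ z : V, ∑ w, ∑ v, B4 G y z w v = N * ∑ x, ∑ y, ∑ z, ∑ u, B4 G x y z u := by
      simp only [sum_const, card_univ, nsmul_eq_mul, mul_sum]; rfl
    rw [e1, e2, e3, e4]; ring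
  rw [e]
  have : 0 ≤ N := Nat.cast_nonneg _
  have := mul_le_mul_of_nonneg_left hB (by positivity : 0 ≤ 4 * N)
  refine this.trans_eq (by ring)

theorem crossC_sum {κ : ℝ} {a : Fin 3 → V} (ha : GoodT G κ a) :
    ∑ x, ∑ y, ∑ z, crossC G a x y z ≤ 7 * κ * (Fintype.card V : ℝ)^5 := by
  set N : ℝ := ((Fintype.card V : ℕ) : ℝ) with hNdef
  have e : ∑ x, ∑ y, ∑ z, crossC G a x y z =
      5 * N^3 * (∑ w, ∑ v, qT G a w v) + 2 * N^4 * ∑ v, pT G a v := by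
    unfold crossC
    simp only [← hNdef, mul_add, sum_add_distrib, ← mul_sum]
    simp only [sum_const, card_univ, nsmul_eq_mul, ← mul_sum, ← hNdef]
    ring
  rw [e]
  have : 0 ≤ N := Nat.cast_nonneg _
  have h1 := mul_le_mul_of_nonneg_left ha.q (by positivity : 0 ≤ 5 * N^3)
  have h2 := mul_le_mul_of_nonneg_left ha.p (by positivity : 0 ≤ 2 * N^4)
  rw [← hNdef] at h1 h2
  calc _ ≤ 5 * N^3 * (κ * N^2) + 2 * N^4 * (κ * N) := add_le_add h1 h2
    _ = _ := by ring

theorem goodT_of_cost (hN : 0 < Fintype.card V) {x y z : V} {κ : ℝ} (ht : Tri G ![x, y, z])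
    (h : cost0 G x y z ≤ κ * (Fintype.card V : ℝ)^2) : GoodT G κ ![x, y, z] := by
  have hN' : (0:ℝ) < Fintype.card V := by exact_mod_cast hN
  have h1 : 0 ≤ ∑ v, pT G ![x, y, z] v := sum_nonneg fun v _ => pT_nonneg _ v
  have h2 : 0 ≤ ∑ w, ∑ v, qT G ![x, y, z] w v := sum_nonneg fun w _ => qs_nonneg _ w
  unfold cost0 at h
  refine ⟨ht, ?_, ?_⟩
  · have : (Fintype.card V : ℝ) * ∑ v, pT G ![x, y, z] v ≤
        (Fintype.card V : ℝ) * (κ * (Fintype.card V : ℝ)) := by nlinarith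
    exact le_of_mul_le_mul_left this hN'
  · have := mul_nonneg hN'.le h1
    linarith

theorem GoodT.mono {κ κ' : ℝ} (h : κ ≤ κ') {a : Fin 3 → V} (ha : GoodT G κ a) : GoodT G κ' a :=
  ⟨ha.tri, ha.p.trans (by gcongr), ha.q.trans (by gcongr)⟩

theorem size_part (hreg : Reg G) {a : Fin 3 → V} (ha : GoodT G (1/10^20) a) (k : Fin 3) :
    |∑ v, sI G a k v - (Fintype.card V : ℝ)/9| ≤ 1/10^15 * (Fintype.card V : ℝ) := by
  set N : ℝ := ((Fintype.card V : ℕ) : ℝ) with hNdef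
  have hN0 : 0 ≤ N := Nat.cast_nonneg _
  have h1 : ∀ i, |∑ v, (jb G (a i) v : ℝ) - (∑ k, ∑ v, sI G a k v - ∑ v, sI G a i v)| ≤ 1/10^20 * N := by
    intro i
    rw [sum_comm, ← sum_sub_distrib, ← sum_sub_distrib]
    refine (abs_sum_le_sum_abs _ _).trans ?_
    exact (sum_le_sum fun v _ => deg_pt ha.tri i v).trans ha.p
  have h2 := fun i => hreg.deg (a i)
  simp only [← hNdef] at h2
  simp only [Fin.sum_univ_three] at h1
  have a0 := abs_le.1 (h1 0)
  have a1 := abs_le.1 (h1 1)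
  have a2 := abs_le.1 (h1 2)
  have b0 := abs_le.1 (h2 0)
  have b1 := abs_le.1 (h2 1)
  have b2 := abs_le.1 (h2 2)
  norm_num at a0 a1 a2 b0 b1 b2
  rw [abs_le]
  norm_num
  obtain ⟨a01, a02⟩ := a0
  obtain ⟨a11, a12⟩ := a1
  obtain ⟨a21, a22⟩ := a2
  obtain ⟨b01, b02⟩ := b0
  obtain ⟨b11, b12⟩ := b1
  obtain ⟨b21, b22⟩ := b2
  fin_cases k <;> simp only [Fin.zero_eta, Fin.mk_one, Fin.reduceFinMk] <;> constructor <;> linarith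

/-- cross conditions between two reference triangles -/
theorem cross_ok (hN : 0 < Fintype.card V) {κ : ℝ} (hκ : κ < 1) {a : Fin 3 → V} (ha : Tri G a)
    {x y z : V} (ht : Tri G ![x, y, z]) (hx : Out G a x)
    (h : crossC G a x y z ≤ κ * (Fintype.card V : ℝ)^2) (k l : Fin 3) :
    ∑ v, sI G a k v * sI G ![x, y, z] l v ≤ κ * (Fintype.card V : ℝ) := by
  have hN' : (0:ℝ) < Fintype.card V := by exact_mod_cast hN
  set N : ℝ := ((Fintype.card V : ℕ) : ℝ) with hNdef
  have n1 := qs_nonneg (G := G) a x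
  have n2 := qs_nonneg (G := G) a y
  have n3 := qs_nonneg (G := G) a z
  have n4 := qT_nonneg (G := G) a x y
  have n5 := qT_nonneg (G := G) a x z
  have n6 := pT_nonneg (G := G) a y
  have n7 := pT_nonneg (G := G) a z
  unfold crossC at h
  rw [← hNdef] at h
  have hA : N * (∑ v, qT G a x v + ∑ v, qT G a y v + ∑ v, qT G a z v) ≤ N * (κ * N) := by
    have : 0 ≤ N^2 * (qT G a x y + qT G a x z + pT G a y + pT G a z) :=
      mul_nonneg (pow_nonneg hN'.le _) (by linarith)
    linarith
  have hA := le_of_mul_le_mul_left hA hN'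
  have hB : N^2 * (qT G a x y + qT G a x z + pT G a y + pT G a z) ≤ N^2 * κ := by
    have : 0 ≤ N * (∑ v, qT G a x v + ∑ v, qT G a y v + ∑ v, qT G a z v) :=
      mul_nonneg hN'.le (by linarith)
    linarith
  have hB := le_of_mul_le_mul_left hB (pow_pos hN' 2)
  have hxy : G.Adj x y := (ht 0 1).2 (by decide)
  have hxz : G.Adj x z := (ht 0 2).2 (by decide)
  have hy : Out G a y := by
    rcases trich ha y with h | ⟨i, hi⟩ | h
    · exact h
    · have := qT_out ha hx hi hxy; exfalso; linarith
    · exfalso; linarith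
  have hz : Out G a z := by
    rcases trich ha z with h | ⟨i, hi⟩ | h
    · exact h
    · have := qT_out ha hx hi hxz; exfalso; linarith
    · exfalso; linarith
  have main : ∀ w, Out G a w → (∀ v, InS G ![x, y, z] l v → G.Adj w v) →
      ∑ v, sI G a k v * sI G ![x, y, z] l v ≤ ∑ v, qT G a w v := by
    intro w hw hl
    refine sum_le_sum fun v _ => ?_
    by_cases h1 : InS G a k v
    · by_cases h2 : InS G ![x, y, z] l v
      · have := qT_out ha hw h1 (hl v h2)
        simp [sI, h1, h2, this]
      · simp [sI, h2, qT_nonneg]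
    · simp [sI, h1, qT_nonneg]
  by_cases hl : l = 0
  · subst hl
    have := main y hy fun v hv => ((hv 1).2 (by decide)).symm
    linarith
  · have := main x hx fun v hv => ((hv 0).2 (Ne.symm hl)).symm
    linarith

theorem out_card {a : Fin 3 → V} (hreg : Reg G) (ha : GoodT G (1/10^20) a) :
    ∑ v, (1 - (if Out G a v then (1:ℝ) else 0)) ≤ 34/100 * (Fintype.card V : ℝ) := by
  set N : ℝ := ((Fintype.card V : ℕ) : ℝ) with hNdef
  have hN0 : 0 ≤ N := Nat.cast_nonneg _
  have h1 : ∑ v, (1 - (if Out G a v then (1:ℝ) else 0)) ≤ ∑ v, (∑ k, sI G a k v + pT G a v) :=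
    sum_le_sum fun v _ => by linarith [cover_pt ha.tri v]
  rw [sum_add_distrib, sum_comm, Fin.sum_univ_three] at h1
  have := abs_le.1 (size_part hreg ha 0)
  have := abs_le.1 (size_part hreg ha 1)
  have := abs_le.1 (size_part hreg ha 2)
  have := ha.p
  rw [← hNdef] at *
  norm_num at *
  linarith

theorem exists_ref (hreg : Reg G) (hN : 0 < Fintype.card V) :
    ∃ a : Fin 3 → Fin 3 → V, (∀ j, GoodT G (1/10^20) (a j)) ∧
      ∀ j j', j ≠ j' → ∀ k l, ∑ v, sI G (a j) k v * sI G (a j') l v ≤ 1/10^20 * (Fintype.card V : ℝ) := by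
  have hN' : (0:ℝ) < Fintype.card V := by exact_mod_cast hN
  obtain ⟨x1, -, y1, z1, t1, c1⟩ := pick hreg hN univ (by rw [card_univ]; linarith)
    (cost0 G) cost0_nonneg _ (by positivity) (cost0_sum hreg)
  have g1 : GoodT G (1/10^32) ![x1, y1, z1] := (goodT_of_cost hN t1 c1).mono (by norm_num)
  have g1' : GoodT G (1/10^20) ![x1, y1, z1] := g1.mono (by norm_num)
  have o1 := out_card hreg g1'
  have s1 := crossC_sum g1
  set a1 := ![x1, y1, z1] with ha1
  obtain ⟨x2, hx2, y2, z2, t2, c2⟩ := pick hreg hN (univ.filter fun v => Out G a1 v)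
    (by
      rw [← Finset.sum_boole (R := ℝ)]
      rw [sum_sub_distrib] at o1
      simp only [sum_const, card_univ, nsmul_eq_mul, mul_one] at o1
      linarith)
    (fun x y z => cost0 G x y z + crossC G a1 x y z)
    (fun x y z => add_nonneg (cost0_nonneg x y z) (crossC_nonneg _ x y z))
    (1/10^30) (by positivity)
    (by
      simp only [sum_add_distrib]
      have h0 := cost0_sum hreg
      have hp : 0 < (Fintype.card V : ℝ)^5 := by positivity
      norm_num at *
      linarith)
  have hx2 : Out G a1 x2 := (mem_filter.1 hx2).2
  have n2 := cost0_nonneg (G := G) x2 y2 z2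
  have n2' := crossC_nonneg (G := G) a1 x2 y2 z2
  have g2 : GoodT G (1/10^27) ![x2, y2, z2] := (goodT_of_cost (κ := 1000 * (1/10^30)) hN t2 (by linarith)).mono (by norm_num)
  have g2' : GoodT G (1/10^20) ![x2, y2, z2] := g2.mono (by norm_num)
  have k12 := cross_ok (κ := 1000 * (1/10^30)) hN (by norm_num) g1.tri t2 hx2 (by linarith)
  have o2 := out_card hreg g2'
  have s2 := crossC_sum g2
  set a2 := ![x2, y2, z2] with ha2
  obtain ⟨x3, hx3, y3, z3, t3, c3⟩ := pick hreg hN (univ.filter fun v => Out G a1 v ∧ Out G a2 v)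
    (by
      rw [← Finset.sum_boole (R := ℝ)]
      have : ∑ v : V, ((1:ℝ) - (if Out G a1 v ∧ Out G a2 v then (1:ℝ) else 0)) ≤
        ∑ v, (1 - (if Out G a1 v then (1:ℝ) else 0)) + ∑ v, (1 - (if Out G a2 v then (1:ℝ) else 0)) := by
        rw [← sum_add_distrib]
        refine sum_le_sum fun v _ => ?_
        by_cases h1 : Out G a1 v <;> by_cases h2 : Out G a2 v <;> simp [h1, h2]
      rw [sum_sub_distrib] at this
      simp only [sum_const, card_univ, nsmul_eq_mul, mul_one] at this
      linarith)
    (fun x y z => cost0 G x y z + (crossC G a1 x y z + crossC G a2 x y z))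
    (fun x y z => add_nonneg (cost0_nonneg x y z) (add_nonneg (crossC_nonneg _ x y z) (crossC_nonneg _ x y z)))
    (1/10^25) (by positivity)
    (by
      simp only [sum_add_distrib]
      have h0 := cost0_sum hreg
      have hp : 0 < (Fintype.card V : ℝ)^5 := by positivity
      norm_num at *
      linarith)
  have hx3' : Out G a1 x3 := (mem_filter.1 hx3).2.1
  have hx3'' : Out G a2 x3 := (mem_filter.1 hx3).2.2
  have n3 := cost0_nonneg (G := G) x3 y3 z3
  have n3' := crossC_nonneg (G := G) a1 x3 y3 z3
  have n3'' := crossC_nonneg (G := G) a2 x3 y3 z3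
  have g3 : GoodT G (1/10^20) ![x3, y3, z3] := (goodT_of_cost (κ := 1000 * (1/10^25)) hN t3 (by linarith)).mono (by norm_num)
  have k13 := cross_ok (κ := 1000 * (1/10^25)) hN (by norm_num) g1.tri t3 hx3' (by linarith)
  have k23 := cross_ok (κ := 1000 * (1/10^25)) hN (by norm_num) g2.tri t3 hx3'' (by linarith)
  have m1 : 1000 * (1/10^30) * (Fintype.card V : ℝ) ≤ 1/10^20 * (Fintype.card V : ℝ) :=
    mul_le_mul_of_nonneg_right (by norm_num) hN'.le
  have m2 : 1000 * (1/10^25) * (Fintype.card V : ℝ) ≤ 1/10^20 * (Fintype.card V : ℝ) :=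
    mul_le_mul_of_nonneg_right (by norm_num) hN'.le
  refine ⟨![a1, a2, ![x3, y3, z3]], ?_, ?_⟩
  · intro j; fin_cases j
    exacts [g1', g2', g3]
  · intro j j' hj k l
    fin_cases j <;> fin_cases j' <;> simp only [Fin.zero_eta, Fin.mk_one, Fin.reduceFinMk,
      Matrix.cons_val_zero, Matrix.cons_val_one, Matrix.cons_val] at hj ⊢
    · exact absurd rfl hj
    · exact (k12 k l).trans m1
    · exact (k13 k l).trans m2
    · simp only [mul_comm (sI G a2 k _)]; exact (k12 l k).trans m1
    · exact absurd rfl hj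
    · exact (k23 k l).trans m2
    · simp only [mul_comm (sI G ![x3, y3, z3] k _)]; exact (k13 l k).trans m2
    · simp only [mul_comm (sI G ![x3, y3, z3] k _)]; exact (k23 l k).trans m2
    · exact absurd rfl hj
end struct2
end EI

namespace EI
set_option linter.unusedSectionVars false
set_option linter.unusedVariables false
section struct3
variable {V : Type*} [Fintype V] {G : SimpleGraph V}

theorem jbR (G : SimpleGraph V) (x y : V) : (jb G x y : ℝ) = 0 ∨ (jb G x y : ℝ) = 1 := by
  rcases jb_01 G x y with h | h <;> simp [h]

theorem par_pt {a : Fin 3 → V} (ha : Tri G a) (v p q r : V) :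
    sI G a 0 p * sI G a 1 q * sI G a 2 r -
      (sI G a 0 p * (1 - 2 * jb G v p)) * (sI G a 1 q * (1 - 2 * jb G v q)) *
        (sI G a 2 r * (1 - 2 * jb G v r)) ≤
      2 * (B4 G v p q r + (qT G a p q + qT G a p r + qT G a q r)) := by
  have n0 := B4_nonneg G v p q r
  have n1 := qT_nonneg (G := G) a p q
  have n2 := qT_nonneg (G := G) a p r
  have n3 := qT_nonneg (G := G) a q r
  by_cases h0 : InS G a 0 p
  swap
  · simp only [sI, h0, if_false, zero_mul, sub_zero]; linarith
  by_cases h1 : InS G a 1 q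
  swap
  · simp only [sI, h1, if_false, zero_mul, mul_zero, sub_zero]; linarith
  by_cases h2 : InS G a 2 r
  swap
  · simp only [sI, h2, if_false, zero_mul, mul_zero, sub_zero]; linarith
  simp only [sI, h0, h1, h2, if_true, one_mul]
  have key : (1:ℝ) - (1 - 2 * jb G v p) * (1 - 2 * jb G v q) * (1 - 2 * jb G v r) ≤ 2 := by
    rcases jbR G v p with e1 | e1 <;> rcases jbR G v q with e2 | e2 <;>
      rcases jbR G v r with e3 | e3 <;> rw [e1, e2, e3] <;> norm_num
  by_cases a1 : G.Adj p q
  swap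
  · have := qT_miss ha (by decide) h0 h1 a1; linarith
  by_cases a2 : G.Adj p r
  swap
  · have := qT_miss ha (by decide) h0 h2 a2; linarith
  by_cases a3 : G.Adj q r
  swap
  · have := qT_miss ha (by decide) h1 h2 a3; linarith
  rcases jb_01 G v p with e1 | e1 <;> rcases jb_01 G v q with e2 | e2 <;>
      rcases jb_01 G v r with e3 | e3
  · rw [e1, e2, e3]; push_cast; norm_num; linarith
  · have := B4_eq _ _ _ _ _ _ e1 e2 (jb1 a1) e3 (jb1 a2) (jb1 a3) (by decide); linarith
  · have := B4_eq _ _ _ _ _ _ e1 e2 (jb1 a1) e3 (jb1 a2) (jb1 a3) (by decide); linarith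
  · rw [e1, e2, e3]; push_cast; norm_num; linarith
  · have := B4_eq _ _ _ _ _ _ e1 e2 (jb1 a1) e3 (jb1 a2) (jb1 a3) (by decide); linarith
  · rw [e1, e2, e3]; push_cast; norm_num; linarith
  · rw [e1, e2, e3]; push_cast; norm_num; linarith
  · have := B4_eq _ _ _ _ _ _ e1 e2 (jb1 a1) e3 (jb1 a2) (jb1 a3) (by decide); linarith

theorem sum3_mul (f g h : V → ℝ) :
    ∑ p, ∑ q, ∑ r, f p * g q * h r = (∑ p, f p) * (∑ q, g q) * (∑ r, h r) := by
  rw [sum_mul_sum, sum_mul]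
  refine sum_congr rfl fun p _ => ?_
  rw [sum_mul]
  refine sum_congr rfl fun q _ => ?_
  rw [mul_sum]

noncomputable def sS (G : SimpleGraph V) (a : Fin 3 → V) (i : Fin 3) : ℝ := ∑ p, sI G a i p
noncomputable def dS (G : SimpleGraph V) (a : Fin 3 → V) (v : V) (i : Fin 3) : ℝ :=
  ∑ p, sI G a i p * jb G v p

theorem parity (hreg : Reg G) {a : Fin 3 → V} (ha : GoodT G (1/10^20) a) (v : V) :
    sS G a 0 * sS G a 1 * sS G a 2 -
      (sS G a 0 - 2 * dS G a v 0) * (sS G a 1 - 2 * dS G a v 1) * (sS G a 2 - 2 * dS G a v 2) ≤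
      1/10^19 * (Fintype.card V : ℝ)^3 := by
  set N : ℝ := ((Fintype.card V : ℕ) : ℝ) with hNdef
  have hN0 : 0 ≤ N := Nat.cast_nonneg _
  have e : ∀ i, sS G a i - 2 * dS G a v i = ∑ p, sI G a i p * (1 - 2 * jb G v p) := by
    intro i
    unfold sS dS
    rw [mul_sum, ← sum_sub_distrib]
    exact sum_congr rfl fun p _ => by ring
  rw [e, e, e]
  unfold sS
  rw [← sum3_mul, ← sum3_mul, ← sum_sub_distrib]
  simp only [← sum_sub_distrib]
  refine (sum_le_sum fun p _ => sum_le_sum fun q _ => sum_le_sum fun r _ =>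
    par_pt ha.tri v p q r).trans ?_
  simp only [← mul_sum, sum_add_distrib]
  have h1 := hreg.bad v
  have h2 := ha.q
  rw [← hNdef] at h1 h2
  have e1 : ∑ p : V, ∑ q : V, ∑ r : V, qT G a p q = N * ∑ w, ∑ v, qT G a w v := by
    simp only [sum_const, card_univ, nsmul_eq_mul, ← mul_sum]; rfl
  have e2 : ∑ p : V, ∑ q : V, ∑ r : V, qT G a p r = N * ∑ w, ∑ v, qT G a w v := by
    simp only [sum_const, card_univ, nsmul_eq_mul, ← mul_sum]; rfl
  have e3 : ∑ p : V, ∑ q : V, ∑ r : V, qT G a q r = N * ∑ w, ∑ v, qT G a w v := by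
    simp only [sum_const, card_univ, nsmul_eq_mul, ← mul_sum]; rfl
  rw [e1, e2, e3]
  have h3 := mul_le_mul_of_nonneg_left h2 hN0
  have h4 : N * (1/10^20 * N^2) = 1/10^20 * N^3 := by ring
  rw [h4] at h3
  have h5 : 0 ≤ N^3 := pow_nonneg hN0 3
  norm_num at *
  linarith

theorem large_of_prod {N y0 y1 y2 s0 s1 s2 : ℝ} (hN : 0 < N) (h0 : |y0| ≤ s0) (h1 : |y1| ≤ s1)
    (h2 : |y2| ≤ s2) (hs1 : N/10 ≤ s1) (hs2 : N/10 ≤ s2)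
    (h : s0 * s1 * s2 - y0 * y1 * y2 ≤ 1/10^19 * N^3) : s0 - 1/10^17 * N ≤ |y0| := by
  by_contra hc
  push Not at hc
  have e1 : y0 * y1 * y2 ≤ |y0| * (s1 * s2) := by
    refine (le_abs_self _).trans ?_
    rw [abs_mul, abs_mul, mul_assoc]
    refine mul_le_mul_of_nonneg_left ?_ (abs_nonneg _)
    exact mul_le_mul h1 h2 (abs_nonneg _) ((abs_nonneg _).trans h1)
  have hp : N^2/100 ≤ s1 * s2 := by nlinarith
  have e2 : (s0 - |y0|) * (s1 * s2) ≤ 1/10^19 * N^3 := by nlinarith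
  have e3 : (s0 - |y0|) * (N^2/100) ≤ (s0 - |y0|) * (s1 * s2) :=
    mul_le_mul_of_nonneg_left hp (by linarith)
  have e4 : (1/10^17 * N) * (N^2/100) < (s0 - |y0|) * (N^2/100) :=
    mul_lt_mul_of_pos_right (by linarith) (by positivity)
  have e5 : (1/10^17 * N) * (N^2/100) = 1/10^19 * N^3 := by ring
  linarith

theorem abs_cases' {y s d t : ℝ} (hy : y = s - 2 * d) (h : s - t ≤ |y|) (ht : t < s) (ht0 : 0 ≤ t) :
    (d ≤ t ∧ 0 < y) ∨ (s - t ≤ d ∧ y < 0) := by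
  rcases abs_cases y with ⟨e, h'⟩ | ⟨e, h'⟩
  · left; constructor <;> linarith
  · right; constructor <;> linarith

theorem trichot {N : ℝ} (hN : 0 < N) (s d : Fin 3 → ℝ) (hs : ∀ i, N/10 ≤ s i)
    (hd0 : ∀ i, 0 ≤ d i) (hd1 : ∀ i, d i ≤ s i)
    (h : s 0 * s 1 * s 2 - (s 0 - 2 * d 0) * (s 1 - 2 * d 1) * (s 2 - 2 * d 2) ≤ 1/10^19 * N^3) :
    (∀ i, d i ≤ 1/10^17 * N) ∨
      ∃ i, d i ≤ 1/10^17 * N ∧ ∀ k, k ≠ i → s k - 1/10^17 * N ≤ d k := by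
  have hy : ∀ i, |s i - 2 * d i| ≤ s i := fun i => by
    rw [abs_le]; constructor <;> linarith [hd0 i, hd1 i]
  have l0 := large_of_prod hN (hy 0) (hy 1) (hy 2) (hs 1) (hs 2) h
  have l1 := large_of_prod hN (hy 1) (hy 0) (hy 2) (hs 0) (hs 2) (by linarith)
  have l2 := large_of_prod hN (hy 2) (hy 0) (hy 1) (hs 0) (hs 1) (by linarith)
  have ht : ∀ i, 1/10^17 * N < s i := fun i => by have := hs i; norm_num; linarith
  have ht0 : 0 ≤ 1/10^17 * N := by positivity
  have hpos : 0 < (s 0 - 2 * d 0) * (s 1 - 2 * d 1) * (s 2 - 2 * d 2) := by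
    have a1 : N/10 * (N/10) ≤ s 0 * s 1 := mul_le_mul (hs 0) (hs 1) (by positivity) (by linarith [hs 0])
    have a2 : N/10 * (N/10) * (N/10) ≤ s 0 * s 1 * s 2 :=
      mul_le_mul a1 (hs 2) (by positivity) ((by positivity : (0:ℝ) ≤ N/10 * (N/10)).trans a1)
    have a3 : N/10 * (N/10) * (N/10) = N^3/1000 := by ring
    have a4 : 0 < N^3 := by positivity
    norm_num at *
    linarith
  rcases abs_cases' rfl l0 (ht 0) ht0 with ⟨a0, b0⟩ | ⟨a0, b0⟩ <;>
  rcases abs_cases' rfl l1 (ht 1) ht0 with ⟨a1, b1⟩ | ⟨a1, b1⟩ <;>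
  rcases abs_cases' rfl l2 (ht 2) ht0 with ⟨a2, b2⟩ | ⟨a2, b2⟩
  · left; intro i; fin_cases i <;> assumption
  · exfalso; have := mul_neg_of_pos_of_neg (mul_pos b0 b1) b2; linarith
  · exfalso; have := mul_neg_of_neg_of_pos (mul_neg_of_pos_of_neg b0 b1) b2; linarith
  · right; refine ⟨0, a0, fun k hk => ?_⟩; fin_cases k <;> first | assumption | exact absurd rfl hk
  · exfalso; have := mul_neg_of_neg_of_pos (mul_neg_of_neg_of_pos b0 b1) b2; linarith
  · right; refine ⟨1, a1, fun k hk => ?_⟩; fin_cases k <;> first | assumption | exact absurd rfl hk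
  · right; refine ⟨2, a2, fun k hk => ?_⟩; fin_cases k <;> first | assumption | exact absurd rfl hk
  · exfalso; have := mul_neg_of_pos_of_neg (mul_pos_of_neg_of_neg b0 b1) b2; linarith

theorem class_aux {N D : ℝ} (hN : 0 < N) (s d : Fin 3 → Fin 3 → ℝ)
    (hs : ∀ j i, |s j i - N/9| ≤ 1/10^15 * N) (hd0 : ∀ j i, 0 ≤ d j i)
    (hc : ∀ j, (∀ i, d j i ≤ 1/10^17 * N) ∨
      ∃ i, d j i ≤ 1/10^17 * N ∧ ∀ k, k ≠ i → s j k - 1/10^17 * N ≤ d j k)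
    (hD1 : |9 * D - 2 * N| ≤ 1/10^16 * N) (hD2 : |∑ j, ∑ i, d j i - D| ≤ 1/10^13 * N) :
    ∃ j i, d j i ≤ 1/10^17 * N ∧ (∀ k, k ≠ i → s j k - 1/10^17 * N ≤ d j k) ∧
      ∀ j', j' ≠ j → ∀ k, d j' k ≤ 1/10^17 * N := by
  have hbig : ∀ j, (∃ i, d j i ≤ 1/10^17 * N ∧ ∀ k, k ≠ i → s j k - 1/10^17 * N ≤ d j k) →
      2 / 10 * N ≤ ∑ i, d j i := by
    rintro j ⟨i, -, h⟩
    have b : ∀ k, k ≠ i → N/10 ≤ d j k := fun k hk => by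
      have := h k hk
      have := (abs_le.1 (hs j k)).1
      norm_num at *
      linarith
    have d0 := hd0 j 0
    have d1 := hd0 j 1
    have d2 := hd0 j 2
    rw [Fin.sum_univ_three]
    fin_cases i
    · have := b 1 (by decide); have := b 2 (by decide); linarith
    · have := b 0 (by decide); have := b 2 (by decide); linarith
    · have := b 0 (by decide); have := b 1 (by decide); linarith
  have hnn : ∀ j, 0 ≤ ∑ i, d j i := fun j => sum_nonneg fun i _ => hd0 j i
  have hsm : ∀ j, (∀ i, d j i ≤ 1/10^17 * N) → ∑ i, d j i ≤ 1/100 * N := by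
    intro j h
    have := h 0; have := h 1; have := h 2
    rw [Fin.sum_univ_three]
    norm_num at *
    linarith
  obtain ⟨D1, D1'⟩ := abs_le.1 hD1
  obtain ⟨D2, D2'⟩ := abs_le.1 hD2
  by_cases hall : ∀ j i, d j i ≤ 1/10^17 * N
  · exfalso
    have := hsm 0 (hall 0); have := hsm 1 (hall 1); have := hsm 2 (hall 2)
    rw [Fin.sum_univ_three (f := fun j => ∑ i, d j i)] at D2
    norm_num at *
    linarith
  · push Not at hall
    obtain ⟨j, i', hj⟩ := hall
    have hj' : ∃ i, d j i ≤ 1/10^17 * N ∧ ∀ k, k ≠ i → s j k - 1/10^17 * N ≤ d j k := by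
      rcases hc j with h | h
      · exact absurd (h i') (not_le.2 hj)
      · exact h
    have bj := hbig j hj'
    obtain ⟨i, hi1, hi2⟩ := hj'
    refine ⟨j, i, hi1, hi2, fun j' hjj => ?_⟩
    rcases hc j' with h | h
    · exact h
    · exfalso
      have bj' := hbig j' h
      have h2 : ∑ i, d j i + ∑ i, d j' i ≤ ∑ j, ∑ i, d j i := by
        rw [← Finset.sum_pair (f := fun j => ∑ i, d j i) (Ne.symm hjj)]
        exact sum_le_univ_sum_of_nonneg hnn
      norm_num at *
      linarith
end struct3
end EI

namespace EI
set_option linter.unusedSectionVars false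
set_option linter.unusedVariables false
section struct4
variable {V : Type*} [Fintype V] {G : SimpleGraph V}

theorem sI_sum01 (a : Fin 3 → V) (v : V) : ∑ k, sI G a k v = 0 ∨ ∑ k, sI G a k v = 1 := by
  by_cases h : ∃ k, InS G a k v
  · obtain ⟨k, hk⟩ := h
    right; simp [sI_of_InS hk]
  · push Not at h
    have : ∀ k, sI G a k v = 0 := fun k => by unfold sI; rw [if_neg (h k)]
    left; simp [this]

theorem mult_pt (M : Fin 3 → ℝ) (h : ∀ j, M j = 0 ∨ M j = 1) :
    |∑ j, M j - 1| ≤ 2 * (M 0 * M 1 + M 0 * M 2 + M 1 * M 2) - (∑ j, M j - 1) := by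
  rw [Fin.sum_univ_three]
  rcases h 0 with a | a <;> rcases h 1 with b | b <;> rcases h 2 with c | c <;>
    rw [a, b, c] <;> norm_num

variable (G) in
structure Ref (a : Fin 3 → Fin 3 → V) : Prop where
  good : ∀ j, GoodT G (1/10^20) (a j)
  cross : ∀ j j', j ≠ j' → ∀ k l,
    ∑ v, sI G (a j) k v * sI G (a j') l v ≤ 1/10^20 * (Fintype.card V : ℝ)

theorem ov_sum {a : Fin 3 → Fin 3 → V} (ha : Ref G a) {j j' : Fin 3} (h : j ≠ j') :
    ∑ u, (∑ i, sI G (a j) i u) * (∑ i, sI G (a j') i u) ≤ 9/10^20 * (Fintype.card V : ℝ) := by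
  have e : ∑ u, (∑ i, sI G (a j) i u) * (∑ i, sI G (a j') i u) =
      ∑ k, ∑ l, ∑ u, sI G (a j) k u * sI G (a j') l u := by
    simp only [sum_mul_sum]
    rw [sum_comm]
    exact sum_congr rfl fun k _ => by rw [sum_comm]
  rw [e]
  refine (sum_le_sum fun k _ => sum_le_sum fun l _ => ha.cross j j' h k l).trans_eq ?_
  simp only [sum_const, card_univ, Fintype.card_fin, nsmul_eq_mul]
  push_cast; ring

theorem mult_sum (hreg : Reg G) {a : Fin 3 → Fin 3 → V} (ha : Ref G a) :
    ∑ u, |∑ j, ∑ i, sI G (a j) i u - 1| ≤ 1/10^13 * (Fintype.card V : ℝ) := by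
  set N : ℝ := ((Fintype.card V : ℕ) : ℝ) with hNdef
  have hN0 : 0 ≤ N := Nat.cast_nonneg _
  refine (sum_le_sum fun u _ => mult_pt (fun j => ∑ i, sI G (a j) i u)
    (fun j => sI_sum01 _ _)).trans ?_
  rw [sum_sub_distrib, ← mul_sum, sum_add_distrib, sum_add_distrib, sum_sub_distrib]
  have o1 := ov_sum ha (by decide : (0 : Fin 3) ≠ 1)
  have o2 := ov_sum ha (by decide : (0 : Fin 3) ≠ 2)
  have o3 := ov_sum ha (by decide : (1 : Fin 3) ≠ 2)
  have hs : ∀ j i, N/9 - 1/10^15 * N ≤ ∑ u, sI G (a j) i u := fun j i => by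
    have := (abs_le.1 (size_part hreg (ha.good j) i)).1
    rw [← hNdef] at this
    linarith
  have hs2 : N - 9/10^15 * N ≤ ∑ u, ∑ j, ∑ i, sI G (a j) i u := by
    rw [sum_comm]
    have hthis : ∀ j : Fin 3, N/3 - 3/10^15 * N ≤ ∑ u, ∑ i, sI G (a j) i u := by
      intro j
      rw [sum_comm, Fin.sum_univ_three]
      have := hs j 0; have := hs j 1; have := hs j 2
      linarith
    rw [Fin.sum_univ_three]
    have := hthis 0; have := hthis 1; have := hthis 2
    linarith
  have e1 : ∑ u : V, (1:ℝ) = N := by simp [hNdef]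
  rw [e1]
  rw [← hNdef] at o1 o2 o3
  norm_num at *
  linarith

theorem class_v (hreg : Reg G) (hN : 0 < Fintype.card V) {a : Fin 3 → Fin 3 → V} (ha : Ref G a)
    (v : V) : ∃ j i, dS G (a j) v i ≤ 1/10^17 * (Fintype.card V : ℝ) ∧
      (∀ k, k ≠ i → sS G (a j) k - 1/10^17 * (Fintype.card V : ℝ) ≤ dS G (a j) v k) ∧
      ∀ j', j' ≠ j → ∀ k, dS G (a j') v k ≤ 1/10^17 * (Fintype.card V : ℝ) := by
  have hN' : (0:ℝ) < Fintype.card V := by exact_mod_cast hN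
  have hs : ∀ j i, |sS G (a j) i - (Fintype.card V : ℝ)/9| ≤ 1/10^15 * (Fintype.card V : ℝ) :=
    fun j i => size_part hreg (ha.good j) i
  have hd0 : ∀ j i, 0 ≤ dS G (a j) v i := fun j i =>
    sum_nonneg fun p _ => mul_nonneg (sI_nonneg _ _ _) (Nat.cast_nonneg _)
  have hd1 : ∀ j i, dS G (a j) v i ≤ sS G (a j) i := fun j i =>
    sum_le_sum fun p _ => by
      have := sI_nonneg (G := G) (a j) i p
      rcases jbR G v p with h | h <;> rw [h] <;> linarith
  have hs' : ∀ j i, (Fintype.card V : ℝ)/10 ≤ sS G (a j) i := fun j i => by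
    have := (abs_le.1 (hs j i)).1
    norm_num at *
    linarith
  refine class_aux hN' (fun j i => sS G (a j) i) (fun j i => dS G (a j) v i) hs hd0 ?_
    (hreg.deg v) ?_
  · intro j
    exact trichot hN' _ _ (hs' j) (hd0 j) (hd1 j) (parity hreg (ha.good j) v)
  · have e : ∑ j, ∑ i, dS G (a j) v i - ∑ u, (jb G v u : ℝ) =
        ∑ u, (∑ j, ∑ i, sI G (a j) i u - 1) * jb G v u := by
      simp only [sub_mul, one_mul, sum_sub_distrib]
      congr 1
      unfold dS
      simp only [sum_mul]
      rw [sum_comm (s := (univ : Finset V))]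
      refine sum_congr rfl fun j _ => ?_
      rw [sum_comm]
    rw [e]
    refine (abs_sum_le_sum_abs _ _).trans (le_trans (sum_le_sum fun u _ => ?_) (mult_sum hreg ha))
    rw [abs_mul]
    have := abs_nonneg (∑ j, ∑ i, sI G (a j) i u - 1)
    rcases jbR G v u with h | h <;> rw [h] <;> simp

def pat (α β : Fin 3 × Fin 3) : Prop := α.1 = β.1 ∧ α.2 ≠ β.2
noncomputable def pj (α β : Fin 3 × Fin 3) : ℝ := if pat α β then 1 else 0

theorem exc_pt {a : Fin 3 → V} (ha : Tri G a) {i k : Fin 3} (hik : k ≠ i) {u : V} (hu : InS G a i u) :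
    sS G a k - ∑ w, qT G a u w ≤ dS G a u k := by
  unfold sS dS
  rw [← sum_sub_distrib]
  refine sum_le_sum fun w _ => ?_
  have h0 := qT_nonneg (G := G) a u w
  by_cases hw : InS G a k w
  · by_cases h : G.Adj u w
    · simp [sI, hw, jb1 h, h0]
    · have := qT_miss ha hik hu hw h
      simp [sI, hw, jb0 h]; linarith
  · simp [sI, hw, h0]

variable (G) in
structure Cls (c : V → Fin 3 × Fin 3) (ε : ℝ) : Prop where
  size : ∀ β, |∑ u, (if c u = β then (1:ℝ) else 0) - (Fintype.card V : ℝ)/9| ≤ ε * (Fintype.card V : ℝ)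
  wrong : ∀ v, ∑ u, |(jb G v u : ℝ) - pj (c v) (c u)| ≤ ε * (Fintype.card V : ℝ)

theorem abs_jp (G : SimpleGraph V) (v u : V) (α β : Fin 3 × Fin 3) : |(jb G v u : ℝ) - pj α β| ≤ 1 := by
  unfold pj
  rcases jbR G v u with h | h <;> rw [h] <;> split_ifs <;> norm_num

theorem exists_cls (hreg : Reg G) (hN : 0 < Fintype.card V) :
    ∃ c : V → Fin 3 × Fin 3, Cls G c (1/10^12) := by
  have hN' : (0:ℝ) < Fintype.card V := by exact_mod_cast hN
  obtain ⟨a, ha1, ha2⟩ := exists_ref hreg hN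
  have ha : Ref G a := ⟨ha1, ha2⟩
  have hcl := class_v hreg hN ha
  set N : ℝ := ((Fintype.card V : ℕ) : ℝ) with hNdef
  choose cj ci h1 h2 h3 using hcl
  set c : V → Fin 3 × Fin 3 := fun v => (cj v, ci v) with hc
  have hs : ∀ j i, |sS G (a j) i - N/9| ≤ 1/10^15 * N :=
    fun j i => size_part hreg (ha.good j) i
  have hs' : ∀ j i, N/10 ≤ sS G (a j) i := fun j i => by
    have := (abs_le.1 (hs j i)).1
    norm_num at *
    linarith
  -- exceptional vertices
  have hexc : ∀ u j i, InS G (a j) i u → c u ≠ (j, i) → N/100 ≤ ∑ w, qT G (a j) u w := by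
    intro u j i hu hne
    by_contra hlt
    push Not at hlt
    apply hne
    have hk : ∀ k, k ≠ i → N/100 < dS G (a j) u k := fun k hk => by
      have := exc_pt (ha.good j).tri hk hu
      have := hs' j k
      linarith
    have hsm : 1/10^17 * N < N/100 := by norm_num; linarith
    have hj : cj u = j := by
      by_contra hj
      have : ∃ k : Fin 3, k ≠ i := by fin_cases i; exacts [⟨1, by decide⟩, ⟨0, by decide⟩, ⟨0, by decide⟩]
      obtain ⟨k, hki⟩ := this
      have h4 := h3 u j (Ne.symm hj) k
      have := hk k hki
      linarith
    have hi : ci u = i := by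
      by_contra hi
      have h4 := hk (ci u) hi
      have h5 := h1 u
      rw [hj] at h5
      linarith
    simp only [hc, hj, hi]
  set ex : V → ℝ := fun u => ∑ j, 100 / N * ∑ w, qT G (a j) u w with hex
  have hexn : ∀ u j, 0 ≤ 100 / N * ∑ w, qT G (a j) u w := fun u j =>
    mul_nonneg (by positivity) (qs_nonneg _ _)
  have hex1 : ∀ u j i, InS G (a j) i u → c u ≠ (j, i) → 1 ≤ ex u := by
    intro u j i hu hne
    have h4 := hexc u j i hu hne
    have h5 : 1 ≤ 100 / N * ∑ w, qT G (a j) u w := by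
      have := mul_le_mul_of_nonneg_left h4 (by positivity : 0 ≤ 100 / N)
      have e : 100 / N * (N / 100) = 1 := by field_simp
      linarith
    refine h5.trans ?_
    exact single_le_sum (f := fun j => 100 / N * ∑ w, qT G (a j) u w) (fun j _ => hexn u j) (mem_univ j)
  have hex0 : ∀ u, 0 ≤ ex u := fun u => sum_nonneg fun j _ => hexn u j
  have hexs : ∑ u, ex u ≤ 1/10^17 * N := by
    simp only [hex]
    rw [sum_comm]
    have hthis : ∀ j : Fin 3, ∑ u, 100 / N * ∑ w, qT G (a j) u w ≤ 1/10^18 * N := by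
      intro j
      rw [← mul_sum]
      have h4 := mul_le_mul_of_nonneg_left (ha.good j).q (by positivity : 0 ≤ 100 / N)
      rw [← hNdef] at h4
      refine h4.trans_eq ?_
      field_simp
      norm_num
    rw [Fin.sum_univ_three]
    have := hthis 0; have := hthis 1; have := hthis 2
    norm_num at *
    linarith
  have hms := mult_sum hreg ha
  rw [← hNdef] at hms
  set bd : V → ℝ := fun u => |∑ j, ∑ i, sI G (a j) i u - 1| + ex u with hbd
  have hbd0 : ∀ u, 0 ≤ bd u := fun u => add_nonneg (abs_nonneg _) (hex0 u)
  have hbds : ∑ u, bd u ≤ 2/10^13 * N := by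
    simp only [hbd, sum_add_distrib]
    norm_num at *
    linarith
  have hbd1 : ∀ u, ¬ InS G (a (cj u)) (ci u) u → 1 ≤ bd u := by
    intro u hu
    by_cases hcov : ∃ j i, InS G (a j) i u
    · obtain ⟨j, i, hji⟩ := hcov
      have hne : c u ≠ (j, i) := by
        intro h
        simp only [hc, Prod.mk.injEq] at h
        rw [h.1, h.2] at hu
        exact hu hji
      have h4 := hex1 u j i hji hne
      simp only [hbd]
      linarith [abs_nonneg (∑ j, ∑ i, sI G (a j) i u - 1)]
    · push Not at hcov
      have : ∑ j, ∑ i, sI G (a j) i u = 0 := sum_eq_zero fun j _ => sum_eq_zero fun i _ => by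
        unfold sI; rw [if_neg (hcov j i)]
      simp only [hbd, this]
      norm_num
      exact hex0 u
  refine ⟨c, ?_, ?_⟩
  · rintro ⟨j, i⟩
    rw [← hNdef]
    have hd : |∑ u, (if c u = (j, i) then (1:ℝ) else 0) - sS G (a j) i| ≤ ∑ u, bd u := by
      unfold sS
      rw [← sum_sub_distrib]
      refine (abs_sum_le_sum_abs _ _).trans (sum_le_sum fun u _ => ?_)
      have hb := hbd0 u
      by_cases hu : InS G (a j) i u
      · by_cases hcu : c u = (j, i)
        · simp [sI, hu, hcu, hb]
        · have h4 := hex1 u j i hu hcu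
          have : 1 ≤ bd u := by
            simp only [hbd]
            linarith [abs_nonneg (∑ j, ∑ i, sI G (a j) i u - 1)]
          simpa [sI, hu, hcu] using this
      · by_cases hcu : c u = (j, i)
        · have : ¬ InS G (a (cj u)) (ci u) u := by
            simp only [hc, Prod.mk.injEq] at hcu
            rw [hcu.1, hcu.2]; exact hu
          have := hbd1 u this
          simpa [sI, hu, hcu] using this
        · simp [sI, hu, hcu, hb]
    have h5 := hs j i
    have h6 := hd.trans hbds
    rw [abs_le] at h5 h6 ⊢
    norm_num at h5 h6 ⊢
    constructor <;> linarith
  · intro v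
    rw [← hNdef]
    have hpt : ∀ u, |(jb G v u : ℝ) - pj (c v) (c u)| ≤
        bd u + ∑ j, ∑ i, sI G (a j) i u * |(jb G v u : ℝ) - pj (c v) (j, i)| := by
      intro u
      have hnn : ∀ j i, 0 ≤ sI G (a j) i u * |(jb G v u : ℝ) - pj (c v) (j, i)| := fun j i =>
        mul_nonneg (sI_nonneg _ _ _) (abs_nonneg _)
      by_cases hu : InS G (a (cj u)) (ci u) u
      · have e1 : sI G (a (cj u)) (ci u) u * |(jb G v u : ℝ) - pj (c v) (cj u, ci u)| ≤
            ∑ j, ∑ i, sI G (a j) i u * |(jb G v u : ℝ) - pj (c v) (j, i)| := by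
          refine le_trans ?_ (single_le_sum (f := fun j => ∑ i, sI G (a j) i u * |(jb G v u : ℝ) - pj (c v) (j, i)|)
            (fun j _ => sum_nonneg fun i _ => hnn j i) (mem_univ (cj u)))
          exact single_le_sum (f := fun i => sI G (a (cj u)) i u * |(jb G v u : ℝ) - pj (c v) (cj u, i)|)
            (fun i _ => hnn _ i) (mem_univ (ci u))
        have e2 : sI G (a (cj u)) (ci u) u = 1 := by unfold sI; rw [if_pos hu]
        rw [e2, one_mul] at e1
        have := hbd0 u
        have e3 : c u = (cj u, ci u) := rfl
        rw [e3]
        linarith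
      · have e1 := hbd1 u hu
        have e2 := abs_jp G v u (c v) (c u)
        have e3 : 0 ≤ ∑ j, ∑ i, sI G (a j) i u * |(jb G v u : ℝ) - pj (c v) (j, i)| :=
          sum_nonneg fun j _ => sum_nonneg fun i _ => hnn j i
        linarith
    refine (sum_le_sum fun u _ => hpt u).trans ?_
    rw [sum_add_distrib]
    have hji : ∀ j i, ∑ u, sI G (a j) i u * |(jb G v u : ℝ) - pj (c v) (j, i)| ≤ 1/10^17 * N := by
      intro j i
      by_cases hp : pat (c v) (j, i)
      · have e : ∑ u, sI G (a j) i u * |(jb G v u : ℝ) - pj (c v) (j, i)| = sS G (a j) i - dS G (a j) v i := by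
          unfold sS dS
          rw [← sum_sub_distrib]
          refine sum_congr rfl fun u _ => ?_
          unfold pj; rw [if_pos hp]
          rcases jbR G v u with h | h <;> rw [h] <;> norm_num
        rw [e]
        obtain ⟨q1, q2⟩ := hp
        simp only [hc] at q1 q2
        subst q1
        have := h2 v i (Ne.symm q2)
        linarith
      · have e : ∑ u, sI G (a j) i u * |(jb G v u : ℝ) - pj (c v) (j, i)| = dS G (a j) v i := by
          unfold dS
          refine sum_congr rfl fun u _ => ?_
          unfold pj; rw [if_neg hp]
          rcases jbR G v u with h | h <;> rw [h] <;> norm_num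
        rw [e]
        by_cases q1 : j = cj v
        · have q2 : i = ci v := by
            by_contra q2
            exact hp ⟨q1.symm, Ne.symm q2⟩
          rw [q1, q2]; exact h1 v
        · exact h3 v j q1 i
    rw [sum_comm]
    have h6 : ∀ j : Fin 3, ∑ u, ∑ i, sI G (a j) i u * |(jb G v u : ℝ) - pj (c v) (j, i)| ≤ 3/10^17 * N := by
      intro j
      rw [sum_comm, Fin.sum_univ_three]
      have := hji j 0; have := hji j 1; have := hji j 2
      linarith
    rw [Fin.sum_univ_three]
    have := h6 0; have := h6 1; have := h6 2
    norm_num at *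
    linarith
end struct4
end EI

namespace EI
set_option linter.unusedSectionVars false
set_option linter.unusedVariables false
section counting

theorem psum_root {V : Type*} [DecidableEq V] (A : Finset V) (x : V) (hx : x ∈ A) (k : ℕ) (D : Finset V → ℝ)
    (hD : ∀ S, x ∉ S → D S = 0) :
    ∑ S ∈ powersetCard (k+1) A, D S = ∑ R ∈ powersetCard k (A.erase x), D (insert x R) := by
  rw [← insert_erase hx, powersetCard_succ_insert (notMem_erase x A), sum_union, erase_insert (notMem_erase x A)]
  · rw [sum_eq_zero, zero_add]
    · rw [sum_image]
      intro S hS T hT h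
      have hS' : x ∉ S := fun h' => notMem_erase x A ((mem_powersetCard.1 hS).1 h')
      have hT' : x ∉ T := fun h' => notMem_erase x A ((mem_powersetCard.1 hT).1 h')
      rw [← erase_insert hS', ← erase_insert hT', h]
    · intro S hS
      exact hD S fun h' => notMem_erase x A ((mem_powersetCard.1 hS).1 h')
  · rw [disjoint_left]
    intro S hS hS'
    obtain ⟨T, hT, rfl⟩ := mem_image.1 hS'
    exact notMem_erase x A ((mem_powersetCard.1 hS).1 (mem_insert_self x T))

theorem psum_dbl {V : Type*} [DecidableEq V] (A : Finset V) (k : ℕ) (f : Finset V → ℝ) :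
    ((k:ℝ)+1) * ∑ S ∈ powersetCard (k+1) A, f S =
      ∑ x ∈ A, ∑ R ∈ powersetCard k (A.erase x), f (insert x R) := by
  have h1 : ∀ x ∈ A, ∑ R ∈ powersetCard k (A.erase x), f (insert x R) =
      ∑ S ∈ powersetCard (k+1) A, if x ∈ S then f S else 0 := by
    intro x hx
    rw [psum_root A x hx k (fun S => if x ∈ S then f S else 0) (fun S hS => by simp [hS])]
    exact sum_congr rfl fun R _ => by simp
  rw [sum_congr rfl h1, sum_comm, mul_sum]
  refine sum_congr rfl fun S hS => ?_
  obtain ⟨hS1, hS2⟩ := mem_powersetCard.1 hS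
  rw [← sum_filter, filter_mem_eq_inter, inter_eq_right.2 hS1, sum_const, hS2, nsmul_eq_mul]
  push_cast; ring

theorem psum3 {V : Type*} [DecidableEq V] (A : Finset V) (f : Finset V → ℝ) :
    6 * ∑ S ∈ powersetCard 3 A, f S =
      ∑ x ∈ A, ∑ y ∈ A.erase x, ∑ z ∈ (A.erase x).erase y, f {x, y, z} := by
  have h1 : ∀ (B : Finset V) (g : Finset V → ℝ), ∑ S ∈ powersetCard 1 B, g S = ∑ z ∈ B, g {z} := by
    intro B g
    have := psum_dbl B 0 g
    simpa using this
  have h2 : ∀ (B : Finset V) (g : Finset V → ℝ), 2 * ∑ S ∈ powersetCard 2 B, g S =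
      ∑ y ∈ B, ∑ z ∈ B.erase y, g {y, z} := by
    intro B g
    have := psum_dbl B 1 g
    simp only [h1] at this
    rw [← this]; norm_num
  have := psum_dbl A 2 f
  have e : 6 * ∑ S ∈ powersetCard 3 A, f S = 2 * (((2:ℕ):ℝ) + 1) * ∑ S ∈ powersetCard 3 A, f S := by
    norm_num
  rw [e, mul_assoc, this, mul_sum]
  exact sum_congr rfl fun x _ => h2 _ _

theorem psum4 {V : Type*} [DecidableEq V] (A : Finset V) (f : Finset V → ℝ) :
    24 * ∑ S ∈ powersetCard 4 A, f S =
      ∑ x ∈ A, ∑ y ∈ A.erase x, ∑ z ∈ (A.erase x).erase y, ∑ u ∈ ((A.erase x).erase y).erase z,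
        f {x, y, z, u} := by
  have := psum_dbl A 3 f
  have e : 24 * ∑ S ∈ powersetCard 4 A, f S = 6 * ((((3:ℕ):ℝ) + 1) * ∑ S ∈ powersetCard 4 A, f S) := by
    push_cast; ring
  rw [e, this, mul_sum]
  exact sum_congr rfl fun x _ => psum3 _ _

theorem psum5 {V : Type*} [DecidableEq V] (A : Finset V) (f : Finset V → ℝ) :
    120 * ∑ S ∈ powersetCard 5 A, f S =
      ∑ x ∈ A, ∑ y ∈ A.erase x, ∑ z ∈ (A.erase x).erase y, ∑ u ∈ ((A.erase x).erase y).erase z,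
        ∑ w ∈ (((A.erase x).erase y).erase z).erase u, f {x, y, z, u, w} := by
  have := psum_dbl A 4 f
  have e : 120 * ∑ S ∈ powersetCard 5 A, f S = 24 * ((((4:ℕ):ℝ) + 1) * ∑ S ∈ powersetCard 5 A, f S) := by
    push_cast; ring
  rw [e, this, mul_sum]
  exact sum_congr rfl fun x _ => psum4 _ _

/-- indicator of two edges -/
noncomputable def FS {n : ℕ} (G : SimpleGraph (Fin n)) (S : Finset (Fin n)) : ℝ :=
  if edgeCount G S = 2 then 1 else 0

theorem numKL_eq {n : ℕ} (G : SimpleGraph (Fin n)) :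
    (numKL 5 2 G : ℝ) = ∑ S ∈ powersetCard 5 univ, FS G S := by
  unfold numKL FS
  rw [← sum_boole]

theorem jb_self {V : Type*} [Fintype V] (G : SimpleGraph V) (x : V) : jb G x x = 0 := by simp [jb]

theorem ec_sum {n : ℕ} (G : SimpleGraph (Fin n)) (S : Finset (Fin n)) :
    2 * edgeCount G S = ∑ p ∈ S, ∑ q ∈ S, jb G p q := by
  have h1 : edgeCount G S = ∑ p ∈ S, ∑ q ∈ S, if p < q then jb G p q else 0 := by
    unfold edgeCount
    rw [card_filter, Fintype.sum_prod_type, ← sum_subset (subset_univ S)]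
    · refine sum_congr rfl fun p hp => ?_
      rw [← sum_subset (subset_univ S)]
      · refine sum_congr rfl fun q hq => ?_
        by_cases h : p < q <;> simp [hp, hq, h, jb]
      · intro q _ hq; simp [hq]
    · intro p _ hp; simp [hp]
  have h2 : edgeCount G S = ∑ p ∈ S, ∑ q ∈ S, if q < p then jb G p q else 0 := by
    rw [h1, sum_comm]
    refine sum_congr rfl fun p _ => sum_congr rfl fun q _ => ?_
    rw [jb_symm G q p]
  have : 2 * edgeCount G S = edgeCount G S + edgeCount G S := by ring
  rw [this]
  nth_rewrite 1 [h1]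
  rw [h2, ← sum_add_distrib]
  refine sum_congr rfl fun p _ => ?_
  rw [← sum_add_distrib]
  refine sum_congr rfl fun q _ => ?_
  rcases lt_trichotomy p q with h | h | h
  · simp [h, h.not_gt]
  · subst h; simp [jb_self]
  · simp [h, h.not_gt]

theorem FS_eq {n : ℕ} (G : SimpleGraph (Fin n)) (x y z u w : Fin n) (hxy : x ≠ y) (hxz : x ≠ z)
    (hxu : x ≠ u) (hxw : x ≠ w) (hyz : y ≠ z) (hyu : y ≠ u) (hyw : y ≠ w) (hzu : z ≠ u) (hzw : z ≠ w)
    (huw : u ≠ w) : FS G {x, y, z, u, w} = E5 G x y z u w := by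
  have h := ec_sum G {x, y, z, u, w}
  have hs : ∀ f : Fin n → ℕ, ∑ q ∈ ({x, y, z, u, w} : Finset (Fin n)), f q =
      f x + (f y + (f z + (f u + f w))) := by
    intro f
    rw [sum_insert (by simp [*]), sum_insert (by simp [*]), sum_insert (by simp [*]), sum_insert (by simp [*]), sum_singleton]
  simp only [hs, jb_self] at h
  rw [jb_symm G y x, jb_symm G z x, jb_symm G u x, jb_symm G w x, jb_symm G z y, jb_symm G u y,
    jb_symm G w y, jb_symm G u z, jb_symm G w z, jb_symm G w u] at h
  unfold FS E5 at5 e2N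
  have hm : ∀ p q, jb G p q % 2 = jb G p q := fun p q => by rcases jb_01 G p q with h | h <;> simp [h]
  simp only [hm]
  have : edgeCount G {x, y, z, u, w} = jb G x y + jb G x z + jb G y z + jb G x u + jb G y u + jb G z u +
      jb G x w + jb G y w + jb G z w + jb G u w := by omega
  rw [this]
  split_ifs <;> simp

theorem sum_ge_compl {V : Type*} [Fintype V] [DecidableEq V] (B : Finset V) (k : ℕ) (hB : Bᶜ.card ≤ k) (f g : V → ℝ) (M : ℝ)
    (hM : 0 ≤ M) (hfg : ∀ x ∈ B, g x ≤ f x) (hg : ∀ x, g x ≤ M) : ∑ x, g x - k * M ≤ ∑ x ∈ B, f x := by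
  rw [← sum_add_sum_compl B g]
  have h1 := sum_le_sum hfg
  have h2 : ∑ x ∈ Bᶜ, g x ≤ k * M := by
    refine (sum_le_card_nsmul _ _ M fun x _ => hg x).trans ?_
    rw [nsmul_eq_mul]
    exact mul_le_mul_of_nonneg_right (by exact_mod_cast hB) hM
  linarith

theorem sum_le_M {V : Type*} [Fintype V] (f : V → ℝ) (M : ℝ) (h : ∀ x, f x ≤ M) :
    ∑ x, f x ≤ (Fintype.card V : ℝ) * M := by
  refine (sum_le_card_nsmul _ _ M fun x _ => h x).trans_eq ?_
  rw [nsmul_eq_mul, card_univ]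

theorem compl_erase_card {V : Type*} [Fintype V] [DecidableEq V] (A : Finset V) (x : V) (k : ℕ) (h : Aᶜ.card ≤ k) :
    (A.erase x)ᶜ.card ≤ k + 1 := by
  rw [compl_erase]
  exact (card_insert_le _ _).trans (by omega)

/-- sum over injective triples outside a small set -/
theorem sum3_ge {V : Type*} [Fintype V] [DecidableEq V] (A : Finset V) (hA : Aᶜ.card ≤ 2) (f : V → V → V → ℝ)
    (hf : ∀ x y z, f x y z ≤ 1) :
    ∑ x, ∑ y, ∑ z, f x y z - 9 * (Fintype.card V : ℝ)^2 ≤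
      ∑ x ∈ A, ∑ y ∈ A.erase x, ∑ z ∈ (A.erase x).erase y, f x y z := by
  set N : ℝ := ((Fintype.card V : ℕ) : ℝ) with hNdef
  have hN0 : 0 ≤ N := Nat.cast_nonneg _
  have s1 : ∀ x y, ∑ z, f x y z ≤ N := fun x y => by
    have := sum_le_M (f x y) 1 (hf x y); rwa [mul_one] at this
  have s2 : ∀ x, ∑ y, ∑ z, f x y z ≤ N * N := fun x => sum_le_M _ N (s1 x)
  have t1 : ∀ x y, ∑ z, f x y z - 4 ≤ ∑ z ∈ (A.erase x).erase y, f x y z := by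
    intro x y
    have := sum_ge_compl ((A.erase x).erase y) 4 (compl_erase_card _ _ _ (compl_erase_card _ _ _ hA))
      (f x y) (f x y) 1 (by norm_num) (fun _ _ => le_rfl) (hf x y)
    norm_num at this ⊢; linarith
  have t2 : ∀ x, ∑ y, ∑ z, f x y z - 7 * N ≤ ∑ y ∈ A.erase x, ∑ z ∈ (A.erase x).erase y, f x y z := by
    intro x
    have := sum_ge_compl (A.erase x) 3 (compl_erase_card _ _ _ hA)
      (fun y => ∑ z ∈ (A.erase x).erase y, f x y z) (fun y => ∑ z, f x y z - 4) N hN0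
      (fun y _ => t1 x y) (fun y => by linarith [s1 x y])
    rw [sum_sub_distrib, sum_const, card_univ, nsmul_eq_mul, ← hNdef] at this
    push_cast at this
    linarith
  have := sum_ge_compl A 2 hA (fun x => ∑ y ∈ A.erase x, ∑ z ∈ (A.erase x).erase y, f x y z)
    (fun x => ∑ y, ∑ z, f x y z - 7 * N) (N * N) (by positivity) (fun x _ => t2 x)
    (fun x => by linarith [s2 x])
  rw [sum_sub_distrib, sum_const, card_univ, nsmul_eq_mul, ← hNdef] at this
  push_cast at this
  nlinarith
end counting
end EI

namespace EI
set_option linter.unusedSectionVars false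
set_option linter.unusedVariables false
section flip

def cd (α : Fin 3 × Fin 3) : ℕ := 3 * α.1.1 + α.2.1
def L9 : List ℕ := [0,1,2,3,4,5,6,7,8]
/-- adjacency table of the disjoint union of three triangles -/
def pc (a b : ℕ) : ℕ := 909652762138973202811398 / 2^(9 * a + b) % 2
def ls : List ℕ → (ℕ → ℕ) → ℕ
  | [], _ => 0
  | a :: l, f => f a + ls l f
def hF (t a b x y z : ℕ) : ℕ :=
  (4 / 2^(t + pc a x + pc b x + pc a y + pc b y + pc x y + pc a z + pc b z + pc x z + pc y z)) % 2
def cF (t a b : ℕ) : ℕ := ls L9 fun x => ls L9 fun y => ls L9 fun z => hF t a b x y z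

theorem flipF : ∀ a ∈ L9, ∀ b ∈ L9, cF (1 - pc a b) a b + 36 ≤ cF (pc a b) a b := by decide +kernel
theorem totF : (ls L9 fun a => ls L9 fun b => cF (pc a b) a b) = 22680 := by decide +kernel

theorem cd_mem (α : Fin 3 × Fin 3) : cd α ∈ L9 := by revert α; decide

theorem pc_cd (α β : Fin 3 × Fin 3) : pc (cd α) (cd β) = if pat α β then 1 else 0 := by
  have h : ∀ α β : Fin 3 × Fin 3, pc (cd α) (cd β) = if (α.1 = β.1 ∧ α.2 ≠ β.2) then 1 else 0 := by
    decide +kernel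
  unfold pat
  rw [h α β]
  split_ifs <;> rfl

theorem pj_eq (α β : Fin 3 × Fin 3) : pj α β = (pc (cd α) (cd β) : ℝ) := by
  rw [pc_cd]; unfold pj; split_ifs <;> simp

theorem sum9 (f : ℕ → ℕ) : ∑ α : Fin 3 × Fin 3, f (cd α) = ls L9 f := by
  simp [Fintype.sum_prod_type, Fin.sum_univ_three, ls, L9, cd]
  ring

theorem pc01 (a b : ℕ) : pc a b = 0 ∨ pc a b = 1 := by unfold pc; omega

theorem e2N_bit (a b c d e f g h k l : ℕ) (ha : a = 0 ∨ a = 1) (hb : b = 0 ∨ b = 1) (hc : c = 0 ∨ c = 1)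
    (hd : d = 0 ∨ d = 1) (he : e = 0 ∨ e = 1) (hf : f = 0 ∨ f = 1) (hg : g = 0 ∨ g = 1)
    (hh : h = 0 ∨ h = 1) (hk : k = 0 ∨ k = 1) (hl : l = 0 ∨ l = 1) :
    e2N a b c d e f g h k l = 4 / 2^(a + b + c + d + e + f + g + h + k + l) % 2 := by
  have hm : ∀ t : ℕ, (t = 0 ∨ t = 1) → t % 2 = t := by intro t ht; omega
  unfold e2N
  rw [hm a ha, hm b hb, hm c hc, hm d hd, hm e he, hm f hf, hm g hg, hm h hh, hm k hk, hm l hl]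
  have h10 : a + b + c + d + e + f + g + h + k + l ≤ 10 := by omega
  generalize a + b + c + d + e + f + g + h + k + l = m at *
  interval_cases m <;> decide

variable {V : Type*} [Fintype V]

/-- value of a five-tuple with the first pair forced -/
noncomputable def eT (G : SimpleGraph V) (t : ℕ) (u v x y z : V) : ℝ :=
  (e2N t (jb G u x) (jb G v x) (jb G u y) (jb G v y) (jb G x y) (jb G u z) (jb G v z) (jb G x z) (jb G y z) : ℝ)

theorem eT_nonneg (G : SimpleGraph V) (t : ℕ) (u v x y z : V) : 0 ≤ eT G t u v x y z := Nat.cast_nonneg _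
theorem eT_le (G : SimpleGraph V) (t : ℕ) (u v x y z : V) : eT G t u v x y z ≤ 1 := by
  unfold eT e2N; split_ifs <;> simp
theorem hF_le (t a b x y z : ℕ) : (hF t a b x y z : ℝ) ≤ 1 := by
  have : hF t a b x y z ≤ 1 := by unfold hF; omega
  exact_mod_cast this

theorem jp_ne (G : SimpleGraph V) (x y : V) (a b : ℕ) (h : jb G x y ≠ pc a b) : |(jb G x y : ℝ) - pc a b| = 1 := by
  rcases jb_01 G x y with h1 | h1 <;> rcases pc01 a b with h2 | h2 <;> rw [h1, h2] at h ⊢ <;> simp at h ⊢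

theorem eT_close (G : SimpleGraph V) (c : V → Fin 3 × Fin 3) (t : ℕ) (ht : t = 0 ∨ t = 1) (u v x y z : V) :
    |eT G t u v x y z - hF t (cd (c u)) (cd (c v)) (cd (c x)) (cd (c y)) (cd (c z))| ≤
      |(jb G u x : ℝ) - pj (c u) (c x)| + |(jb G v x : ℝ) - pj (c v) (c x)| +
      |(jb G u y : ℝ) - pj (c u) (c y)| + |(jb G v y : ℝ) - pj (c v) (c y)| +
      |(jb G x y : ℝ) - pj (c x) (c y)| + |(jb G u z : ℝ) - pj (c u) (c z)| +
      |(jb G v z : ℝ) - pj (c v) (c z)| + |(jb G x z : ℝ) - pj (c x) (c z)| +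
      |(jb G y z : ℝ) - pj (c y) (c z)| := by
  have h0 : |eT G t u v x y z - hF t (cd (c u)) (cd (c v)) (cd (c x)) (cd (c y)) (cd (c z))| ≤ 1 := by
    have h1 := eT_nonneg G t u v x y z
    have h2 := eT_le G t u v x y z
    have h3 := hF_le t (cd (c u)) (cd (c v)) (cd (c x)) (cd (c y)) (cd (c z))
    have h4 : (0:ℝ) ≤ hF t (cd (c u)) (cd (c v)) (cd (c x)) (cd (c y)) (cd (c z)) := Nat.cast_nonneg _
    rw [abs_le]; constructor <;> linarith
  simp only [pj_eq]
  have n : ∀ (p q : V), 0 ≤ |(jb G p q : ℝ) - pc (cd (c p)) (cd (c q))| := fun p q => abs_nonneg _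
  have n1 := n u x
  have n2 := n v x
  have n3 := n u y
  have n4 := n v y
  have n5 := n x y
  have n6 := n u z
  have n7 := n v z
  have n8 := n x z
  have n9 := n y z
  by_cases e1 : jb G u x = pc (cd (c u)) (cd (c x))
  swap
  · have := jp_ne G _ _ _ _ e1; linarith
  by_cases e2 : jb G v x = pc (cd (c v)) (cd (c x))
  swap
  · have := jp_ne G _ _ _ _ e2; linarith
  by_cases e3 : jb G u y = pc (cd (c u)) (cd (c y))
  swap
  · have := jp_ne G _ _ _ _ e3; linarith
  by_cases e4 : jb G v y = pc (cd (c v)) (cd (c y))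
  swap
  · have := jp_ne G _ _ _ _ e4; linarith
  by_cases e5 : jb G x y = pc (cd (c x)) (cd (c y))
  swap
  · have := jp_ne G _ _ _ _ e5; linarith
  by_cases e6 : jb G u z = pc (cd (c u)) (cd (c z))
  swap
  · have := jp_ne G _ _ _ _ e6; linarith
  by_cases e7 : jb G v z = pc (cd (c v)) (cd (c z))
  swap
  · have := jp_ne G _ _ _ _ e7; linarith
  by_cases e8 : jb G x z = pc (cd (c x)) (cd (c z))
  swap
  · have := jp_ne G _ _ _ _ e8; linarith
  by_cases e9 : jb G y z = pc (cd (c y)) (cd (c z))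
  swap
  · have := jp_ne G _ _ _ _ e9; linarith
  have : eT G t u v x y z = hF t (cd (c u)) (cd (c v)) (cd (c x)) (cd (c y)) (cd (c z)) := by
    unfold eT hF
    rw [e2N_bit _ _ _ _ _ _ _ _ _ _ ht (jb_01 _ _ _) (jb_01 _ _ _) (jb_01 _ _ _) (jb_01 _ _ _) (jb_01 _ _ _)
      (jb_01 _ _ _) (jb_01 _ _ _) (jb_01 _ _ _) (jb_01 _ _ _), e1, e2, e3, e4, e5, e6, e7, e8, e9]
  rw [this, sub_self, abs_zero]
  linarith

theorem eT_close_sum {G : SimpleGraph V} {c : V → Fin 3 × Fin 3} {ε : ℝ} (hc : Cls G c ε) (t : ℕ)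
    (ht : t = 0 ∨ t = 1) (u v : V) :
    ∑ x, ∑ y, ∑ z, |eT G t u v x y z - hF t (cd (c u)) (cd (c v)) (cd (c x)) (cd (c y)) (cd (c z))| ≤
      9 * ε * (Fintype.card V : ℝ)^3 := by
  set N : ℝ := ((Fintype.card V : ℕ) : ℝ) with hNdef
  have hN0 : 0 ≤ N := Nat.cast_nonneg _
  refine (sum_le_sum fun x _ => sum_le_sum fun y _ => sum_le_sum fun z _ => eT_close G c t ht u v x y z).trans ?_
  simp only [sum_add_distrib]
  have w := hc.wrong
  simp only [← hNdef] at w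
  have wall : ∑ x, ∑ y, |(jb G x y : ℝ) - pj (c x) (c y)| ≤ N * (ε * N) := sum_le_M _ _ w
  simp only [sum_const, card_univ, nsmul_eq_mul, ← mul_sum, ← hNdef]
  have a1 := mul_le_mul_of_nonneg_left (mul_le_mul_of_nonneg_left (w u) hN0) hN0
  have a2 := mul_le_mul_of_nonneg_left (mul_le_mul_of_nonneg_left (w v) hN0) hN0
  have a3 := mul_le_mul_of_nonneg_left wall hN0
  have e : N * (N * (ε * N)) = ε * N^3 := by ring
  rw [e] at a1 a2 a3
  linarith

theorem three_close {N a b c ε : ℝ} (hN : 0 ≤ N) (hε : 0 ≤ ε) (ha0 : 0 ≤ a) (hb0 : 0 ≤ b) (hc0 : 0 ≤ c)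
    (ha1 : a ≤ N) (hb1 : b ≤ N) (hc1 : c ≤ N) (ha : |a - N/9| ≤ ε * N) (hb : |b - N/9| ≤ ε * N)
    (hc : |c - N/9| ≤ ε * N) : |a * b * c - (N/9)^3| ≤ 3 * ε * N^3 := by
  have e : a * b * c - (N/9)^3 = (a - N/9) * (b * c) + (b - N/9) * (N/9 * c) + (c - N/9) * (N/9 * (N/9)) := by ring
  rw [e]
  have hεN : 0 ≤ ε * N := by positivity
  have k1 : |(a - N/9) * (b * c)| ≤ (ε * N) * (N * N) := by
    rw [abs_mul, abs_of_nonneg (mul_nonneg hb0 hc0)]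
    exact mul_le_mul ha (mul_le_mul hb1 hc1 hc0 hN) (by positivity) hεN
  have k2 : |(b - N/9) * (N/9 * c)| ≤ (ε * N) * (N * N) := by
    rw [abs_mul, abs_of_nonneg (mul_nonneg (by positivity) hc0)]
    exact mul_le_mul hb (mul_le_mul (by linarith) hc1 hc0 hN) (by positivity) hεN
  have k3 : |(c - N/9) * (N/9 * (N/9))| ≤ (ε * N) * (N * N) := by
    rw [abs_mul, abs_of_nonneg (mul_nonneg (by positivity : 0 ≤ N/9) (by positivity))]
    exact mul_le_mul hc (mul_le_mul (by linarith) (by linarith) (by positivity) hN) (by positivity) hεN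
  have := abs_add_le ((a - N/9) * (b * c) + (b - N/9) * (N/9 * c)) ((c - N/9) * (N/9 * (N/9)))
  have := abs_add_le ((a - N/9) * (b * c)) ((b - N/9) * (N/9 * c))
  nlinarith

theorem col1 (c : V → Fin 3 × Fin 3) (f : Fin 3 × Fin 3 → ℝ) :
    ∑ x, f (c x) = ∑ α, (∑ u, if c u = α then (1:ℝ) else 0) * f α := by
  simp only [sum_mul]
  rw [sum_comm]
  refine sum_congr rfl fun x _ => ?_
  simp

theorem col3 (c : V → Fin 3 × Fin 3) (f : Fin 3 × Fin 3 → Fin 3 × Fin 3 → Fin 3 × Fin 3 → ℝ) :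
    ∑ x, ∑ y, ∑ z, f (c x) (c y) (c z) =
      ∑ α, ∑ β, ∑ γ, (∑ u, if c u = α then (1:ℝ) else 0) * (∑ u, if c u = β then (1:ℝ) else 0) *
        (∑ u, if c u = γ then (1:ℝ) else 0) * f α β γ := by
  rw [col1 c (fun α => ∑ y, ∑ z, f α (c y) (c z))]
  refine sum_congr rfl fun α _ => ?_
  rw [col1 c (fun β => ∑ z, f α β (c z)), mul_sum]
  refine sum_congr rfl fun β _ => ?_
  rw [col1 c (fun γ => f α β γ), mul_sum, mul_sum]
  refine sum_congr rfl fun γ _ => ?_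
  ring

theorem col_lower {G : SimpleGraph V} {c : V → Fin 3 × Fin 3} {ε : ℝ} (hε : 0 ≤ ε) (hc : Cls G c ε)
    (f : Fin 3 × Fin 3 → Fin 3 × Fin 3 → Fin 3 × Fin 3 → ℝ) (hf : ∀ α β γ, |f α β γ| ≤ 1) :
    ((Fintype.card V : ℝ)/9)^3 * (∑ α, ∑ β, ∑ γ, f α β γ) - 2187 * ε * (Fintype.card V : ℝ)^3 ≤
      ∑ x, ∑ y, ∑ z, f (c x) (c y) (c z) := by
  rw [col3 c]
  have w := hc.size
  set N : ℝ := ((Fintype.card V : ℕ) : ℝ) with hNdef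
  have hN0 : 0 ≤ N := Nat.cast_nonneg _
  have w0 : ∀ α, 0 ≤ ∑ u, if c u = α then (1:ℝ) else 0 := fun α => sum_nonneg fun u _ => by split_ifs <;> norm_num
  have w1 : ∀ α, ∑ u, (if c u = α then (1:ℝ) else 0) ≤ N := fun α => by
    have := sum_le_M (fun u => if c u = α then (1:ℝ) else 0) 1 (fun u => by split_ifs <;> norm_num)
    rwa [mul_one] at this
  have e : (N/9)^3 * (∑ α, ∑ β, ∑ γ, f α β γ) - 2187 * ε * N^3 =
      ∑ α : Fin 3 × Fin 3, ∑ β : Fin 3 × Fin 3, ∑ γ : Fin 3 × Fin 3, ((N/9)^3 * f α β γ - 3 * ε * N^3) := by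
    simp only [sum_sub_distrib, mul_sum, sum_const, card_univ, nsmul_eq_mul, Fintype.card_prod, Fintype.card_fin]
    push_cast; ring
  rw [e]
  refine sum_le_sum fun α _ => sum_le_sum fun β _ => sum_le_sum fun γ _ => ?_
  have h1 := three_close hN0 hε (w0 α) (w0 β) (w0 γ) (w1 α) (w1 β) (w1 γ) (w α) (w β) (w γ)
  set X := (∑ u, if c u = α then (1:ℝ) else 0) * (∑ u, if c u = β then (1:ℝ) else 0) *
        (∑ u, if c u = γ then (1:ℝ) else 0)
  have h2 : |(X - (N/9)^3) * f α β γ| ≤ 3 * ε * N^3 := by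
    rw [abs_mul]
    calc _ ≤ (3 * ε * N^3) * 1 := mul_le_mul h1 (hf α β γ) (abs_nonneg _) ((abs_nonneg _).trans h1)
      _ = _ := by ring
  have h3 := (abs_le.1 h2).1
  linarith

theorem gain_arith {N p q A B A' B' : ℝ} (hN : 0 ≤ N)
    (c3 : (N/9)^3 * (p - q) - 2187 * (1/10^12) * N^3 ≤ A' - B') (c4 : q + 36 ≤ p)
    (d1 : -(9 * (1/10^12) * N^3) ≤ A - A') (d2 : B - B' ≤ 9 * (1/10^12) * N^3) :
    1/25 * N^3 ≤ A - B := by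
  have hp : 0 ≤ N^3 := by positivity
  have c5 : (N/9)^3 * 36 ≤ (N/9)^3 * (p - q) :=
    mul_le_mul_of_nonneg_left (by linarith) (by positivity)
  have e1 : (N/9)^3 * 36 = 36/729 * N^3 := by ring
  rw [e1] at c5
  norm_num at c3 d1 d2
  linarith

/-- main gain estimate -/
theorem gain_sum {G : SimpleGraph V} {c : V → Fin 3 × Fin 3} (hc : Cls G c (1/10^12)) (u v : V) (t : ℕ)
    (ht : t = pc (cd (c u)) (cd (c v))) :
    1/25 * (Fintype.card V : ℝ)^3 ≤ ∑ x, ∑ y, ∑ z, (eT G t u v x y z - eT G (1 - t) u v x y z) := by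
  have ht1 : t = 0 ∨ t = 1 := by rw [ht]; exact pc01 _ _
  have ht2 : 1 - t = 0 ∨ 1 - t = 1 := by omega
  have c1 := eT_close_sum hc t ht1 u v
  have c2 := eT_close_sum hc (1 - t) ht2 u v
  set a := cd (c u) with ha
  set b := cd (c v) with hb
  have c3 := col_lower (by norm_num) hc
    (fun α β γ => (hF t a b (cd α) (cd β) (cd γ) : ℝ) - hF (1 - t) a b (cd α) (cd β) (cd γ)) (by
      intro α β γ
      have h1 := hF_le t a b (cd α) (cd β) (cd γ)
      have h2 := hF_le (1 - t) a b (cd α) (cd β) (cd γ)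
      have h3 : (0:ℝ) ≤ hF t a b (cd α) (cd β) (cd γ) := Nat.cast_nonneg _
      have h4 : (0:ℝ) ≤ hF (1 - t) a b (cd α) (cd β) (cd γ) := Nat.cast_nonneg _
      rw [abs_le]; constructor <;> linarith)
  have hsum : ∀ s, (∑ α : Fin 3 × Fin 3, ∑ β : Fin 3 × Fin 3, ∑ γ : Fin 3 × Fin 3,
      (hF s a b (cd α) (cd β) (cd γ) : ℝ)) = cF s a b := by
    intro s
    unfold cF
    rw [← sum9, Nat.cast_sum]
    refine sum_congr rfl fun α _ => ?_
    rw [← sum9, Nat.cast_sum]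
    refine sum_congr rfl fun β _ => ?_
    rw [← sum9, Nat.cast_sum]
  simp only [sum_sub_distrib] at c3 ⊢
  rw [hsum, hsum] at c3
  have c4 : (cF (1 - t) a b : ℝ) + 36 ≤ cF t a b := by
    have := flipF a (cd_mem _) b (cd_mem _)
    rw [← ht] at this
    exact_mod_cast this
  set N : ℝ := ((Fintype.card V : ℕ) : ℝ) with hNdef
  have hN0 : 0 ≤ N := Nat.cast_nonneg _
  have d : ∀ s, |∑ x, ∑ y, ∑ z, eT G s u v x y z - ∑ x, ∑ y, ∑ z, (hF s a b (cd (c x)) (cd (c y)) (cd (c z)) : ℝ)| ≤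
      ∑ x, ∑ y, ∑ z, |eT G s u v x y z - hF s a b (cd (c x)) (cd (c y)) (cd (c z))| := by
    intro s
    rw [← sum_sub_distrib]
    refine (abs_sum_le_sum_abs _ _).trans (sum_le_sum fun x _ => ?_)
    rw [← sum_sub_distrib]
    refine (abs_sum_le_sum_abs _ _).trans (sum_le_sum fun y _ => ?_)
    rw [← sum_sub_distrib]
    exact abs_sum_le_sum_abs _ _
  have d1 := (abs_le.1 ((d t).trans c1)).1
  have d2 := (abs_le.1 ((d (1 - t)).trans c2)).2
  exact gain_arith hN0 c3 c4 d1 d2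

end flip
end EI

namespace EI
set_option linter.unusedSectionVars false
set_option linter.unusedVariables false
section surgery
variable {n : ℕ}

/-- flip one pair -/
def flipG (G : SimpleGraph (Fin n)) (u v : Fin n) (huv : u ≠ v) : SimpleGraph (Fin n) where
  Adj p q := if (p = u ∧ q = v) ∨ (p = v ∧ q = u) then ¬ G.Adj p q else G.Adj p q
  symm := ⟨by
    intro p q h
    have e : ((q = u ∧ p = v) ∨ (q = v ∧ p = u)) ↔ ((p = u ∧ q = v) ∨ (p = v ∧ q = u)) := by tauto
    simp only [e, G.adj_comm q p]
    exact h⟩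
  loopless := ⟨by
    intro p h
    have e : ¬ ((p = u ∧ p = v) ∨ (p = v ∧ p = u)) := by
      rintro (⟨h1, h2⟩ | ⟨h1, h2⟩)
      · exact huv (h1.symm.trans h2)
      · exact huv (h2.symm.trans h1)
    rw [if_neg e] at h
    exact G.loopless.irrefl p h⟩

theorem flip_other (G : SimpleGraph (Fin n)) {u v : Fin n} (huv : u ≠ v) {p q : Fin n}
    (h : ¬ ((p = u ∧ q = v) ∨ (p = v ∧ q = u))) : (flipG G u v huv).Adj p q ↔ G.Adj p q := by
  simp only [flipG, if_neg h]

theorem flip_uv (G : SimpleGraph (Fin n)) {u v : Fin n} (huv : u ≠ v) :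
    (flipG G u v huv).Adj u v ↔ ¬ G.Adj u v := by
  simp [flipG]

theorem jb_congr {G H : SimpleGraph (Fin n)} {p q p' q' : Fin n} (h : G.Adj p q ↔ H.Adj p' q') :
    jb G p q = jb H p' q' := by
  unfold jb; simp only [h]

theorem FS_congr {G H : SimpleGraph (Fin n)} {S : Finset (Fin n)}
    (h : ∀ p ∈ S, ∀ q ∈ S, (G.Adj p q ↔ H.Adj p q)) : FS G S = FS H S := by
  have : edgeCount G S = edgeCount H S := by
    have h1 := ec_sum G S
    have h2 := ec_sum H S
    have : ∑ p ∈ S, ∑ q ∈ S, jb G p q = ∑ p ∈ S, ∑ q ∈ S, jb H p q :=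
      sum_congr rfl fun p hp => sum_congr rfl fun q hq => jb_congr (h p hp q hq)
    omega
  unfold FS; rw [this]

theorem FS_nonneg (G : SimpleGraph (Fin n)) (S : Finset (Fin n)) : 0 ≤ FS G S := by
  unfold FS; split_ifs <;> norm_num
theorem FS_le (G : SimpleGraph (Fin n)) (S : Finset (Fin n)) : FS G S ≤ 1 := by
  unfold FS; split_ifs <;> norm_num

theorem flip_gain (G : SimpleGraph (Fin n)) (c : Fin n → Fin 3 × Fin 3) (hc : Cls G c (1/10^12))
    (hn : 1000 ≤ n) (u v : Fin n) (huv : u ≠ v) (hw : ¬ (G.Adj u v ↔ pat (c u) (c v))) :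
    (numKL 5 2 G : ℝ) + (n:ℝ)^3/1000 ≤ numKL 5 2 (flipG G u v huv) := by
  set G' := flipG G u v huv with hG'
  rw [numKL_eq, numKL_eq]
  have hD : ∀ S, ¬ (u ∈ S ∧ v ∈ S) → FS G' S - FS G S = 0 := by
    intro S hS
    rw [sub_eq_zero]
    refine FS_congr fun p hp q hq => flip_other G huv ?_
    rintro (⟨rfl, rfl⟩ | ⟨rfl, rfl⟩)
    · exact hS ⟨hp, hq⟩
    · exact hS ⟨hq, hp⟩
  set A : Finset (Fin n) := (univ.erase u).erase v with hA
  have e1 : ∑ S ∈ powersetCard 5 univ, FS G' S - ∑ S ∈ powersetCard 5 univ, FS G S =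
      ∑ R ∈ powersetCard 3 A, (FS G' (insert u (insert v R)) - FS G (insert u (insert v R))) := by
    rw [← sum_sub_distrib, psum_root univ u (mem_univ u) 4 (fun S => FS G' S - FS G S)
      (fun S hS => hD S fun h => hS h.1)]
    rw [psum_root (univ.erase u) v (mem_erase.2 ⟨huv.symm, mem_univ v⟩) 3
      (fun R => FS G' (insert u R) - FS G (insert u R))]
    intro S hS
    refine hD _ fun h => hS ?_
    exact (mem_insert.1 h.2).resolve_left huv.symm
  have e2 := psum3 A (fun R => FS G' (insert u (insert v R)) - FS G (insert u (insert v R)))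
  set t := 1 - jb G u v with ht
  have e3 : ∑ x ∈ A, ∑ y ∈ A.erase x, ∑ z ∈ (A.erase x).erase y,
      (FS G' (insert u (insert v {x, y, z})) - FS G (insert u (insert v {x, y, z}))) =
      ∑ x ∈ A, ∑ y ∈ A.erase x, ∑ z ∈ (A.erase x).erase y,
        (eT G t u v x y z - eT G (1 - t) u v x y z) := by
    refine sum_congr rfl fun x hx => sum_congr rfl fun y hy => sum_congr rfl fun z hz => ?_
    simp only [hA, mem_erase, mem_univ, and_true] at hx hy hz
    obtain ⟨hxv, hxu⟩ := hx
    obtain ⟨hyx, hyv, hyu⟩ := hy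
    obtain ⟨hzy, hzx, hzv, hzu⟩ := hz
    rw [FS_eq G u v x y z huv hxu.symm hyu.symm hzu.symm hxv.symm hyv.symm hzv.symm hyx.symm hzx.symm hzy.symm]
    rw [FS_eq G' u v x y z huv hxu.symm hyu.symm hzu.symm hxv.symm hyv.symm hzv.symm hyx.symm hzx.symm hzy.symm]
    have h01 := jb_01 G u v
    have j1 : jb G' u v = t := by
      have := flip_uv G huv
      rw [ht]
      unfold jb
      by_cases h : G.Adj u v <;> simp [hG', this, h]
    have j2 : jb G u v = 1 - t := by omega
    have jo : ∀ p q, q ≠ u → q ≠ v → jb G' p q = jb G p q := fun p q h1 h2 =>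
      jb_congr (flip_other G huv (by rintro (⟨_, h⟩ | ⟨_, h⟩); exacts [h2 h, h1 h]))
    unfold E5 at5 eT
    rw [j1, j2, jo u x hxu hxv, jo v x hxu hxv, jo u y hyu hyv, jo v y hyu hyv, jo x y hyu hyv,
      jo u z hzu hzv, jo v z hzu hzv, jo x z hzu hzv, jo y z hzu hzv]
  rw [e3] at e2
  have htp : t = pc (cd (c u)) (cd (c v)) := by
    rw [pc_cd, ht]
    unfold jb
    by_cases h1 : G.Adj u v <;> by_cases h2 : pat (c u) (c v) <;> simp [h1, h2] at hw ⊢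
  have g := gain_sum hc u v t htp
  have hAc : Aᶜ.card ≤ 2 := by
    have : (univ : Finset (Fin n))ᶜ.card ≤ 0 := by simp
    exact compl_erase_card _ _ _ (compl_erase_card _ _ _ this)
  have g2 := sum3_ge A hAc (fun x y z => eT G t u v x y z - eT G (1 - t) u v x y z) (fun x y z => by
    have := eT_le G t u v x y z
    have := eT_nonneg G (1 - t) u v x y z
    linarith)
  rw [Fintype.card_fin] at g g2
  have hn' : (1000:ℝ) ≤ n := by exact_mod_cast hn
  have h3 : 1000 * (n:ℝ)^2 ≤ (n:ℝ)^3 := by nlinarith [sq_nonneg (n:ℝ)]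
  have h4 : 0 ≤ (n:ℝ)^3 := by positivity
  have := e1
  linarith

/-- wrong pairs with respect to a colouring -/
noncomputable def Wr (G : SimpleGraph (Fin n)) (c : Fin n → Fin 3 × Fin 3) : ℕ :=
  (univ.filter (fun p : Fin n × Fin n => p.1 < p.2 ∧ ¬ (G.Adj p.1 p.2 ↔ pat (c p.1) (c p.2)))).card

noncomputable def dW (G : SimpleGraph (Fin n)) : ℕ := ⨅ c : Fin n → Fin 3 × Fin 3, Wr G c

noncomputable def dG (G H : SimpleGraph (Fin n)) : ℕ :=
  (univ.filter (fun p : Fin n × Fin n => p.1 < p.2 ∧ ¬ (G.Adj p.1 p.2 ↔ H.Adj p.1 p.2))).card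

theorem dW_le (G : SimpleGraph (Fin n)) (c : Fin n → Fin 3 × Fin 3) : dW G ≤ Wr G c :=
  ciInf_le (OrderBot.bddBelow _) c

theorem dW_att (G : SimpleGraph (Fin n)) : ∃ c, dW G = Wr G c := by
  obtain ⟨c, hc⟩ := ciInf_mem (fun c : Fin n → Fin 3 × Fin 3 => Wr G c)
  exact ⟨c, hc.symm⟩

theorem dW_lip (G H : SimpleGraph (Fin n)) : dW G ≤ dW H + dG G H := by
  obtain ⟨c, hc⟩ := dW_att H
  refine (dW_le G c).trans ?_
  rw [hc]
  unfold Wr dG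
  refine le_trans (card_le_card ?_) (card_union_le _ _)
  intro p hp
  simp only [mem_filter, mem_univ, true_and, mem_union] at hp ⊢
  tauto

/-- graph of a colouring -/
def patG (c : Fin n → Fin 3 × Fin 3) : SimpleGraph (Fin n) where
  Adj u v := pat (c u) (c v)
  symm := ⟨fun u v h => ⟨h.1.symm, h.2.symm⟩⟩
  loopless := ⟨fun u h => h.2 rfl⟩

theorem dist_le_dW (G : SimpleGraph (Fin n)) : distToFam G isBlowup3K3 ≤ dW G := by
  obtain ⟨c, hc⟩ := dW_att G
  rw [hc]
  have h1 : distToFam G isBlowup3K3 ≤ editDist G (patG c) :=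
    ciInf_le (OrderBot.bddBelow _) (⟨patG c, c, fun u v => Iff.rfl⟩ : {H : SimpleGraph (Fin n) // isBlowup3K3 H})
  refine h1.trans ?_
  exact ciInf_le (OrderBot.bddBelow _) (1 : Equiv.Perm (Fin n))

theorem dG_flip (G : SimpleGraph (Fin n)) (u v : Fin n) (huv : u ≠ v) : dG G (flipG G u v huv) ≤ 2 := by
  unfold dG
  refine le_trans (card_le_card (t := {(u, v), (v, u)}) ?_) card_le_two
  intro p hp
  simp only [mem_filter, mem_univ, true_and] at hp
  by_contra hne
  refine hp.2 (flip_other G huv ?_).symm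
  rintro (⟨h1, h2⟩ | ⟨h1, h2⟩)
  · exact hne (by simp [Prod.ext_iff, h1, h2])
  · exact hne (by simp [Prod.ext_iff, h1, h2])

/-- replace x by a twin of y -/
def cloneG (G : SimpleGraph (Fin n)) (x y : Fin n) : SimpleGraph (Fin n) :=
  G.comap (fun p => if p = x then y else p)

theorem clone_adj (G : SimpleGraph (Fin n)) (x y p q : Fin n) :
    (cloneG G x y).Adj p q ↔ G.Adj (if p = x then y else p) (if q = x then y else q) := Iff.rfl

theorem dG_clone (G : SimpleGraph (Fin n)) (x y : Fin n) : dG G (cloneG G x y) ≤ 2 * n := by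
  unfold dG
  refine le_trans (card_le_card (t := univ.image (fun q => (x, q)) ∪ univ.image (fun q => (q, x))) ?_) ?_
  · intro p hp
    simp only [mem_filter, mem_univ, true_and] at hp
    by_contra hne
    simp only [mem_union, mem_image, mem_univ, true_and, not_or, not_exists] at hne
    have h1 : p.1 ≠ x := fun h => hne.1 p.2 (by rw [← h])
    have h2 : p.2 ≠ x := fun h => hne.2 p.1 (by rw [← h])
    apply hp.2
    rw [clone_adj, if_neg h1, if_neg h2]
  · refine (card_union_le _ _).trans ?_
    have h1 := card_image_le (s := (univ : Finset (Fin n))) (f := fun q => (x, q))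
    have h2 := card_image_le (s := (univ : Finset (Fin n))) (f := fun q => (q, x))
    rw [card_univ, Fintype.card_fin] at h1 h2
    omega

/-- good sets through x -/
noncomputable def Lx (G : SimpleGraph (Fin n)) (x : Fin n) : ℝ :=
  ∑ R ∈ powersetCard 4 (univ.erase x), FS G (insert x R)

theorem sum_Lx (G : SimpleGraph (Fin n)) : ∑ x, Lx G x = 5 * numKL 5 2 G := by
  rw [numKL_eq]
  have := psum_dbl univ 4 (FS G)
  unfold Lx
  rw [← this]; norm_num

theorem split_x (G : SimpleGraph (Fin n)) (x : Fin n) :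
    (numKL 5 2 G : ℝ) = ∑ S ∈ powersetCard 5 (univ.erase x), FS G S + Lx G x := by
  rw [numKL_eq]
  unfold Lx
  nth_rewrite 1 [← insert_erase (mem_univ x)]
  rw [powersetCard_succ_insert (notMem_erase x univ), sum_union, sum_image]
  · intro S hS T hT h
    have hS' : x ∉ S := fun h' => notMem_erase x univ ((mem_powersetCard.1 hS).1 h')
    have hT' : x ∉ T := fun h' => notMem_erase x univ ((mem_powersetCard.1 hT).1 h')
    rw [← erase_insert hS', ← erase_insert hT', h]
  · rw [disjoint_left]
    intro S hS hS'
    obtain ⟨T, hT, rfl⟩ := mem_image.1 hS'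
    exact notMem_erase x univ ((mem_powersetCard.1 hS).1 (mem_insert_self x T))

theorem FS_clone (G : SimpleGraph (Fin n)) (x y : Fin n) (hxy : x ≠ y) (R : Finset (Fin n)) (hx : x ∉ R) (hy : y ∉ R) :
    FS (cloneG G x y) (insert x R) = FS G (insert y R) := by
  have : edgeCount (cloneG G x y) (insert x R) = edgeCount G (insert y R) := by
    have h1 := ec_sum (cloneG G x y) (insert x R)
    have h2 := ec_sum G (insert y R)
    have hR : ∀ q ∈ R, q ≠ x := fun q hq h => hx (h ▸ hq)
    have : ∑ p ∈ insert x R, ∑ q ∈ insert x R, jb (cloneG G x y) p q =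
        ∑ p ∈ insert y R, ∑ q ∈ insert y R, jb G p q := by
      simp only [sum_insert hx, sum_insert hy]
      congr 1
      · congr 1
        · exact jb_congr (by simp [clone_adj])
        · exact sum_congr rfl fun q hq => jb_congr (by simp [clone_adj, hR q hq])
      · refine sum_congr rfl fun p hp => ?_
        congr 1
        · exact jb_congr (by simp [clone_adj, hR p hp])
        · exact sum_congr rfl fun q hq => jb_congr (by simp [clone_adj, hR q hq, hR p hp])
    omega
  unfold FS; rw [this]

theorem clone_gain (G : SimpleGraph (Fin n)) (x y : Fin n) (hxy : x ≠ y) :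
    (numKL 5 2 G : ℝ) - Lx G x + Lx G y - (n:ℝ)^3 ≤ numKL 5 2 (cloneG G x y) := by
  rw [split_x G x, split_x (cloneG G x y) x]
  have e1 : ∑ S ∈ powersetCard 5 (univ.erase x), FS (cloneG G x y) S =
      ∑ S ∈ powersetCard 5 (univ.erase x), FS G S := by
    refine sum_congr rfl fun S hS => FS_congr fun p hp q hq => ?_
    have hS' : ∀ p ∈ S, p ≠ x := fun p hp h => notMem_erase x univ ((mem_powersetCard.1 hS).1 (h ▸ hp))
    rw [clone_adj, if_neg (hS' p hp), if_neg (hS' q hq)]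
  rw [e1]
  have e2 : ∑ R ∈ powersetCard 4 ((univ.erase x).erase y), FS G (insert y R) ≤ Lx (cloneG G x y) x := by
    unfold Lx
    rw [← sum_congr rfl (fun R hR => FS_clone G x y hxy R
      (fun h => notMem_erase x _ (mem_of_mem_erase ((mem_powersetCard.1 hR).1 h)))
      (fun h => notMem_erase y _ ((mem_powersetCard.1 hR).1 h)))]
    exact sum_le_sum_of_subset_of_nonneg (powersetCard_mono (erase_subset _ _)) fun _ _ _ => FS_nonneg _ _
  have e3 : Lx G y ≤ ∑ R ∈ powersetCard 4 ((univ.erase x).erase y), FS G (insert y R) + (n:ℝ)^3 := by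
    unfold Lx
    have hx : x ∈ (univ : Finset (Fin n)).erase y := mem_erase.2 ⟨hxy, mem_univ x⟩
    nth_rewrite 1 [← insert_erase hx]
    rw [powersetCard_succ_insert (notMem_erase x _), erase_right_comm]
    have h1 : ∀ s t : Finset (Finset (Fin n)), ∑ R ∈ s ∪ t, FS G (insert y R) ≤
        ∑ R ∈ s, FS G (insert y R) + ∑ R ∈ t, FS G (insert y R) := by
      intro s t
      rw [← sum_union_inter]
      exact le_add_of_nonneg_right (sum_nonneg fun _ _ => FS_nonneg _ _)
    refine (h1 _ _).trans (add_le_add_right ?_ _)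
    refine (sum_le_card_nsmul _ _ 1 fun R _ => FS_le _ _).trans ?_
    rw [nsmul_eq_mul, mul_one]
    have h2 : ((powersetCard 3 ((univ.erase x).erase y)).image (insert x)).card ≤ n^3 := by
      refine card_image_le.trans ?_
      rw [card_powersetCard]
      refine (Nat.choose_le_pow _ _).trans (Nat.pow_le_pow_left ?_ 3)
      exact (card_le_univ _).trans (by simp)
    exact_mod_cast h2
  linarith
end surgery
end EI

namespace EI
set_option linter.unusedSectionVars false
set_option linter.unusedVariables false
section final
variable {n : ℕ}

theorem sum_sub_le {V : Type*} [Fintype V] (s : Finset V) (f g : V → ℝ) (h : ∀ x ∈ s, f x ≤ g x)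
    (hg : ∀ x, 0 ≤ g x) : ∑ x ∈ s, f x ≤ ∑ x, g x :=
  (sum_le_sum h).trans (sum_le_sum_of_subset_of_nonneg (subset_univ s) fun x _ _ => hg x)

theorem rooted_le (G : SimpleGraph (Fin n)) (x : Fin n) :
    24 * Lx G x ≤ ∑ y, ∑ z, ∑ u, ∑ w, E5 G x y z u w := by
  unfold Lx
  rw [psum4]
  have h0 : ∀ y z u w, 0 ≤ E5 G x y z u w := fun y z u w => E5_nonneg G x y z u w
  refine sum_sub_le _ _ _ (fun y hy => sum_sub_le _ _ _ (fun z hz => sum_sub_le _ _ _ (fun u hu =>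
    sum_sub_le _ _ _ (fun w hw => ?_) ?_) ?_) ?_) ?_
  · simp only [mem_erase, mem_univ, and_true] at hy hz hu hw
    rw [FS_eq G x y z u w (Ne.symm hy) (Ne.symm hz.2) (Ne.symm hu.2.2) (Ne.symm hw.2.2.2) (Ne.symm hz.1)
      (Ne.symm hu.2.1) (Ne.symm hw.2.2.1) (Ne.symm hu.1) (Ne.symm hw.2.1) (Ne.symm hw.1)]
  · exact fun w => h0 y z u w
  · exact fun u => sum_nonneg fun w _ => h0 y z u w
  · exact fun z => sum_nonneg fun u _ => sum_nonneg fun w _ => h0 y z u w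
  · exact fun y => sum_nonneg fun z _ => sum_nonneg fun u _ => sum_nonneg fun w _ => h0 y z u w

theorem num_le (G : SimpleGraph (Fin n)) : 120 * (numKL 5 2 G : ℝ) ≤ S5 (fun _ => 1) (E5 G) := by
  rw [S5_one]
  have h := sum_Lx G
  have h2 : ∑ x, 24 * Lx G x ≤ ∑ x, ∑ y, ∑ z, ∑ u, ∑ w, E5 G x y z u w :=
    sum_le_sum fun x _ => rooted_le G x
  rw [← mul_sum, h] at h2
  linarith

theorem E5_le (G : SimpleGraph (Fin n)) (x y z u w : Fin n) : E5 G x y z u w ≤ 1 := by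
  unfold E5 at5 e2N; split_ifs <;> simp

theorem num_ge (G : SimpleGraph (Fin n)) :
    S5 (fun _ => 1) (E5 G) - 12 * (n:ℝ)^4 ≤ 120 * (numKL 5 2 G : ℝ) := by
  rw [S5_one, numKL_eq, psum5]
  set N : ℝ := (n:ℝ) with hN
  have hN0 : 0 ≤ N := Nat.cast_nonneg _
  have t0 : ∀ x y, ((univ.erase x).erase y : Finset (Fin n))ᶜ.card ≤ 2 := by
    intro x y
    have : (univ : Finset (Fin n))ᶜ.card ≤ 0 := by simp
    exact compl_erase_card _ _ _ (compl_erase_card _ _ _ this)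
  have t0' : ∀ x, (univ.erase x : Finset (Fin n))ᶜ.card ≤ 1 := by
    intro x
    have : (univ : Finset (Fin n))ᶜ.card ≤ 0 := by simp
    exact compl_erase_card _ _ _ this
  have t1 : ∀ x, ∀ y ∈ univ.erase x, ∑ z, ∑ u, ∑ w, E5 G x y z u w - 9 * N^2 ≤
      ∑ z ∈ (univ.erase x).erase y, ∑ u ∈ ((univ.erase x).erase y).erase z,
        ∑ w ∈ (((univ.erase x).erase y).erase z).erase u, FS G {x, y, z, u, w} := by
    intro x y hy
    have h := sum3_ge _ (t0 x y) (fun z u w => E5 G x y z u w) (fun z u w => E5_le G x y z u w)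
    rw [Fintype.card_fin] at h
    refine h.trans (le_of_eq ?_)
    refine sum_congr rfl fun z hz => sum_congr rfl fun u hu => sum_congr rfl fun w hw => ?_
    simp only [mem_erase, mem_univ, and_true] at hy hz hu hw
    rw [FS_eq G x y z u w (Ne.symm hy) (Ne.symm hz.2) (Ne.symm hu.2.2) (Ne.symm hw.2.2.2) (Ne.symm hz.1)
      (Ne.symm hu.2.1) (Ne.symm hw.2.2.1) (Ne.symm hu.1) (Ne.symm hw.2.1) (Ne.symm hw.1)]
  have s3 : ∀ x y, ∑ z, ∑ u, ∑ w, E5 G x y z u w ≤ N * (N * N) := by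
    intro x y
    have := sum_le_M (fun z => ∑ u, ∑ w, E5 G x y z u w) (N * N) fun z => by
      have := sum_le_M (fun u => ∑ w, E5 G x y z u w) N fun u => by
        have := sum_le_M (fun w => E5 G x y z u w) 1 fun w => E5_le G x y z u w
        rwa [Fintype.card_fin, mul_one] at this
      rwa [Fintype.card_fin] at this
    rwa [Fintype.card_fin] at this
  rw [← sub_nonneg]
  have t2 : ∀ x, ∑ y, ∑ z, ∑ u, ∑ w, E5 G x y z u w - 10 * N^3 ≤
      ∑ y ∈ univ.erase x, ∑ z ∈ (univ.erase x).erase y, ∑ u ∈ ((univ.erase x).erase y).erase z,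
        ∑ w ∈ (((univ.erase x).erase y).erase z).erase u, FS G {x, y, z, u, w} := by
    intro x
    have := sum_ge_compl (univ.erase x) 1 (t0' x) _ (fun y => ∑ z, ∑ u, ∑ w, E5 G x y z u w - 9 * N^2)
      (N * (N * N)) (by positivity) (t1 x) (fun y => by
        have := s3 x y
        have h2 : 0 ≤ N^2 := by positivity
        linarith)
    rw [sum_sub_distrib, sum_const, card_univ, Fintype.card_fin, nsmul_eq_mul] at this
    push_cast at this
    refine le_trans (le_of_eq ?_) this
    rw [← hN]; ring
  have t3 := sum_le_sum fun x (_ : x ∈ (univ : Finset (Fin n))) => t2 x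
  rw [sum_sub_distrib, sum_const, card_univ, Fintype.card_fin, nsmul_eq_mul, ← hN] at t3
  have h4 : 0 ≤ N^4 := by positivity
  have e : N * (10 * N^3) = 10 * N^4 := by ring
  rw [e] at t3
  linarith

theorem num_upper (G : SimpleGraph (Fin n)) : 120 * (numKL 5 2 G : ℝ) ≤ 280/729 * (n:ℝ)^5 := by
  refine (num_le G).trans ?_
  have hs : ∑ x : Fin n, (1:ℝ) = n := by simp
  have hn : (0:ℝ) ≤ n := Nat.cast_nonneg n
  have hB : ∀ x y z u, 0 ≤ B4 G x y z u := fun x y z u => B4_nonneg G x y z u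
  rcases core G (fun _ => 1) (fun _ => zero_le_one) with h | h
  · rw [hs] at h
    have : 0 ≤ (n:ℝ)^5 := by positivity
    linarith
  · simp only [hs, one_mul, mul_one] at h
    have h1 : 0 ≤ (n:ℝ) * ∑ x, ∑ y, ∑ z, ∑ u, B4 G x y z u :=
      mul_nonneg hn (sum_nonneg fun x _ => sum_nonneg fun y _ => sum_nonneg fun z _ => sum_nonneg fun u _ => hB x y z u)
    have h2 : 0 ≤ 1/10000 * (n:ℝ)^2 * ∑ x, (9 * (∑ y, (jb G x y : ℝ)) - 2 * (n:ℝ))^2 :=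
      mul_nonneg (by positivity) (sum_nonneg fun x _ => sq_nonneg _)
    have h3 : 0 ≤ ∑ x, (81 * (∑ y, ∑ z, ((jb G x y : ℝ) * jb G x z * jb G y z)) - 2 * (n:ℝ)^2)^2 :=
      sum_nonneg fun x _ => sq_nonneg _
    linarith

/-- the balanced colouring -/
def bc (v : Fin n) : Fin 3 × Fin 3 :=
  (⟨v.1 % 9 / 3, by omega⟩, ⟨v.1 % 3, by omega⟩)

theorem bc_size (α : Fin 3 × Fin 3) : ((n / 9 : ℕ) : ℝ) ≤ ∑ u : Fin n, if bc u = α then (1:ℝ) else 0 := by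
  rw [sum_boole]
  have h : n / 9 ≤ (univ.filter (fun u : Fin n => bc u = α)).card := by
    have h1 : (univ : Finset (Fin (n/9))).card = n / 9 := by simp
    rw [← h1]
    refine card_le_card_of_injOn (fun k => (⟨9 * k.1 + 3 * α.1.1 + α.2.1, by
      have := k.2; have := α.1.2; have := α.2.2; omega⟩ : Fin n)) ?_ ?_
    · intro k _
      have := α.1.2; have := α.2.2
      refine mem_coe.2 (mem_filter.2 ⟨mem_univ _, ?_⟩)
      refine Prod.ext (Fin.ext ?_) (Fin.ext ?_)
      · show (9 * k.1 + 3 * α.1.1 + α.2.1) % 9 / 3 = α.1.1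
        omega
      · show (9 * k.1 + 3 * α.1.1 + α.2.1) % 3 = α.2.1
        omega
    · intro k _ l _ h
      have := congrArg Fin.val h
      simp only at this
      exact Fin.ext (by omega)
  exact_mod_cast h

theorem bc_ge (f : Fin 3 × Fin 3 → ℝ) (hf : ∀ α, 0 ≤ f α) (F : Fin n → ℝ) (hF : ∀ x, f (bc x) ≤ F x) :
    ((n/9 : ℕ):ℝ) * ∑ α, f α ≤ ∑ x, F x := by
  refine le_trans ?_ (sum_le_sum fun x _ => hF x)
  rw [col1 bc f, mul_sum]
  exact sum_le_sum fun α _ => mul_le_mul_of_nonneg_right (bc_size α) (hf α)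

theorem tot_real : ∑ a : Fin 3 × Fin 3, ∑ b : Fin 3 × Fin 3, ∑ x : Fin 3 × Fin 3, ∑ y : Fin 3 × Fin 3,
    ∑ z : Fin 3 × Fin 3, (hF (pc (cd a) (cd b)) (cd a) (cd b) (cd x) (cd y) (cd z) : ℝ) = 22680 := by
  have h := totF
  unfold cF at h
  simp only [← sum9] at h
  exact_mod_cast h

theorem E5_bal (x y z u w : Fin n) : E5 (patG bc) x y z u w =
    (hF (pc (cd (bc x)) (cd (bc y))) (cd (bc x)) (cd (bc y)) (cd (bc z)) (cd (bc u)) (cd (bc w)) : ℝ) := by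
  have hj : ∀ p q : Fin n, jb (patG bc) p q = pc (cd (bc p)) (cd (bc q)) := by
    intro p q
    rw [pc_cd]
    rfl
  unfold E5 at5 hF
  simp only [hj]
  rw [e2N_bit] <;> exact pc01 _ _

theorem bal_ge : 22680 * ((n/9 : ℕ):ℝ)^5 ≤ S5 (fun _ => 1) (E5 (patG (bc : Fin n → _))) := by
  rw [S5_one]
  set m : ℝ := ((n/9 : ℕ):ℝ) with hm
  have hm0 : 0 ≤ m := Nat.cast_nonneg _
  simp only [E5_bal]
  set g : Fin 3 × Fin 3 → Fin 3 × Fin 3 → Fin 3 × Fin 3 → Fin 3 × Fin 3 → Fin 3 × Fin 3 → ℝ :=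
    fun a b x y z => (hF (pc (cd a) (cd b)) (cd a) (cd b) (cd x) (cd y) (cd z) : ℝ) with hg
  have g0 : ∀ a b x y z, 0 ≤ g a b x y z := fun a b x y z => Nat.cast_nonneg _
  have n1 : ∀ a b x y, 0 ≤ ∑ z, g a b x y z := fun a b x y => sum_nonneg fun z _ => g0 a b x y z
  have n2 : ∀ a b x, 0 ≤ ∑ y, ∑ z, g a b x y z := fun a b x => sum_nonneg fun y _ => n1 a b x y
  have n3 : ∀ a b, 0 ≤ ∑ x, ∑ y, ∑ z, g a b x y z := fun a b => sum_nonneg fun x _ => n2 a b x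
  have n4 : ∀ a, 0 ≤ ∑ b, ∑ x, ∑ y, ∑ z, g a b x y z := fun a => sum_nonneg fun b _ => n3 a b
  have key := bc_ge (n := n) (fun a => m * (m * (m * (m * ∑ b, ∑ x, ∑ y, ∑ z, g a b x y z))))
    (fun a => mul_nonneg hm0 (mul_nonneg hm0 (mul_nonneg hm0 (mul_nonneg hm0 (n4 a)))))
    (fun x => ∑ y, ∑ z, ∑ u, ∑ w, g (bc x) (bc y) (bc z) (bc u) (bc w)) (fun x => by
      have := bc_ge (n := n) (fun b => m * (m * (m * ∑ x', ∑ y, ∑ z, g (bc x) b x' y z)))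
        (fun b => mul_nonneg hm0 (mul_nonneg hm0 (mul_nonneg hm0 (n3 _ b))))
        (fun y => ∑ z, ∑ u, ∑ w, g (bc x) (bc y) (bc z) (bc u) (bc w)) (fun y => by
          have := bc_ge (n := n) (fun c => m * (m * ∑ y', ∑ z, g (bc x) (bc y) c y' z))
            (fun c => mul_nonneg hm0 (mul_nonneg hm0 (n2 _ _ c)))
            (fun z => ∑ u, ∑ w, g (bc x) (bc y) (bc z) (bc u) (bc w)) (fun z => by
              have := bc_ge (n := n) (fun d => m * ∑ z', g (bc x) (bc y) (bc z) d z')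
                (fun d => mul_nonneg hm0 (n1 _ _ _ d))
                (fun u => ∑ w, g (bc x) (bc y) (bc z) (bc u) (bc w)) (fun u =>
                  bc_ge (n := n) (fun e => g (bc x) (bc y) (bc z) (bc u) e) (fun e => g0 _ _ _ _ e) _
                    (fun w => le_rfl))
              rwa [← mul_sum] at this)
          simp only [← mul_sum] at this
          exact this)
      simp only [← mul_sum] at this
      exact this)
  simp only [← mul_sum] at key
  have ht : ∑ a, ∑ b, ∑ x, ∑ y, ∑ z, g a b x y z = 22680 := tot_real
  rw [ht] at key
  refine le_trans (le_of_eq ?_) key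
  rw [← hm]; ring

theorem bern_aux (N m : ℝ) (hN : 8 ≤ N) (h : N ≤ 9 * m + 8) :
    280/729 * N^5 - 16 * N^4 ≤ 22680 * m^5 := by
  have hm : (N - 8)/9 ≤ m := by linarith
  have h1 : ((N - 8)/9)^5 ≤ m^5 := pow_le_pow_left₀ (by linarith) hm 5
  have h2 : N^5 - 40 * N^4 ≤ (N - 8)^5 := by
    have e : (N - 8)^5 - (N^5 - 40 * N^4) = (N-8) * (640 * N^2 + 0) + 0 + (-5120 * N^2 + 5120 * N^2) + 20480 * N - 32768 := by ring
    have : 0 ≤ (N-8) * (640 * N^2) := mul_nonneg (by linarith) (by positivity)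
    nlinarith
  have h4 : 0 ≤ N^4 := by positivity
  have e : ((N - 8)/9)^5 = (N-8)^5/59049 := by ring
  rw [e] at h1
  linarith

theorem bal_num (hn : 8 ≤ n) :
    280/729 * (n:ℝ)^5 - 28 * (n:ℝ)^4 ≤ 120 * (numKL 5 2 (patG (bc : Fin n → _)) : ℝ) := by
  have h1 := num_ge (patG (bc : Fin n → _))
  have h2 := bal_ge (n := n)
  have h3 := bern_aux (n:ℝ) ((n/9 : ℕ):ℝ) (by exact_mod_cast hn) (by
    have : n ≤ 9 * (n/9) + 8 := by omega
    exact_mod_cast this)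
  linarith
end final
end EI

namespace EI
set_option linter.unusedSectionVars false
set_option linter.unusedVariables false
section final2
variable {n : ℕ}

theorem dW_le_sq (G : SimpleGraph (Fin n)) : dW G ≤ n^2 := by
  refine (dW_le G (fun _ => (0, 0))).trans ?_
  unfold Wr
  refine (card_le_univ _).trans ?_
  rw [Fintype.card_prod, Fintype.card_fin, sq]

theorem max_arith {N L c : ℝ} (hN : 10^83 ≤ N) (hc : c = 1/10^83)
    (h : 280/729 * N^5 - 28 * N^4 ≤ 120 * (L + c * N^5)) :
    (280/729 - 1/10^80) * N^5 + 24 * N^4 + 48 * c * N^5 ≤ 120 * L := by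
  have hN0 : (0:ℝ) ≤ N := le_trans (by norm_num) hN
  have h4 : 0 ≤ N^4 := pow_nonneg hN0 4
  have h5 : 10^83 * N^4 ≤ N^5 := by
    have : N^5 = N * N^4 := by ring
    rw [this]; exact mul_le_mul_of_nonneg_right hN h4
  have h6 : N^4 ≤ c * N^5 := by
    rw [hc]
    have : N^4 = 1/10^83 * (10^83 * N^4) := by ring
    rw [this]; exact mul_le_mul_of_nonneg_left h5 (by norm_num)
  have h7 : 1/10^80 * N^5 = 1000 * (c * N^5) := by rw [hc]; ring
  have h8 : 0 ≤ c * N^5 := h4.trans h6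
  have e : (280/729 - 1/10^80) * N^5 = 280/729 * N^5 - 1/10^80 * N^5 := by ring
  rw [e, h7]
  linarith

theorem cancel_N {N a R : ℝ} (hN : 0 < N) (h : a * N^5 ≤ N * R) : a * N^4 ≤ R := by
  have : N * (a * N^4) ≤ N * R := by
    refine le_trans (le_of_eq ?_) h
    ring
  exact le_of_mul_le_mul_left this hN

/-- the extremal comparison -/
theorem exists_opt (hn : (10:ℝ)^83 ≤ n) : ∃ G0 : SimpleGraph (Fin n), ∀ G : SimpleGraph (Fin n),
    (numKL 5 2 G : ℝ) + 1/10^83 * (n:ℝ)^3 * dW G ≤ numKL 5 2 G0 := by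
  obtain ⟨c0, hc0⟩ : ∃ c : ℝ, c = 1/10^83 := ⟨_, rfl⟩
  rw [← hc0]
  have hcp : 0 < c0 := by rw [hc0]; norm_num
  obtain ⟨N, hN⟩ : ∃ N : ℝ, N = n := ⟨_, rfl⟩
  rw [← hN] at hn ⊢
  have hNp : 0 < N := lt_of_lt_of_le (by norm_num) hn
  have hn1000 : 1000 ≤ n := by
    have : (1000:ℝ) ≤ n := by rw [← hN]; exact le_trans (by norm_num) hn
    exact_mod_cast this
  have hcN : 0 ≤ c0 * N^3 := mul_nonneg hcp.le (pow_nonneg hNp.le 3)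
  obtain ⟨G0, hG0⟩ := Finite.exists_max (fun G : SimpleGraph (Fin n) => (numKL 5 2 G : ℝ) + c0 * N^3 * dW G)
  refine ⟨G0, ?_⟩
  suffices hd : dW G0 = 0 by
    intro G
    have := hG0 G
    simp only [hd, Nat.cast_zero, mul_zero, add_zero] at this
    exact this
  -- comparison principle
  have cmp : ∀ (H : SimpleGraph (Fin n)) (k : ℝ), (dG G0 H : ℝ) ≤ k →
      (numKL 5 2 H : ℝ) ≤ numKL 5 2 G0 + c0 * N^3 * k := by
    intro H k hk
    have h1 := hG0 H
    have h2 : (dW G0 : ℝ) ≤ dW H + dG G0 H := by exact_mod_cast dW_lip G0 H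
    have h3 : c0 * N^3 * dW G0 ≤ c0 * N^3 * (dW H + k) := mul_le_mul_of_nonneg_left (by linarith) hcN
    rw [mul_add] at h3
    linarith
  have hbal := bal_num (n := n) (by omega)
  rw [← hN] at hbal
  have hL : 280/729 * N^5 - 28 * N^4 ≤ 120 * ((numKL 5 2 G0 : ℝ) + c0 * N^5) := by
    have h1 := hG0 (patG bc)
    have h2 : (dW G0 : ℝ) ≤ N^2 := by rw [hN]; exact_mod_cast dW_le_sq G0
    have h3 : c0 * N^3 * dW G0 ≤ c0 * N^3 * N^2 := mul_le_mul_of_nonneg_left h2 hcN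
    have h4 : 0 ≤ c0 * N^3 * dW (patG (bc : Fin n → _)) := mul_nonneg hcN (Nat.cast_nonneg _)
    have e : c0 * N^3 * N^2 = c0 * N^5 := by ring
    rw [e] at h3
    linarith
  have hA := max_arith hn hc0 hL
  have p4 : 0 ≤ N^4 := pow_nonneg hNp.le 4
  have p5 : 0 ≤ c0 * N^5 := mul_nonneg hcp.le (pow_nonneg hNp.le 5)
  have hT : (280/729 - 1/10^80) * N^5 ≤ S5 (fun _ => 1) (E5 G0) := by
    have := num_le G0
    linarith
  have hTx : ∀ x, (280/729 - 1/10^80) * N^4 ≤ ∑ y, ∑ z, ∑ u, ∑ w, E5 G0 x y z u w := by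
    intro x
    apply cancel_N hNp
    have hxy : ∀ y, Lx G0 y ≤ Lx G0 x + N^3 + c0 * N^3 * (2 * N) := by
      intro y
      by_cases h : x = y
      · subst h
        have q1 : 0 ≤ N^3 := pow_nonneg hNp.le 3
        have q2 : 0 ≤ c0 * N^3 * (2 * N) := mul_nonneg hcN (by linarith)
        linarith
      · have h1 := clone_gain G0 x y h
        have h2 := cmp (cloneG G0 x y) (2 * N) (by rw [hN]; exact_mod_cast dG_clone G0 x y)
        rw [← hN] at h1
        linarith
    have h1 := sum_le_sum fun y (_ : y ∈ (univ : Finset (Fin n))) => hxy y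
    rw [sum_Lx, sum_const, card_univ, Fintype.card_fin, nsmul_eq_mul, ← hN] at h1
    have h2 := mul_le_mul_of_nonneg_left (rooted_le G0 x) hNp.le
    have e : N * (Lx G0 x + N^3 + c0 * N^3 * (2 * N)) = N * Lx G0 x + N^4 + 2 * (c0 * N^5) := by ring
    rw [e] at h1
    have e2 : N * (24 * Lx G0 x) = 24 * (N * Lx G0 x) := by ring
    rw [e2] at h2
    linarith
  have hcard : 0 < Fintype.card (Fin n) := by rw [Fintype.card_fin]; omega
  have hreg : Reg G0 := by
    refine reg_of_rooted G0 hcard ?_ ?_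
    · rw [Fintype.card_fin, ← hN]; exact hT
    · rw [Fintype.card_fin, ← hN]; exact hTx
  obtain ⟨c, hc⟩ := exists_cls hreg hcard
  have hW : Wr G0 c = 0 := by
    unfold Wr
    rw [card_eq_zero, filter_eq_empty_iff]
    rintro ⟨u, v⟩ _ ⟨huv, hw⟩
    simp only at huv hw
    have h1 := flip_gain G0 c hc hn1000 u v huv.ne hw
    have h2 := cmp (flipG G0 u v huv.ne) 2 (by exact_mod_cast dG_flip G0 u v huv.ne)
    rw [← hN] at h1
    have h3 : 0 < N^3 := pow_pos hNp 3
    have h4 : c0 * N^3 * 2 < N^3/1000 := by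
      rw [hc0]
      have : (1/10^83 * N^3 * 2 : ℝ) = (2/10^83) * N^3 := by ring
      rw [this]
      have : N^3/1000 = (1/1000) * N^3 := by ring
      rw [this]
      exact mul_lt_mul_of_pos_right (by norm_num) h3
    linarith
  have := dW_le G0 c
  omega

theorem lam_le_max (G : SimpleGraph (Fin n)) : lamKL 5 2 G ≤ lamKLmax 5 2 n :=
  le_ciSup (f := fun G : SimpleGraph (Fin n) => lamKL 5 2 G) (Set.finite_range _).bddAbove G

theorem stab_part (n : ℕ) (hn : (10:ℝ)^83 ≤ n) (G : SimpleGraph (Fin n)) :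
    (distToFam G isBlowup3K3 : ℝ) ≤ 10^83 * (lamKLmax 5 2 n - lamKL 5 2 G) * (n:ℝ)^2 := by
  obtain ⟨G0, hG0⟩ := exists_opt hn
  have h1 := hG0 G
  have h2 := lam_le_max G0
  have hd : (distToFam G isBlowup3K3 : ℝ) ≤ dW G := by exact_mod_cast dist_le_dW G
  have hnp : (0:ℝ) < n := lt_of_lt_of_le (by norm_num) hn
  have hn5 : 5 ≤ n := by
    have : (5:ℝ) ≤ n := le_trans (by norm_num) hn
    exact_mod_cast this
  have hcp : (0:ℝ) < (n.choose 5 : ℝ) := by exact_mod_cast Nat.choose_pos hn5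
  have hc5 : (n.choose 5 : ℝ) ≤ (n:ℝ)^5 := by exact_mod_cast Nat.choose_le_pow n 5
  have hd0 : (0:ℝ) ≤ dW G := Nat.cast_nonneg _
  have h3 : (1/10^83 * (n:ℝ)^3 * dW G) / (n.choose 5 : ℝ) ≤ lamKLmax 5 2 n - lamKL 5 2 G := by
    have : (1/10^83 * (n:ℝ)^3 * dW G) / (n.choose 5 : ℝ) ≤ lamKL 5 2 G0 - lamKL 5 2 G := by
      unfold lamKL
      rw [← sub_div]
      exact div_le_div_of_nonneg_right (by linarith) hcp.le
    linarith
  have h4 : (1/10^83 * (n:ℝ)^3 * dW G) / (n:ℝ)^5 ≤ (1/10^83 * (n:ℝ)^3 * dW G) / (n.choose 5 : ℝ) :=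
    div_le_div_of_nonneg_left (mul_nonneg (mul_nonneg (by norm_num) (pow_nonneg hnp.le 3)) hd0) hcp hc5
  have h5 := mul_le_mul_of_nonneg_right (mul_le_mul_of_nonneg_left (h4.trans h3) (by norm_num : (0:ℝ) ≤ 10^83))
    (pow_nonneg hnp.le 2)
  refine hd.trans (le_trans (le_of_eq ?_) h5)
  have : (n:ℝ) ≠ 0 := hnp.ne'
  field_simp

theorem choose_lower (n : ℕ) (hn : 5 ≤ n) : (n:ℝ)^5 - 10 * (n:ℝ)^4 ≤ 120 * (n.choose 5 : ℝ) := by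
  have h := Nat.descFactorial_eq_factorial_mul_choose n 5
  have h2 : (n.descFactorial 5 : ℝ) = 120 * (n.choose 5 : ℝ) := by
    rw [h]; push_cast; norm_num [Nat.factorial]
  rw [← h2]
  obtain ⟨k, rfl⟩ := Nat.exists_eq_add_of_le hn
  simp only [Nat.descFactorial_succ, Nat.descFactorial_zero, Nat.sub_zero, mul_one]
  have e0 : 5 + k - 4 = k + 1 := by omega
  have e1 : 5 + k - 3 = k + 2 := by omega
  have e2 : 5 + k - 2 = k + 3 := by omega
  have e3 : 5 + k - 1 = k + 4 := by omega
  rw [e0, e1, e2, e3]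
  push_cast
  have : (0:ℝ) ≤ k := Nat.cast_nonneg k
  have k2 : (0:ℝ) ≤ (k:ℝ)^2 := by positivity
  have k3 : (0:ℝ) ≤ (k:ℝ)^3 := by positivity
  have e : ((k:ℝ)+1)*((k+2)*((k+3)*((k+4)*(5+k)))) - ((5+k)^5 - 10*(5+k)^4) =
      35*k^3 + 475 * k^2 + 2149 * k + 3245 := by ring
  nlinarith

theorem choose_upper (n : ℕ) : 120 * (n.choose 5 : ℝ) ≤ (n:ℝ)^5 := by
  have h := Nat.descFactorial_eq_factorial_mul_choose n 5
  have h2 : (n.descFactorial 5 : ℝ) = 120 * (n.choose 5 : ℝ) := by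
    rw [h]; push_cast; norm_num [Nat.factorial]
  rw [← h2]
  exact_mod_cast Nat.descFactorial_le_pow n 5

theorem max_upper (n : ℕ) (hn : 11 ≤ n) : lamKLmax 5 2 n ≤ 280/729 * (1 / (1 - 10 / (n:ℝ))) := by
  have hnr : (11:ℝ) ≤ n := by exact_mod_cast hn
  have hnp : (0:ℝ) < n := by linarith
  refine ciSup_le fun G => ?_
  have h1 := num_upper G
  have h2 := choose_lower n (by omega)
  have hcp : (0:ℝ) < (n.choose 5 : ℝ) := by exact_mod_cast Nat.choose_pos (by omega : 5 ≤ n)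
  have e : (1:ℝ) - 10/n = (n - 10)/n := by field_simp
  unfold lamKL
  rw [e, one_div_div, div_le_iff₀ hcp]
  have hp : (0:ℝ) < n - 10 := by linarith
  have h3 : (n:ℝ)^5 ≤ (n:ℝ)/(n-10) * (120 * (n.choose 5 : ℝ)) := by
    rw [div_mul_eq_mul_div, le_div_iff₀ hp]
    have := mul_le_mul_of_nonneg_left h2 hnp.le
    refine le_trans (le_of_eq ?_) this
    ring
  have h4 : 280/729 * (n:ℝ)^5 ≤ 280/729 * ((n:ℝ)/(n-10) * (120 * (n.choose 5 : ℝ))) :=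
    mul_le_mul_of_nonneg_left h3 (by norm_num)
  have e2 : 280/729 * ((n:ℝ)/(n-10) * (120 * (n.choose 5 : ℝ))) = 120 * (280/729 * ((n:ℝ)/(n-10)) * (n.choose 5 : ℝ)) := by ring
  rw [e2] at h4
  linarith

theorem max_lower (n : ℕ) (hn : 100 ≤ n) : 280/729 - 28 / (n:ℝ) ≤ lamKLmax 5 2 n := by
  have hnr : (100:ℝ) ≤ n := by exact_mod_cast hn
  have hnp : (0:ℝ) < n := by linarith
  refine le_trans ?_ (lam_le_max (patG bc))
  have h1 := bal_num (n := n) (by omega)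
  have h2 := choose_upper n
  have hcp : (0:ℝ) < (n.choose 5 : ℝ) := by exact_mod_cast Nat.choose_pos (by omega : 5 ≤ n)
  unfold lamKL
  rw [le_div_iff₀ hcp]
  have h0 : 0 ≤ 280/729 - 28 / (n:ℝ) := by
    have : 28 / (n:ℝ) ≤ 28/100 := div_le_div_of_nonneg_left (by norm_num) (by norm_num) hnr
    norm_num at this ⊢
    linarith
  have h3 := mul_le_mul_of_nonneg_left h2 h0
  have e : (280/729 - 28 / (n:ℝ)) * (n:ℝ)^5 = 280/729 * (n:ℝ)^5 - 28 * (n:ℝ)^4 := by field_simp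
  rw [e] at h3
  linarith

theorem lim_part : Filter.Tendsto (fun n => lamKLmax 5 2 n) Filter.atTop (nhds (280/729)) := by
  have hinv : ∀ a : ℝ, Filter.Tendsto (fun n : ℕ => a / (n:ℝ)) Filter.atTop (nhds 0) :=
    fun a => tendsto_const_div_atTop_nhds_zero_nat a
  have hl : Filter.Tendsto (fun n : ℕ => 280/729 - 28 / (n:ℝ)) Filter.atTop (nhds (280/729)) := by
    have := (tendsto_const_nhds (x := (280/729:ℝ)) (f := Filter.atTop)).sub (hinv 28)
    simpa using this
  have hu : Filter.Tendsto (fun n : ℕ => 280/729 * (1 / (1 - 10 / (n:ℝ)))) Filter.atTop (nhds (280/729)) := by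
    have h1 := (tendsto_const_nhds (x := (1:ℝ)) (f := Filter.atTop)).sub (hinv 10)
    have h2 := ((tendsto_const_nhds (x := (1:ℝ)) (f := Filter.atTop)).div h1 (by norm_num)).const_mul (280/729:ℝ)
    simpa using h2
  refine tendsto_of_tendsto_of_tendsto_of_le_of_le' hl hu ?_ ?_
  · filter_upwards [Filter.eventually_ge_atTop 100] with n hn using max_lower n hn
  · filter_upwards [Filter.eventually_ge_atTop 100] with n hn using max_upper n (by omega)

end final2
end EI

theorem edge_inducibility_5_2 :
    Filter.Tendsto (fun n => lamKLmax 5 2 n) Filter.atTop (nhds (280/729)) ∧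
    ∃ C : ℝ, 0 < C ∧ ∀ n : ℕ, (C ≤ n) → ∀ G : SimpleGraph (Fin n),
      (distToFam G isBlowup3K3 : ℝ) ≤ C * (lamKLmax 5 2 n - lamKL 5 2 G) * n ^ 2 := by
  refine ⟨EI.lim_part, 10^83, by norm_num, ?_⟩
  intro n hn G
  exact EI.stab_part n hn G
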